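/- arXiv:math/0407322 — 2 statements merged into one kernel-verified Lean document; each statement's English description precedes it below -/
import Mathlib

section
/- Corollary. Let r > 0, 0 < ε ≤ r/3 and y ≥ 1. If a ∈ 𝓕(2r/3 + ε, r, y), then c_n ∼ (e^{nσ_n} / √(2π B_n²)) · Π_{j=1}^n (1 − e^{−jσ_n})^{−a_j} as n → ∞. -/
open Finset Filter

/-- The number of multisets of total size `n` determined by the parameters `a j`
(the number of one-component multisets of size `j`), i.e.
`c_n = Σ_{η ∈ Ω_n} Π_{j=1}^n C(a_j + η_j - 1, η_j)` where
`Ω_n = {η : Σ_{j=1}^n j·η_j = n}` (indices shifted: `j ∈ Fin n` stands for `j+1`). -/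
def multisetCount (a : ℕ → ℕ) (n : ℕ) : ℕ :=
  ∑ η : Fin n → Fin (n + 1),
    if ∑ j : Fin n, (j.1 + 1) * (η j).1 = n then
      ∏ j : Fin n, Nat.choose (a (j.1 + 1) + (η j).1 - 1) (η j).1
    else 0

/-- `M_n(σ) = Σ_{j=1}^n j a_j e^{-jσ}/(1-e^{-jσ})`. -/
noncomputable def Mfun (a : ℕ → ℕ) (n : ℕ) (σ : ℝ) : ℝ :=
  ∑ j ∈ Finset.Icc 1 n, (j : ℝ) * (a j) * Real.exp (-(j * σ)) / (1 - Real.exp (-(j * σ)))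

/-- `B_n²(σ) = Σ_{j=1}^n j² a_j e^{-jσ}/(1-e^{-jσ})²`. -/
noncomputable def B2 (a : ℕ → ℕ) (n : ℕ) (σ : ℝ) : ℝ :=
  ∑ j ∈ Finset.Icc 1 n, (j : ℝ) ^ 2 * (a j) * Real.exp (-(j * σ)) / (1 - Real.exp (-(j * σ))) ^ 2

/-- `a ∈ 𝓕(r₁, r₂, y)`: there are `γ₁, γ₂ > 0` with
`γ₁ j^{r₁-1} y^j ≤ a_j ≤ γ₂ j^{r₂-1} y^j` for all `j ≥ 1`. -/
def FCond (a : ℕ → ℕ) (r₁ r₂ y : ℝ) : Prop :=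
  ∃ γ₁ γ₂ : ℝ, 0 < γ₁ ∧ 0 < γ₂ ∧ ∀ j : ℕ, 1 ≤ j →
    γ₁ * (j : ℝ) ^ (r₁ - 1) * y ^ j ≤ (a j : ℝ) ∧ (a j : ℝ) ≤ γ₂ * (j : ℝ) ^ (r₂ - 1) * y ^ j

lemma hasSum_conv {E : Type*} [AddCommMonoid E] [TopologicalSpace E] {f g : ℕ → E} {u v : E}
    (h : HasSum f u) (hfg : ∀ k, g k = f k) (huv : v = u) : HasSum g v := by
  rw [huv, funext hfg]
  exact h

lemma count_eq_piFinset (a : ℕ → ℕ) (n K : ℕ) (hK : n + 1 ≤ K) :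
    multisetCount a n = ∑ η ∈ Fintype.piFinset (fun _ : Fin n => Finset.range K),
      if ∑ j : Fin n, (j.1 + 1) * η j = n then
        ∏ j : Fin n, Nat.choose (a (j.1 + 1) + η j - 1) (η j) else 0 := by
  unfold multisetCount
  refine Finset.sum_of_injOn (fun (η : Fin n → Fin (n+1)) (j : Fin n) => (η j).1) ?_ ?_ ?_ ?_
  · intro x _ y _ h
    funext j
    exact Fin.ext (congrFun h j)
  · intro x _
    simp only [Finset.mem_coe, Fintype.mem_piFinset, Finset.mem_range]
    intro j
    exact lt_of_lt_of_le (x j).2 hK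
  · intro η _ h
    rw [if_neg]
    intro hs
    apply h
    have hle : ∀ j, η j < n + 1 := by
      intro j
      have h1 : (j.1 + 1) * η j ≤ ∑ j : Fin n, (j.1 + 1) * η j :=
        Finset.single_le_sum (f := fun j : Fin n => (j.1 + 1) * η j)
          (fun _ _ => Nat.zero_le _) (Finset.mem_univ j)
      have h2 : η j ≤ (j.1 + 1) * η j := Nat.le_mul_of_pos_left _ (Nat.succ_pos _)
      omega
    exact ⟨fun j => ⟨η j, hle j⟩, by simp, rfl⟩
  · intro η _
    rfl

lemma integral_exp_int (n m : ℕ) (σ : ℝ) :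
    ∫ t in (-Real.pi)..Real.pi, Complex.exp (-(n * t * Complex.I)) *
      Complex.exp (-σ + t * Complex.I) ^ m
      = if m = n then 2 * Real.pi * Complex.exp (-(n * σ)) else 0 := by
  have h1 : ∀ t : ℝ, Complex.exp (-(n * t * Complex.I)) * Complex.exp (-σ + t * Complex.I) ^ m
      = Complex.exp (-(m * σ)) * Complex.exp (((m : ℂ) - n) * Complex.I * t) := by
    intro t
    rw [← Complex.exp_nat_mul, ← Complex.exp_add, ← Complex.exp_add]
    congr 1
    ring
  simp only [h1]
  rw [intervalIntegral.integral_const_mul]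
  split_ifs with h
  · subst h
    simp
    ring
  · have hc : ((m : ℂ) - n) * Complex.I ≠ 0 := by
      apply mul_ne_zero _ Complex.I_ne_zero
      rw [sub_ne_zero]
      exact_mod_cast h
    rw [integral_exp_mul_complex hc]
    have : Complex.exp (((m : ℂ) - n) * Complex.I * (Real.pi : ℝ))
        = Complex.exp (((m : ℂ) - n) * Complex.I * ((-Real.pi : ℝ) : ℂ)) := by
      rw [Complex.exp_eq_exp_iff_exists_int]
      refine ⟨(m : ℤ) - n, ?_⟩
      push_cast
      ring
    rw [this]
    simp

lemma hasSum_negbin (A : ℕ) (hA : 1 ≤ A) (z : ℂ) (hz : ‖z‖ < 1) :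
    HasSum (fun k : ℕ => (Nat.choose (A + k - 1) k : ℂ) * z ^ k) ((1 / (1 - z)) ^ A) := by
  have h := hasSum_choose_mul_geometric_of_norm_lt_one (A - 1) hz
  rw [Nat.sub_add_cancel hA] at h
  rw [one_div_pow]
  refine hasSum_conv h (fun k => ?_) rfl
  congr 2
  have : A + k - 1 = k + (A - 1) := by omega
  rw [this, Nat.choose_symm_add]

lemma fourier_id (a : ℕ → ℕ) (n : ℕ) (σ : ℝ) (hσ : 0 < σ) (ha : ∀ j, 1 ≤ j → 1 ≤ a j) :
    ∫ t in (-Real.pi)..Real.pi, Complex.exp (-(n * t * Complex.I)) *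
      ∏ j : Fin n, (1 / (1 - Complex.exp (-σ + t * Complex.I) ^ (j.1 + 1))) ^ a (j.1 + 1)
      = 2 * Real.pi * Complex.exp (-(n * σ)) * multisetCount a n := by
  set z : ℝ → ℂ := fun t => Complex.exp (-σ + t * Complex.I) with hzdef
  have hznorm : ∀ t, ‖z t‖ = Real.exp (-σ) := by
    intro t
    simp [hzdef, Complex.norm_exp]
  have hlt : Real.exp (-σ) < 1 := by simpa using hσ
  have hzc : Continuous z := by simp only [hzdef]; fun_prop
  set f : ℕ → ℝ → ℂ := fun K t => Complex.exp (-(n * t * Complex.I)) *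
    ∏ j : Fin n, ∑ k ∈ Finset.range K, (Nat.choose (a (j.1+1) + k - 1) k : ℂ) * (z t ^ (j.1+1)) ^ k
    with hf
  have hfint : ∀ K, n + 1 ≤ K → ∫ t in (-Real.pi)..Real.pi, f K t =
      2 * Real.pi * Complex.exp (-(n * σ)) * multisetCount a n := by
    intro K hK
    have e1 : ∀ t, f K t = ∑ η ∈ Fintype.piFinset (fun _ : Fin n => Finset.range K),
        ((∏ j : Fin n, Nat.choose (a (j.1 + 1) + η j - 1) (η j) : ℕ) : ℂ) *
          (Complex.exp (-(n * t * Complex.I)) * z t ^ (∑ j : Fin n, (j.1 + 1) * η j)) := by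
      intro t
      simp only [hf]
      rw [Finset.prod_univ_sum, Finset.mul_sum]
      refine Finset.sum_congr rfl fun η _ => ?_
      rw [Finset.prod_mul_distrib, ← Finset.prod_pow_eq_pow_sum]
      push_cast
      simp only [pow_mul]
      ring
    simp only [e1]
    rw [intervalIntegral.integral_finsetSum]
    · simp only [intervalIntegral.integral_const_mul, hzdef, integral_exp_int]
      rw [count_eq_piFinset a n K hK]
      push_cast
      rw [Finset.mul_sum]
      refine Finset.sum_congr rfl fun η _ => ?_
      split_ifs
      · ring
      · simp
    · intro η _
      apply Continuous.intervalIntegrable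
      fun_prop
  have hlim : Tendsto (fun K => ∫ t in (-Real.pi)..Real.pi, f K t) atTop
      (nhds (∫ t in (-Real.pi)..Real.pi, Complex.exp (-(n * t * Complex.I)) *
      ∏ j : Fin n, (1 / (1 - z t ^ (j.1 + 1))) ^ a (j.1 + 1))) := by
    have hrn : ∀ (t : ℝ) (j : Fin n), ‖z t ^ (j.1+1)‖ < 1 := by
      intro t j
      rw [norm_pow, hznorm]
      exact pow_lt_one₀ (Real.exp_pos _).le hlt (Nat.succ_ne_zero _)
    apply intervalIntegral.tendsto_integral_filter_of_dominated_convergence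
      (fun _ => ∏ j : Fin n, ∑' k : ℕ, (Nat.choose (a (j.1+1) + k - 1) k : ℝ) *
        (Real.exp (-σ) ^ (j.1+1)) ^ k)
    · refine Eventually.of_forall fun K => ?_
      apply Continuous.aestronglyMeasurable
      simp only [hf]
      fun_prop
    · refine Eventually.of_forall fun K => Eventually.of_forall fun t _ => ?_
      simp only [hf]
      rw [norm_mul, norm_prod]
      have : ‖Complex.exp (-(n * t * Complex.I))‖ = 1 := by
        simp [Complex.norm_exp]
      rw [this, one_mul]
      refine Finset.prod_le_prod (fun _ _ => norm_nonneg _) fun j _ => ?_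
      have hs : Summable (fun k : ℕ => (Nat.choose (a (j.1+1) + k - 1) k : ℝ) *
        (Real.exp (-σ) ^ (j.1+1)) ^ k) := by
        have := (hasSum_negbin (a (j.1+1)) (ha _ (by omega)) (z t ^ (j.1+1)) (hrn t j)).summable.norm
        simpa [hznorm] using this
      refine (norm_sum_le _ _).trans ?_
      refine le_trans (le_of_eq ?_) (hs.sum_le_tsum (Finset.range K) fun k _ => by positivity)
      refine Finset.sum_congr rfl fun k _ => ?_
      simp [hznorm]
    · exact intervalIntegrable_const
    · refine Eventually.of_forall fun t _ => ?_
      refine Tendsto.const_mul _ (tendsto_finsetProd _ fun j _ => ?_)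
      exact (hasSum_negbin (a (j.1+1)) (ha _ (by omega)) (z t ^ (j.1+1)) (hrn t j)).tendsto_sum_nat
  refine tendsto_nhds_unique hlim ?_
  refine tendsto_const_nhds.congr' ?_
  filter_upwards [eventually_ge_atTop (n+1)] with K hK
  exact (hfint K hK).symm

lemma exp_taylor3 (x : ℝ) :
    ‖Complex.exp (x * Complex.I) - 1 - x * Complex.I + x ^ 2 / 2‖ ≤ 4 * |x| ^ 3 := by
  by_cases hx : |x| ≤ 1
  · have h := Complex.norm_exp_sub_sum_le_norm_mul_exp (x * Complex.I) 3
    have e : Complex.exp (x * Complex.I) - ∑ m ∈ Finset.range 3, (x * Complex.I) ^ m / (m.factorial : ℂ)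
        = Complex.exp (x * Complex.I) - 1 - x * Complex.I + x ^ 2 / 2 := by
      simp [Finset.sum_range_succ, Nat.factorial, mul_pow]
      ring
    rw [e] at h
    refine h.trans ?_
    have hn : ‖(x : ℂ) * Complex.I‖ = |x| := by simp
    rw [hn, mul_comm]
    gcongr
    calc Real.exp |x| ≤ Real.exp 1 := Real.exp_le_exp.2 hx
      _ ≤ 4 := by linarith [Real.exp_one_lt_d9]
  · push Not at hx
    have h1 : ‖Complex.exp (x * Complex.I) - 1 - x * Complex.I + x ^ 2 / 2‖ ≤
        1 + 1 + |x| + |x| ^ 2 / 2 := by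
      refine (norm_add_le _ _).trans ?_
      gcongr
      · refine (norm_sub_le _ _).trans ?_
        gcongr
        · refine (norm_sub_le _ _).trans ?_
          rw [Complex.norm_exp_ofReal_mul_I]
          simp
        · simp
      · simp
    refine h1.trans ?_
    have h2 : |x| ≤ |x| ^ 3 := by nlinarith [sq_nonneg (|x| - 1), mul_pos (sub_pos.2 hx) (sub_pos.2 hx)]
    have h3 : |x| ^ 2 ≤ |x| ^ 3 := by nlinarith [sq_nonneg (|x|)]
    linarith

lemma chf_taylor (q θ : ℝ) (hq0 : 0 < q) (hq1 : q < 1) :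
    ∃ w : ℂ, ((1 - q : ℝ) : ℂ) * (1 / (1 - q * Complex.exp (θ * Complex.I))) =
      Complex.exp (((θ * (q / (1 - q)) : ℝ) : ℂ) * Complex.I
        - ((θ ^ 2 / 2 * (q / (1 - q) ^ 2) : ℝ) : ℂ) + w) ∧
      ‖w‖ ≤ 8 * (|θ| ^ 3 * (q / (1 - q) ^ 3)) := by
  have hqn : ‖(q : ℝ)‖ < 1 := by rw [Real.norm_eq_abs, abs_of_pos hq0]; exact hq1
  have hqc : ‖(q : ℂ)‖ < 1 := by simpa using hqn
  have hzn : ‖(q : ℂ) * Complex.exp (θ * Complex.I)‖ < 1 := by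
    rw [norm_mul, Complex.norm_exp_ofReal_mul_I, mul_one]; exact hqc
  have s1 := Complex.hasSum_taylorSeries_neg_log hzn
  have s2 := Complex.hasSum_taylorSeries_neg_log hqc
  have s3 : HasSum (fun k : ℕ => (q : ℂ) ^ k) ((1 - (q:ℂ))⁻¹) := hasSum_geometric_of_norm_lt_one hqc
  have s4 : HasSum (fun k : ℕ => (k : ℂ) * (q : ℂ) ^ k) (q / (1 - (q:ℂ)) ^ 2) :=
    hasSum_coe_mul_geometric_of_norm_lt_one hqc
  have h1q : (0:ℝ) < 1 - q := by linarith
  have hne : (1 - (q:ℂ)) ≠ 0 := by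
    have : ((1 - q : ℝ) : ℂ) ≠ 0 := by exact_mod_cast h1q.ne'
    simpa using this
  have hne2 : (1 - (q:ℂ) * Complex.exp (θ * Complex.I)) ≠ 0 := by
    intro h
    rw [sub_eq_zero] at h
    rw [← h] at hzn
    simp at hzn
  -- the geometric series without its zeroth term
  have s3' : HasSum (fun k : ℕ => if k = 0 then (0:ℂ) else (q : ℂ) ^ k) ((1 - (q:ℂ))⁻¹ - 1) := by
    have := s3.sub (hasSum_ite_eq (0:ℕ) (1:ℂ))
    refine hasSum_conv this (fun k => ?_) rfl
    by_cases hk : k = 0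
    · simp [hk]
    · simp [hk]
  set L : ℂ := -Complex.log (1 - q * Complex.exp (θ * Complex.I)) - -Complex.log (1 - q) with hL
  have sL := ((s1.sub s2).sub (s3'.mul_left (θ * Complex.I))).add (s4.mul_left ((θ:ℂ) ^ 2 / 2))
  set w : ℂ := L - θ * Complex.I * ((1 - (q:ℂ))⁻¹ - 1) + (θ:ℂ) ^ 2 / 2 * (q / (1 - (q:ℂ)) ^ 2) with hw
  refine ⟨w, ?_, ?_⟩
  · have e : (((θ * (q / (1 - q)) : ℝ) : ℂ) * Complex.I
        - ((θ ^ 2 / 2 * (q / (1 - q) ^ 2) : ℝ) : ℂ) + w) = L := by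
      rw [hw]
      push_cast
      field_simp
      ring
    rw [e, hL, sub_neg_eq_add, Complex.exp_add, Complex.exp_neg, Complex.exp_log hne,
      Complex.exp_log hne2]
    push_cast
    field_simp
  · -- remainder
    have sq : HasSum (fun k : ℕ => 8 * (|θ| ^ 3 * (((k + 2).choose 2 : ℝ) * q ^ (k+1))))
        (8 * (|θ| ^ 3 * (q / (1 - q) ^ 3))) := by
      have := hasSum_choose_mul_geometric_of_norm_lt_one 2 hqn
      have h2 := (this.mul_left q)
      have h3 := (h2.mul_left (|θ|^3)).mul_left 8
      refine hasSum_conv h3 (fun k => ?_) ?_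
      · ring
      · ring
    have sL' := (hasSum_nat_add_iff' 1).2 sL
    simp only [Finset.range_one, Finset.sum_singleton] at sL'
    have hval : w = w - (((q : ℂ) * Complex.exp (θ * Complex.I)) ^ 0 / ((0:ℕ):ℂ) - (q:ℂ) ^ 0 / ((0:ℕ):ℂ)
          - (θ * Complex.I) * (if True then (0:ℂ) else (q : ℂ) ^ 0)
          + (θ:ℂ) ^ 2 / 2 * (((0:ℕ):ℂ) * (q:ℂ) ^ 0)) := by
      simp
    rw [← hval] at sL'
    rw [← sL'.tsum_eq]
    refine tsum_of_norm_bounded sq fun k => ?_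
    have hk : ((k:ℂ) + 1) ≠ 0 := by exact_mod_cast Nat.succ_ne_zero k
    have e : ((q : ℂ) * Complex.exp (θ * Complex.I)) ^ (k+1) / ((k+1:ℕ):ℂ) - (q:ℂ) ^ (k+1) / ((k+1:ℕ):ℂ)
          - (θ * Complex.I) * (if (k+1:ℕ) = 0 then (0:ℂ) else (q : ℂ) ^ (k+1))
          + (θ:ℂ) ^ 2 / 2 * (((k+1:ℕ):ℂ) * (q:ℂ) ^ (k+1))
        = (q:ℂ) ^ (k+1) / ((k:ℂ)+1) * (Complex.exp (((k+1) * θ : ℝ) * Complex.I) - 1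
          - ((k+1) * θ : ℝ) * Complex.I + (((k+1) * θ : ℝ):ℂ) ^ 2 / 2) := by
      have : Complex.exp (((k+1) * θ : ℝ) * Complex.I) = Complex.exp (θ * Complex.I) ^ (k+1) := by
        rw [← Complex.exp_nat_mul]
        congr 1
        push_cast
        ring
      rw [this]
      simp only [Nat.succ_ne_zero, if_false]
      push_cast
      field_simp
      ring
    rw [e, norm_mul]
    have hb := exp_taylor3 ((k+1) * θ)
    have hn : ‖(q:ℂ) ^ (k+1) / ((k:ℂ)+1)‖ = q ^ (k+1) / (k+1) := by
      rw [norm_div, norm_pow]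
      congr 1
      · simp [abs_of_pos hq0]
      · have : ((k:ℂ)+1) = ((k+1 : ℝ) : ℂ) := by push_cast; rfl
        rw [this, Complex.norm_real, Real.norm_eq_abs, abs_of_pos (by positivity)]
    rw [hn]
    refine (mul_le_mul_of_nonneg_left hb (by positivity)).trans ?_
    rw [abs_mul, abs_of_pos (by positivity : (0:ℝ) < k + 1)]
    have hch : ((k+2).choose 2 : ℝ) = (k+2) * (k+1) / 2 := by
      rw [Nat.cast_choose_two]; push_cast; ring
    rw [hch]
    have hk' : (0:ℝ) < k + 1 := by positivity
    have e2 : q ^ (k+1) / ((k:ℝ)+1) * (4 * ((k+1) * |θ|)^3) = 4 * |θ|^3 * q^(k+1) * (k+1)^2 := by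
      field_simp
    rw [e2]
    have : 8 * (|θ| ^ 3 * ((k+2:ℝ) * (k+1) / 2 * q ^ (k+1))) = 4 * |θ|^3 * q^(k+1) * ((k+2)*(k+1)) := by ring
    rw [this]
    gcongr
    nlinarith

lemma chf_norm (q θ : ℝ) (hq0 : 0 < q) (hq1 : q < 1) :
    ‖((1 - q : ℝ) : ℂ) * (1 / (1 - q * Complex.exp (θ * Complex.I)))‖ ≤
      Real.exp (-(2 / 5 * (q * Real.sin (θ / 2) ^ 2))) := by
  set s := Real.sin (θ / 2) ^ 2 with hs
  have hs0 : 0 ≤ s := sq_nonneg _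
  have hs1 : s ≤ 1 := Real.sin_sq_le_one _
  have hcos : Real.cos θ = 1 - 2 * s := by
    have := Real.cos_two_mul (θ / 2)
    rw [show 2 * (θ / 2) = θ by ring] at this
    rw [this, hs, Real.sin_sq]; ring
  have hn2 : ‖(1 : ℂ) - q * Complex.exp (θ * Complex.I)‖ ^ 2 = (1 - q) ^ 2 + 4 * q * s := by
    rw [← Complex.normSq_eq_norm_sq, Complex.normSq_apply]
    have hre : ((1 : ℂ) - q * Complex.exp (θ * Complex.I)).re = 1 - q * Real.cos θ := by
      simp [Complex.exp_ofReal_mul_I_re]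
    have him : ((1 : ℂ) - q * Complex.exp (θ * Complex.I)).im = - (q * Real.sin θ) := by
      simp [Complex.exp_ofReal_mul_I_im]
    rw [hre, him]
    have h := Real.sin_sq_add_cos_sq θ
    have : (1 - q * Real.cos θ) * (1 - q * Real.cos θ) + -(q * Real.sin θ) * -(q * Real.sin θ)
      = 1 - 2 * q * Real.cos θ + q^2 * (Real.sin θ ^ 2 + Real.cos θ ^ 2) := by ring
    rw [this, h, hcos]
    ring
  have h1q : 0 < 1 - q := by linarith
  have hpos : 0 < (1 - q) ^ 2 + 4 * q * s := by positivity
  refine le_of_sq_le_sq ?_ (Real.exp_pos _).le |> fun h => h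
  rw [norm_mul, norm_div, norm_one, mul_pow, div_pow, one_pow, hn2, Complex.norm_real,
    Real.norm_eq_abs, sq_abs, ← Real.exp_nat_mul]
  rw [mul_one_div, div_le_iff₀ hpos]
  -- exp(-x) * (1 + x*5) ≥ 1 with x = 4/5 q s
  have hx : q * s ≤ 1 := by nlinarith
  have hx0 : 0 ≤ q * s := by positivity
  set E := Real.exp (((2:ℕ):ℝ) * -(2 / 5 * (q * s))) with hE
  have hE1 : (1 - 4/5 * (q * s)) ≤ E := by
    have := Real.add_one_le_exp (((2:ℕ):ℝ) * -(2 / 5 * (q * s)))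
    push_cast at this
    rw [hE]; push_cast; linarith
  have hkey : 1 ≤ E * (1 + 4 * (q * s)) := by
    have h2 : (1 - 4/5 * (q * s)) * (1 + 4 * (q*s)) ≤ E * (1 + 4 * (q * s)) := by
      gcongr
    nlinarith
  have hE0 : 0 < E := Real.exp_pos _
  have h3 : (1-q)^2 ≤ (1-q)^2 * (E * (1 + 4 * (q * s))) := by
    have : 0 ≤ (1-q)^2 := sq_nonneg _
    nlinarith
  have h4 : (1-q)^2 ≤ 1 := by nlinarith
  have h5 : (1-q)^2 * (4 * (q*s)) ≤ 4 * (q * s) := by nlinarith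
  nlinarith [mul_le_mul_of_nonneg_left h5 hE0.le]

/-- For `1 ≤ u ≤ v ≤ K u`, powers are comparable. -/
lemma rpow_comp (p u v K : ℝ) (hu : 0 < u) (huv : u ≤ v) (hK : v ≤ K * u) :
    u ^ p ≤ K ^ |p| * v ^ p := by
  have hv : 0 < v := lt_of_lt_of_le hu huv
  have hK1 : 1 ≤ K := by
    by_contra h
    push Not at h
    nlinarith
  have h1 : (1:ℝ) ≤ K ^ |p| := Real.one_le_rpow hK1 (abs_nonneg _)
  rcases le_or_gt 0 p with hp | hp
  · have h2 : u ^ p ≤ v ^ p := Real.rpow_le_rpow hu.le huv hp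
    have h3 : 0 ≤ v ^ p := by positivity
    nlinarith
  · have h2 : (K * u) ^ p ≤ v ^ p := Real.rpow_le_rpow_of_nonpos hv hK hp.le
    rw [Real.mul_rpow (by linarith) hu.le] at h2
    rw [abs_of_neg hp]
    have h4 : K ^ (-p) * K ^ p = 1 := by
      rw [← Real.rpow_add (by linarith)]; simp
    calc u ^ p = K ^ (-p) * (K ^ p * u ^ p) := by rw [← mul_assoc, h4, one_mul]
      _ ≤ _ := by gcongr

lemma rpow_comp' (p u v K : ℝ) (hu : 0 < u) (huv : u ≤ v) (hK : v ≤ K * u) :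
    u ^ p ≤ K ^ |p| * v ^ p ∧ v ^ p ≤ K ^ |p| * u ^ p := by
  refine ⟨rpow_comp p u v K hu huv hK, ?_⟩
  have hv : 0 < v := lt_of_lt_of_le hu huv
  have hK0 : 0 < K := by
    by_contra h
    push Not at h
    nlinarith
  have h := rpow_comp (-p) u v K hu huv hK
  rw [abs_neg, Real.rpow_neg hu.le, Real.rpow_neg hv.le, inv_eq_one_div, inv_eq_one_div, mul_one_div,
    div_le_div_iff₀ (by positivity) (by positivity)] at h
  linarith

lemma sum_bound (s : ℝ) (hs : 0 < s) : ∃ C : ℝ, 0 < C ∧ ∀ (n : ℕ) (l : ℝ), 0 < l → l ≤ 1 →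
    ∑ j ∈ Finset.Icc 1 n, (j : ℝ) ^ (s - 1) * Real.exp (-(j * l)) ≤ C * (1 / l) ^ s := by
  refine ⟨2 ^ |s - 1| * Real.exp 1 * Real.Gamma s, by
    have := Real.Gamma_pos_of_pos hs; positivity, ?_⟩
  intro n l hl hl1
  set f : ℝ → ℝ := fun t => t ^ (s - 1) * Real.exp (-(l * t)) with hf
  have h_integrable : MeasureTheory.IntegrableOn f (Set.Ioi 0) := by
    have h := Real.integral_rpow_mul_exp_neg_mul_Ioi hs hl
    by_contra hc
    have h0 : ∫ t in Set.Ioi (0:ℝ), f t = 0 := MeasureTheory.integral_undef hc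
    rw [hf] at h0
    rw [h0] at h
    have := Real.Gamma_pos_of_pos hs
    have : 0 < (1 / l) ^ s * Real.Gamma s := by positivity
    linarith
  have hii : ∀ u v : ℝ, 0 ≤ u → 0 ≤ v → IntervalIntegrable f MeasureTheory.volume u v := by
    intro u v hu hv
    rw [intervalIntegrable_iff]
    refine h_integrable.mono_set ?_
    intro x hx
    rw [Set.mem_uIoc] at hx
    rcases hx with h | h
    · exact lt_of_le_of_lt hu h.1
    · exact lt_of_le_of_lt hv h.1
  have hterm : ∀ k : ℕ, ((k + 1 : ℕ) : ℝ) ^ (s - 1) * Real.exp (-((k + 1 : ℕ) * l)) ≤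
      2 ^ |s - 1| * Real.exp 1 * ∫ t in ((k + 1 : ℕ) : ℝ)..((k + 1 + 1 : ℕ) : ℝ), f t := by
    intro k
    rw [← intervalIntegral.integral_const_mul]
    have hk1 : (0:ℝ) < ((k+1 : ℕ) : ℝ) := by positivity
    have hle : ((k + 1 : ℕ) : ℝ) ≤ ((k + 1 + 1 : ℕ) : ℝ) := by push_cast; linarith
    have h := intervalIntegral.integral_mono_on (a := ((k + 1 : ℕ) : ℝ)) (b := ((k + 1 + 1 : ℕ) : ℝ))
      (μ := MeasureTheory.volume)
      (f := fun _ => ((k + 1 : ℕ) : ℝ) ^ (s - 1) * Real.exp (-((k + 1 : ℕ) * l)))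
      (g := fun t => 2 ^ |s - 1| * Real.exp 1 * f t) hle intervalIntegrable_const
      ((hii _ _ hk1.le (by positivity)).const_mul _) ?_
    · rw [intervalIntegral.integral_const] at h
      have e : ((k + 1 + 1 : ℕ) : ℝ) - ((k + 1 : ℕ) : ℝ) = 1 := by push_cast; ring
      rw [e, one_smul] at h
      exact h
    · intro x hx
      have h1 := rpow_comp (s - 1) _ x 2 hk1 hx.1 (by
        have := hx.2; push_cast at this ⊢; have : (0:ℝ) ≤ k := by positivity
        linarith)
      have h2 : Real.exp (-(((k + 1 : ℕ) : ℝ) * l)) ≤ Real.exp 1 * Real.exp (-(l * x)) := by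
        rw [← Real.exp_add, Real.exp_le_exp]
        have := hx.2
        push_cast at this ⊢
        nlinarith
      have hx0 : 0 < x := lt_of_lt_of_le hk1 hx.1
      calc _ ≤ (2 ^ |s - 1| * x ^ (s - 1)) * (Real.exp 1 * Real.exp (-(l * x))) := by gcongr
        _ = _ := by simp only [hf]; ring
  have e : ∑ j ∈ Finset.Icc 1 n, (j : ℝ) ^ (s - 1) * Real.exp (-(j * l))
      = ∑ k ∈ Finset.range n, ((k + 1 : ℕ) : ℝ) ^ (s - 1) * Real.exp (-((k + 1 : ℕ) * l)) := by
    rw [Finset.range_eq_Ico, Finset.sum_Ico_add' (fun j : ℕ => (j : ℝ) ^ (s - 1) * Real.exp (-(j * l))) 0 n 1]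
    rfl
  rw [e]
  calc _ ≤ ∑ k ∈ Finset.range n, 2 ^ |s - 1| * Real.exp 1 * ∫ t in ((k + 1 : ℕ) : ℝ)..((k + 1 + 1 : ℕ) : ℝ), f t :=
        Finset.sum_le_sum fun k _ => hterm k
    _ = 2 ^ |s - 1| * Real.exp 1 * ∫ t in ((0 + 1 : ℕ) : ℝ)..((n + 1 : ℕ) : ℝ), f t := by
        rw [← Finset.mul_sum]
        congr 1
        exact intervalIntegral.sum_integral_adjacent_intervals (a := fun k : ℕ => ((k+1 : ℕ) : ℝ))
          (fun k _ => hii _ _ (by positivity) (by positivity))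
    _ ≤ 2 ^ |s - 1| * Real.exp 1 * ∫ t in Set.Ioi (0:ℝ), f t := by
        gcongr
        rw [intervalIntegral.integral_of_le (by push_cast; linarith [(Nat.cast_nonneg n : (0:ℝ) ≤ n)])]
        apply MeasureTheory.setIntegral_mono_set h_integrable
        · filter_upwards [MeasureTheory.ae_restrict_mem measurableSet_Ioi] with x hx
          have : (0:ℝ) < x := hx
          simp only [hf, Pi.zero_apply]
          positivity
        · apply Eventually.of_forall
          intro x hx
          have h1 := hx.1
          push_cast at h1
          exact (by linarith : (0:ℝ) < x)
    _ = _ := by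
        rw [hf, Real.integral_rpow_mul_exp_neg_mul_Ioi hs hl]
        ring

/-- Small/large frequency lower bounds. -/
lemma trig_small (N : ℕ) (hN : 1 ≤ N) (t : ℝ) (ht : |t| ≤ Real.pi / (2 * N)) :
    (N : ℝ) ^ 3 * t ^ 2 / Real.pi ^ 2 ≤ ∑ j ∈ Finset.Ico N (4 * N), Real.sin (j * t / 2) ^ 2 := by
  have hpi := Real.pi_pos
  have hN0 : (0:ℝ) < N := by exact_mod_cast hN
  calc (N : ℝ) ^ 3 * t ^ 2 / Real.pi ^ 2
      = ∑ j ∈ Finset.Ico N (2 * N), ((N:ℝ) * t / Real.pi) ^ 2 := by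
        rw [Finset.sum_const, Nat.card_Ico, nsmul_eq_mul]
        have : ((2 * N - N : ℕ) : ℝ) = N := by congr 1; omega
        rw [this]; field_simp
    _ ≤ ∑ j ∈ Finset.Ico N (2 * N), Real.sin (j * t / 2) ^ 2 := by
        refine Finset.sum_le_sum fun j hj => ?_
        rw [Finset.mem_Ico] at hj
        have h1 : (N:ℝ) ≤ j := by exact_mod_cast hj.1
        have h2 : (j:ℝ) ≤ 2 * N := by exact_mod_cast hj.2.le
        have h3 : |j * t / 2| ≤ Real.pi / 2 := by
          rw [abs_div, abs_mul, abs_of_nonneg (by positivity : (0:ℝ) ≤ j), abs_of_pos (by norm_num : (0:ℝ) < 2)]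
          have : (j:ℝ) * |t| ≤ (2 * N) * (Real.pi / (2 * N)) := by gcongr
          have e : (2 * (N:ℝ)) * (Real.pi / (2 * N)) = Real.pi := by field_simp
          linarith
        have h4 := Real.mul_abs_le_abs_sin h3
        rw [← sq_abs ((N:ℝ) * t / Real.pi), ← sq_abs (Real.sin _)]
        refine pow_le_pow_left₀ (abs_nonneg _) ?_ 2
        refine le_trans ?_ h4
        rw [abs_div, abs_div, abs_mul, abs_mul, abs_of_pos hpi, abs_of_pos hN0,
          abs_of_nonneg (by positivity : (0:ℝ) ≤ j), abs_of_pos (by norm_num : (0:ℝ) < 2)]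
        have : 2 / Real.pi * (j * |t| / 2) = j * |t| / Real.pi := by ring
        rw [this]
        gcongr
    _ ≤ _ := by
        apply Finset.sum_le_sum_of_subset_of_nonneg
        · apply Finset.Ico_subset_Ico_right; omega
        · intros; positivity

lemma trig_large (N : ℕ) (hN : 1 ≤ N) (t : ℝ) (ht : Real.pi / (2 * N) ≤ |t|) (ht' : |t| ≤ Real.pi) :
    (N : ℝ) / 8 ≤ ∑ j ∈ Finset.Ico N (4 * N), Real.sin (j * t / 2) ^ 2 := by
  have hpi := Real.pi_pos
  have hN0 : (0:ℝ) < N := by exact_mod_cast hN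
  have ht0 : 0 < |t| := lt_of_lt_of_le (by positivity) ht
  set k := ⌊Real.pi / |t|⌋₊ with hk
  have hx1 : 1 ≤ Real.pi / |t| := by rw [le_div_iff₀ ht0]; linarith
  have hk1 : 1 ≤ k := Nat.le_floor (by simpa using hx1)
  have hkle : (k:ℝ) ≤ Real.pi / |t| := Nat.floor_le (by positivity)
  have hklt : Real.pi / |t| < k + 1 := Nat.lt_floor_add_one _
  have hk1' : (1:ℝ) ≤ k := by exact_mod_cast hk1
  have hk2N : k ≤ 2 * N := by
    have : (k:ℝ) ≤ 2 * N := by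
      refine hkle.trans ?_
      rw [div_le_iff₀ ht0]
      rw [div_le_iff₀ (by positivity)] at ht
      linarith
    exact_mod_cast this
  have hs : 1 / 2 ≤ Real.sin (k * t / 2) ^ 2 := by
    have e : Real.sin (k * t / 2) ^ 2 = 1 / 2 - Real.cos (k * t) / 2 := by
      rw [Real.sin_sq_eq_half_sub]
      congr 3
      ring
    rw [e]
    have hcos : Real.cos (k * t) ≤ 0 := by
      rw [← Real.cos_abs]
      rw [abs_mul, abs_of_nonneg (by positivity : (0:ℝ) ≤ k)]
      have h1 : (k:ℝ) * |t| ≤ Real.pi := by rwa [le_div_iff₀ ht0] at hkle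
      have h2 : Real.pi < (k + 1) * |t| := by rwa [div_lt_iff₀ ht0] at hklt
      apply Real.cos_nonpos_of_pi_div_two_le_of_le
      · nlinarith
      · linarith
    linarith
  have hpair : ∀ j : ℕ, 1 / 4 ≤ Real.sin (j * t / 2) ^ 2 + Real.sin ((j + k : ℕ) * t / 2) ^ 2 := by
    intro j
    set A := (j:ℝ) * t / 2
    have e : (((j + k : ℕ)):ℝ) * t / 2 = A + k * t / 2 := by simp only [A]; push_cast; ring
    rw [e]
    set B := A + k * t / 2 with hB
    have e2 : (k:ℝ) * t / 2 = B - A := by rw [hB]; ring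
    rw [e2, Real.sin_sub] at hs
    have hA := Real.sin_sq_add_cos_sq A
    have hB' := Real.sin_sq_add_cos_sq B
    have h1 : (Real.sin B * Real.cos A - Real.cos B * Real.sin A) ^ 2 ≤
        2 * ((Real.sin B * Real.cos A) ^ 2 + (Real.cos B * Real.sin A)^2) := by
      nlinarith [sq_nonneg (Real.sin B * Real.cos A + Real.cos B * Real.sin A)]
    have h2 : (Real.sin B * Real.cos A) ^ 2 ≤ Real.sin B ^ 2 := by
      rw [mul_pow]; nlinarith [sq_nonneg (Real.sin B), Real.cos_sq_le_one A]
    have h3 : (Real.cos B * Real.sin A) ^ 2 ≤ Real.sin A ^ 2 := by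
      rw [mul_pow]; nlinarith [sq_nonneg (Real.sin A), Real.cos_sq_le_one B]
    linarith
  have hsum : ∑ j ∈ Finset.Ico N (2 * N), (Real.sin (j * t / 2) ^ 2 + Real.sin ((j + k : ℕ) * t / 2) ^ 2)
      ≥ N / 4 := by
    calc (N : ℝ) / 4 = ∑ j ∈ Finset.Ico N (2 * N), (1/4 : ℝ) := by
          rw [Finset.sum_const, Nat.card_Ico, nsmul_eq_mul]
          have : ((2 * N - N : ℕ) : ℝ) = N := by congr 1; omega
          rw [this]; ring
      _ ≤ _ := Finset.sum_le_sum fun j _ => hpair j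
  rw [Finset.sum_add_distrib] at hsum
  have h1 : ∑ j ∈ Finset.Ico N (2 * N), Real.sin (j * t / 2) ^ 2 ≤
      ∑ j ∈ Finset.Ico N (4 * N), Real.sin (j * t / 2) ^ 2 := by
    apply Finset.sum_le_sum_of_subset_of_nonneg
    · apply Finset.Ico_subset_Ico_right; omega
    · intros; positivity
  have h2 : ∑ j ∈ Finset.Ico N (2 * N), Real.sin ((j + k : ℕ) * t / 2) ^ 2 ≤
      ∑ j ∈ Finset.Ico N (4 * N), Real.sin (j * t / 2) ^ 2 := by
    rw [Finset.sum_Ico_add' (fun j : ℕ => Real.sin (j * t / 2) ^ 2) N (2 * N) k]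
    apply Finset.sum_le_sum_of_subset_of_nonneg
    · apply Finset.Ico_subset_Ico <;> omega
    · intros; positivity
  linarith

lemma llt_bound (F : ℝ → ℂ) (hF : Continuous F) (B T η s : ℝ) (hB : 0 < B) (hT0 : 0 < T)
    (hη : 0 ≤ η) (hs : 0 ≤ s)
    (h1 : ∀ t, |t| ≤ T → ‖F t - (Real.exp (-(B ^ 2 / 2) * t ^ 2) : ℝ)‖ ≤ η * Real.exp (-(B ^ 2 / 2) * t ^ 2))
    (h2 : ∀ t, T ≤ |t| → |t| ≤ Real.pi → ‖F t‖ ≤ s) (hT : T ≤ Real.pi) :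
    ‖B * (∫ t in (-Real.pi)..Real.pi, F t) - (Real.sqrt (2 * Real.pi) : ℝ)‖ ≤
      η * Real.sqrt (2 * Real.pi) + 2 * Real.pi * (B * s)
        + Real.exp (-((B * T) ^ 2 / 4)) * Real.sqrt (4 * Real.pi) := by
  have hpi := Real.pi_pos
  have hB2 : 0 < B ^ 2 / 2 := by positivity
  have hB4 : 0 < B ^ 2 / 4 := by positivity
  set G : ℝ → ℝ := fun t => Real.exp (-(B ^ 2 / 2) * t ^ 2) with hG
  set H : ℝ → ℝ := fun t => Real.exp (-(B ^ 2 / 4) * t ^ 2) with hH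
  have iG : MeasureTheory.Integrable G := integrable_exp_neg_mul_sq hB2
  have iH : MeasureTheory.Integrable H := integrable_exp_neg_mul_sq hB4
  have vG : ∫ t, G t = Real.sqrt (2 * Real.pi) / B := by
    rw [hG, integral_gaussian]
    rw [eq_div_iff hB.ne', ← Real.sqrt_sq hB.le, ← Real.sqrt_mul (by positivity)]
    congr 1
    rw [Real.sqrt_sq hB.le]
    field_simp
  have vH : ∫ t, H t = Real.sqrt (4 * Real.pi) / B := by
    rw [hH, integral_gaussian]
    rw [eq_div_iff hB.ne', ← Real.sqrt_sq hB.le, ← Real.sqrt_mul (by positivity)]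
    congr 1
    rw [Real.sqrt_sq hB.le]
    field_simp
  set S : Set ℝ := Set.Ioc (-Real.pi) Real.pi with hS
  have hSm : MeasurableSet S := measurableSet_Ioc
  have iF : MeasureTheory.IntegrableOn F S := by
    have := hF.intervalIntegrable (μ := MeasureTheory.volume) (-Real.pi) Real.pi
    rw [intervalIntegrable_iff, Set.uIoc_of_le (by linarith)] at this
    exact this
  have i1 : MeasureTheory.Integrable (S.indicator F) := iF.integrable_indicator hSm
  have i2 : MeasureTheory.Integrable (S.indicator (fun _ => s)) := by
    apply MeasureTheory.IntegrableOn.integrable_indicator _ hSm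
    simp [hS]
  have iGc : MeasureTheory.Integrable (fun t => ((G t : ℝ) : ℂ)) := iG.ofReal
  have hpt : ∀ t, ‖S.indicator F t - (G t : ℂ)‖ ≤
      η * G t + S.indicator (fun _ => s) t + Real.exp (-((B * T) ^ 2 / 4)) * H t := by
    intro t
    have hGp : 0 < G t := Real.exp_pos _
    have hHp : 0 < H t := Real.exp_pos _
    have hind : 0 ≤ S.indicator (fun _ => s) t := Set.indicator_nonneg (fun _ _ => hs) t
    have hep : 0 < Real.exp (-((B * T) ^ 2 / 4)) := Real.exp_pos _
    by_cases ht : |t| < T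
    · have hmem : t ∈ S := by
        rw [abs_lt] at ht
        exact ⟨by linarith, by linarith⟩
      rw [Set.indicator_of_mem hmem]
      have := h1 t ht.le
      have h3 : 0 ≤ Real.exp (-((B * T) ^ 2 / 4)) * H t := by positivity
      linarith
    · push Not at ht
      have hGH : G t ≤ Real.exp (-((B * T) ^ 2 / 4)) * H t := by
        simp only [hG, hH]
        rw [← Real.exp_add, Real.exp_le_exp]
        have : T ^ 2 ≤ t ^ 2 := by rw [← sq_abs t]; gcongr
        nlinarith [mul_le_mul_of_nonneg_left this hB4.le]
      have h0 : 0 ≤ η * G t := by positivity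
      have hnG : ‖(G t : ℂ)‖ = G t := by simp [abs_of_pos hGp]
      have hnF : ‖S.indicator F t‖ ≤ S.indicator (fun _ => s) t := by
        by_cases hm : t ∈ S
        · rw [Set.indicator_of_mem hm, Set.indicator_of_mem hm]
          exact h2 t ht (abs_le.2 ⟨hm.1.le, hm.2⟩)
        · rw [Set.indicator_of_notMem hm, Set.indicator_of_notMem hm]
          simp
      refine (norm_sub_le _ _).trans ?_
      rw [hnG]
      linarith
  have hmain : ‖∫ t, (S.indicator F t - (G t : ℂ))‖ ≤
      ∫ t, (η * G t + S.indicator (fun _ => s) t + Real.exp (-((B * T) ^ 2 / 4)) * H t) := by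
    refine MeasureTheory.norm_integral_le_of_norm_le ?_ (Eventually.of_forall hpt)
    exact ((iG.const_mul _).add i2).add (iH.const_mul _)
  have hv : ∫ t, (η * G t + S.indicator (fun _ => s) t + Real.exp (-((B * T) ^ 2 / 4)) * H t)
      = η * (Real.sqrt (2 * Real.pi) / B) + 2 * Real.pi * s
        + Real.exp (-((B * T) ^ 2 / 4)) * (Real.sqrt (4 * Real.pi) / B) := by
    have i12 : MeasureTheory.Integrable (fun t => η * G t + S.indicator (fun _ => s) t) :=
      (iG.const_mul _).add i2
    rw [MeasureTheory.integral_add i12 (iH.const_mul _),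
      MeasureTheory.integral_add (iG.const_mul _) i2, MeasureTheory.integral_const_mul,
      MeasureTheory.integral_const_mul, vG, vH, MeasureTheory.integral_indicator hSm,
      MeasureTheory.setIntegral_const]
    simp only [hS, Real.volume_real_Ioc_of_le (by linarith : -Real.pi ≤ Real.pi), smul_eq_mul]
    ring
  have hl : ∫ t, (S.indicator F t - (G t : ℂ)) =
      (∫ t in (-Real.pi)..Real.pi, F t) - ((Real.sqrt (2 * Real.pi) / B : ℝ) : ℂ) := by
    rw [MeasureTheory.integral_sub i1 iGc, MeasureTheory.integral_indicator hSm,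
      intervalIntegral.integral_of_le (by linarith), integral_complex_ofReal, vG]
  rw [hl, hv] at hmain
  have hBc : (B : ℂ) ≠ 0 := by exact_mod_cast hB.ne'
  have e : (B : ℂ) * (∫ t in (-Real.pi)..Real.pi, F t) - (Real.sqrt (2 * Real.pi) : ℝ)
      = B * ((∫ t in (-Real.pi)..Real.pi, F t) - ((Real.sqrt (2 * Real.pi) / B : ℝ) : ℂ)) := by
    push_cast
    field_simp
  rw [e, norm_mul, Complex.norm_real, Real.norm_eq_abs, abs_of_pos hB]
  refine (mul_le_mul_of_nonneg_left hmain hB.le).trans (le_of_eq ?_)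
  field_simp

noncomputable def rho3 (a : ℕ → ℕ) (n : ℕ) (σ : ℝ) : ℝ :=
  ∑ j ∈ Finset.Icc 1 n, (j : ℝ) ^ 3 * (a j) * Real.exp (-(j * σ)) / (1 - Real.exp (-(j * σ))) ^ 3

/-- The (centred) characteristic function. -/
noncomputable def Fch (a : ℕ → ℕ) (n : ℕ) (σ t : ℝ) : ℂ :=
  Complex.exp (-(n * t * Complex.I)) * ∏ j ∈ Finset.Icc 1 n,
    (((1 - Real.exp (-(j * σ)) : ℝ) : ℂ) *
      (1 / (1 - (Real.exp (-(j * σ)) : ℝ) * Complex.exp ((j * t : ℝ) * Complex.I)))) ^ (a j)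

lemma prod_fin_Icc {R : Type*} [CommMonoid R] (n : ℕ) (f : ℕ → R) :
    ∏ j : Fin n, f (j.1 + 1) = ∏ j ∈ Finset.Icc 1 n, f j := by
  rw [Fin.prod_univ_eq_prod_range (fun j => f (j + 1)) n, Finset.range_eq_Ico,
    Finset.prod_Ico_add' f 0 n 1]
  rfl

lemma q_pos (j : ℕ) (σ : ℝ) : 0 < Real.exp (-(j * σ)) := Real.exp_pos _

lemma q_lt (j : ℕ) (hj : 1 ≤ j) (σ : ℝ) (hσ : 0 < σ) : Real.exp (-(j * σ)) < 1 := by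
  rw [Real.exp_lt_one_iff]
  have : (1:ℝ) ≤ j := by exact_mod_cast hj
  nlinarith

lemma Fch_int (a : ℕ → ℕ) (n : ℕ) (σ : ℝ) (hσ : 0 < σ) (ha : ∀ j, 1 ≤ j → 1 ≤ a j) :
    ∫ t in (-Real.pi)..Real.pi, Fch a n σ t =
      ((2 * Real.pi * (Real.exp (-(n * σ)) * multisetCount a n *
        ∏ j ∈ Finset.Icc 1 n, (1 - Real.exp (-(j * σ))) ^ (a j)) : ℝ) : ℂ) := by
  have h := fourier_id a n σ hσ ha
  have e : ∀ t : ℝ, Fch a n σ t = ((∏ j ∈ Finset.Icc 1 n, (1 - Real.exp (-(j * σ))) ^ (a j) : ℝ) : ℂ) *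
     (Complex.exp (-(n * t * Complex.I)) *
      ∏ j : Fin n, (1 / (1 - Complex.exp (-σ + t * Complex.I) ^ (j.1 + 1))) ^ a (j.1 + 1)) := by
    intro t
    rw [prod_fin_Icc n (fun j => (1 / (1 - Complex.exp (-σ + t * Complex.I) ^ j)) ^ a j)]
    unfold Fch
    simp only [mul_pow, Finset.prod_mul_distrib]
    have : ∀ j ∈ Finset.Icc 1 n, (1 / (1 - ((Real.exp (-(j * σ)) : ℝ) : ℂ) * Complex.exp ((j * t : ℝ) * Complex.I))) ^ (a j)
        = (1 / (1 - Complex.exp (-σ + t * Complex.I) ^ j)) ^ a j := by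
      intro j _
      congr 3
      rw [← Complex.exp_nat_mul, Complex.ofReal_exp, ← Complex.exp_add]
      congr 1
      push_cast
      ring
    rw [Finset.prod_congr rfl this]
    push_cast
    ring
  simp only [e]
  rw [intervalIntegral.integral_const_mul, h]
  push_cast
  ring

lemma Fch_cont (a : ℕ → ℕ) (n : ℕ) (σ : ℝ) (hσ : 0 < σ) : Continuous (Fch a n σ) := by
  unfold Fch
  refine Continuous.mul (by fun_prop) (continuous_finsetProd _ fun j hj => ?_)
  rw [Finset.mem_Icc] at hj
  refine Continuous.pow (Continuous.mul continuous_const ?_) _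
  refine Continuous.div continuous_const (by fun_prop) fun t => ?_
  intro h
  rw [sub_eq_zero] at h
  have h2 := congrArg norm h
  rw [norm_mul, Complex.norm_exp_ofReal_mul_I, norm_one, Complex.norm_real, Real.norm_eq_abs,
    abs_of_pos (q_pos j σ)] at h2
  have := q_lt j hj.1 σ hσ
  linarith

lemma Fch_norm (a : ℕ → ℕ) (n : ℕ) (σ : ℝ) (hσ : 0 < σ) (t : ℝ) :
    ‖Fch a n σ t‖ ≤ Real.exp (-(2 / 5 * ∑ j ∈ Finset.Icc 1 n,
      (a j * Real.exp (-(j * σ))) * Real.sin (j * t / 2) ^ 2)) := by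
  unfold Fch
  rw [norm_mul, norm_prod]
  have h1 : ‖Complex.exp (-(n * t * Complex.I))‖ = 1 := by simp [Complex.norm_exp]
  rw [h1, one_mul, Finset.mul_sum, ← Finset.sum_neg_distrib, Real.exp_sum]
  refine Finset.prod_le_prod (fun _ _ => norm_nonneg _) fun j hj => ?_
  rw [Finset.mem_Icc] at hj
  rw [norm_pow]
  have := chf_norm (Real.exp (-(j * σ))) (j * t) (q_pos j σ) (q_lt j hj.1 σ hσ)
  refine (pow_le_pow_left₀ (norm_nonneg _) this (a j)).trans (le_of_eq ?_)
  rw [← Real.exp_nat_mul]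
  congr 1
  ring

lemma Fch_central (a : ℕ → ℕ) (n : ℕ) (σ : ℝ) (hσ : 0 < σ) (hM : Mfun a n σ = n) (t : ℝ)
    (ht : 8 * |t| ^ 3 * rho3 a n σ ≤ 1) :
    ‖Fch a n σ t - (Real.exp (-(B2 a n σ / 2) * t ^ 2) : ℝ)‖ ≤
      2 * (8 * |t| ^ 3 * rho3 a n σ) * Real.exp (-(B2 a n σ / 2) * t ^ 2) := by
  have hex : ∀ j : ℕ, ∃ w : ℂ, 1 ≤ j →
      (((1 - Real.exp (-(j * σ)) : ℝ) : ℂ) *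
      (1 / (1 - (Real.exp (-(j * σ)) : ℝ) * Complex.exp ((j * t : ℝ) * Complex.I))) =
      Complex.exp ((((j * t) * (Real.exp (-(j * σ)) / (1 - Real.exp (-(j * σ)))) : ℝ) : ℂ) * Complex.I
        - (((j * t) ^ 2 / 2 * (Real.exp (-(j * σ)) / (1 - Real.exp (-(j * σ))) ^ 2) : ℝ) : ℂ) + w) ∧
      ‖w‖ ≤ 8 * (|j * t| ^ 3 * (Real.exp (-(j * σ)) / (1 - Real.exp (-(j * σ))) ^ 3))) := by
    intro j
    by_cases hj : 1 ≤ j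
    · obtain ⟨w, hw⟩ := chf_taylor (Real.exp (-(j * σ))) (j * t) (q_pos j σ) (q_lt j hj σ hσ)
      exact ⟨w, fun _ => hw⟩
    · exact ⟨0, fun h => absurd h hj⟩
  choose w hw using hex
  set W : ℂ := ∑ j ∈ Finset.Icc 1 n, (a j : ℂ) * w j with hWdef
  have hW : ‖W‖ ≤ 8 * |t| ^ 3 * rho3 a n σ := by
    rw [hWdef, rho3, Finset.mul_sum]
    refine (norm_sum_le _ _).trans (Finset.sum_le_sum fun j hj => ?_)
    rw [Finset.mem_Icc] at hj
    rw [norm_mul, Complex.norm_natCast]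
    refine (mul_le_mul_of_nonneg_left (hw j hj.1).2 (by positivity)).trans (le_of_eq ?_)
    rw [abs_mul, abs_of_nonneg (by positivity : (0:ℝ) ≤ j)]
    ring
  have hF : Fch a n σ t = Complex.exp (((-(B2 a n σ / 2) * t ^ 2 : ℝ) : ℂ) + W) := by
    unfold Fch
    have hp : ∀ j ∈ Finset.Icc 1 n, (((1 - Real.exp (-(j * σ)) : ℝ) : ℂ) *
      (1 / (1 - (Real.exp (-(j * σ)) : ℝ) * Complex.exp ((j * t : ℝ) * Complex.I)))) ^ (a j)
      = Complex.exp ((a j : ℂ) * ((((j * t) * (Real.exp (-(j * σ)) / (1 - Real.exp (-(j * σ)))) : ℝ) : ℂ) * Complex.I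
        - (((j * t) ^ 2 / 2 * (Real.exp (-(j * σ)) / (1 - Real.exp (-(j * σ))) ^ 2) : ℝ) : ℂ) + w j)) := by
      intro j hj
      rw [Finset.mem_Icc] at hj
      rw [(hw j hj.1).1, ← Complex.exp_nat_mul]
    rw [Finset.prod_congr rfl hp, ← Complex.exp_sum, ← Complex.exp_add]
    congr 1
    have hMs : (n : ℂ) * t * Complex.I = ∑ j ∈ Finset.Icc 1 n, (a j : ℂ) *
        ((((j * t) * (Real.exp (-(j * σ)) / (1 - Real.exp (-(j * σ)))) : ℝ) : ℂ) * Complex.I) := by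
      have h0 : (n : ℂ) = ((Mfun a n σ : ℝ) : ℂ) := by rw [hM]; simp
      rw [h0, Mfun, Complex.ofReal_sum, Finset.sum_mul, Finset.sum_mul]
      refine Finset.sum_congr rfl fun j _ => ?_
      push_cast
      ring
    have hBs : ((-(B2 a n σ / 2) * t ^ 2 : ℝ) : ℂ) = - ∑ j ∈ Finset.Icc 1 n, (a j : ℂ) *
        (((j * t) ^ 2 / 2 * (Real.exp (-(j * σ)) / (1 - Real.exp (-(j * σ))) ^ 2) : ℝ) : ℂ) := by
      rw [B2, ← Finset.sum_neg_distrib, Finset.sum_div, ← Finset.sum_neg_distrib, Finset.sum_mul, Complex.ofReal_sum]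
      refine Finset.sum_congr rfl fun j _ => ?_
      push_cast
      ring
    rw [hMs, hBs, hWdef, ← Finset.sum_neg_distrib, ← Finset.sum_neg_distrib, ← Finset.sum_add_distrib,
      ← Finset.sum_add_distrib]
    refine Finset.sum_congr rfl fun j _ => ?_
    ring
  rw [hF, Complex.exp_add, Complex.ofReal_exp]
  have e : Complex.exp ((-(B2 a n σ / 2) * t ^ 2 : ℝ) : ℂ) * Complex.exp W
      - Complex.exp ((-(B2 a n σ / 2) * t ^ 2 : ℝ) : ℂ)
      = Complex.exp ((-(B2 a n σ / 2) * t ^ 2 : ℝ) : ℂ) * (Complex.exp W - 1) := by ring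
  rw [e, norm_mul, ← Complex.ofReal_exp, Complex.norm_real, Real.norm_eq_abs, abs_of_pos (Real.exp_pos _), mul_comm]
  gcongr
  refine (Complex.norm_exp_sub_one_le (hW.trans ht)).trans ?_
  gcongr

lemma B2_le_rho3 (a : ℕ → ℕ) (n : ℕ) (σ : ℝ) (hσ : 0 < σ) : B2 a n σ ≤ rho3 a n σ := by
  unfold B2 rho3
  refine Finset.sum_le_sum fun j hj => ?_
  rw [Finset.mem_Icc] at hj
  have h1 := q_pos j σ
  have h2 := q_lt j hj.1 σ hσ
  set q := Real.exp (-(j * σ))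
  have hj1 : (1:ℝ) ≤ j := by exact_mod_cast hj.1
  have h3 : 0 < 1 - q := by linarith
  have h4 : 1 - q ≤ 1 := by linarith
  gcongr ?_ / ?_
  · gcongr; norm_num
  · exact pow_le_pow_of_le_one h3.le h4 (by norm_num)

/-- Reduction of the asymptotics to the bound of `llt_bound`. -/
lemma ratio_bound (a : ℕ → ℕ) (n : ℕ) (σ T s : ℝ) (hσ : 0 < σ) (ha : ∀ j, 1 ≤ j → 1 ≤ a j)
    (hM : Mfun a n σ = n) (hB : 0 < B2 a n σ) (hT0 : 0 < T) (hT : T ≤ Real.pi) (hs : 0 ≤ s)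
    (hη : 8 * T ^ 3 * rho3 a n σ ≤ 1)
    (h2 : ∀ t, T ≤ |t| → |t| ≤ Real.pi → ‖Fch a n σ t‖ ≤ s) :
    |(multisetCount a n : ℝ) /
        (Real.exp (n * σ) / Real.sqrt (2 * Real.pi * B2 a n σ) *
          ∏ j ∈ Finset.Icc 1 n, (1 - Real.exp (-(j * σ))) ^ (-(a j : ℤ))) - 1| ≤
      2 * (8 * T ^ 3 * rho3 a n σ) * Real.sqrt (2 * Real.pi)
        + 2 * Real.pi * (Real.sqrt (B2 a n σ) * s)
        + Real.exp (-(B2 a n σ * T ^ 2 / 4)) * Real.sqrt (4 * Real.pi) := by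
  have hpi := Real.pi_gt_three
  have hrho : 0 ≤ rho3 a n σ := hB.le.trans (B2_le_rho3 a n σ hσ)
  set B := Real.sqrt (B2 a n σ) with hBdef
  have hB0 : 0 < B := Real.sqrt_pos.2 hB
  have hBsq : B ^ 2 = B2 a n σ := Real.sq_sqrt hB.le
  have hmain := llt_bound (Fch a n σ) (Fch_cont a n σ hσ) B T (2 * (8 * T ^ 3 * rho3 a n σ)) s hB0 hT0
    (by positivity) hs ?_ h2 hT
  · rw [mul_pow B T, hBsq] at hmain
    refine le_trans ?_ hmain
    rw [Fch_int a n σ hσ ha]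
    set X := Real.exp (-(n * σ)) * multisetCount a n *
        ∏ j ∈ Finset.Icc 1 n, (1 - Real.exp (-(j * σ))) ^ (a j) with hX
    set r := Real.sqrt (2 * Real.pi) with hr
    have hr0 : 0 < r := Real.sqrt_pos.2 (by positivity)
    have hr2 : r ^ 2 = 2 * Real.pi := Real.sq_sqrt (by positivity)
    have hr1 : 1 ≤ r := by nlinarith
    have e1 : (multisetCount a n : ℝ) /
        (Real.exp (n * σ) / Real.sqrt (2 * Real.pi * B2 a n σ) *
          ∏ j ∈ Finset.Icc 1 n, (1 - Real.exp (-(j * σ))) ^ (-(a j : ℤ))) = r * B * X := by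
      rw [Real.sqrt_mul (by positivity), ← hr, ← hBdef, hX, Real.exp_neg]
      simp only [zpow_neg, zpow_natCast, Finset.prod_inv_distrib]
      rw [div_eq_mul_inv, mul_inv, inv_inv, inv_div]
      ring
    rw [e1]
    have e2 : (B : ℂ) * ((2 * Real.pi * X : ℝ) : ℂ) - ((r : ℝ) : ℂ) = ((B * (2 * Real.pi * X) - r : ℝ) : ℂ) := by
      push_cast; ring
    rw [e2, Complex.norm_real, Real.norm_eq_abs, ← hr2]
    have e3 : B * (r ^ 2 * X) - r = r * (r * B * X - 1) := by ring
    rw [e3, abs_mul, abs_of_pos hr0]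
    nlinarith [abs_nonneg (r * B * X - 1)]
  · intro t ht
    rw [hBsq]
    have hcub : 8 * |t| ^ 3 * rho3 a n σ ≤ 8 * T ^ 3 * rho3 a n σ := by gcongr
    refine (Fch_central a n σ hσ hM t (hcub.trans hη)).trans ?_
    gcongr

lemma b_bounds (a : ℕ → ℕ) (y γ₁ γ₂ p₁ p₂ : ℝ) (hy : 1 ≤ y) (j : ℕ)
    (h : γ₁ * (j : ℝ) ^ p₁ * y ^ j ≤ (a j : ℝ) ∧ (a j : ℝ) ≤ γ₂ * (j : ℝ) ^ p₂ * y ^ j) (σ : ℝ) :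
    γ₁ * (j : ℝ) ^ p₁ * Real.exp (-(j * (σ - Real.log y))) ≤ a j * Real.exp (-(j * σ)) ∧
    a j * Real.exp (-(j * σ)) ≤ γ₂ * (j : ℝ) ^ p₂ * Real.exp (-(j * (σ - Real.log y))) := by
  have hy0 : 0 < y := by linarith
  have e : Real.exp (-(j * (σ - Real.log y))) = y ^ j * Real.exp (-(j * σ)) := by
    have : y ^ j = Real.exp (j * Real.log y) := by
      rw [Real.exp_nat_mul, Real.exp_log hy0]
    rw [this, ← Real.exp_add]
    congr 1
    ring
  rw [e, ← mul_assoc, ← mul_assoc]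
  have := Real.exp_pos (-(j * σ))
  exact ⟨mul_le_mul_of_nonneg_right h.1 this.le, mul_le_mul_of_nonneg_right h.2 this.le⟩

lemma q_le (j : ℕ) (σ y : ℝ) (hy : 1 ≤ y) :
    Real.exp (-(j * σ)) ≤ Real.exp (-(j * (σ - Real.log y))) := by
  rw [Real.exp_le_exp]
  have h1 := Real.log_nonneg hy
  have h2 : (0:ℝ) ≤ j := by positivity
  nlinarith [mul_nonneg h2 h1]

lemma exp_ratio (x : ℝ) (hx : 0 < x) :
    x ^ 3 * Real.exp (-x) ≤ 216 * Real.exp (-(x / 2)) * (1 - Real.exp (-x)) ^ 3 := by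
  have h1 : 1 + x ≤ 6 * Real.exp (x / 6) := by
    have := Real.add_one_le_exp (x / 6)
    linarith
  have h2 : x ≤ (1 + x) * (1 - Real.exp (-x)) := by
    have h := Real.add_one_le_exp x
    have h3 : Real.exp x * Real.exp (-x) = 1 := by rw [← Real.exp_add]; simp
    have h4 := Real.exp_pos (-x)
    nlinarith
  have h0 : 0 < 1 - Real.exp (-x) := by
    have : Real.exp (-x) < 1 := by simpa using hx
    linarith
  have h3 : x ≤ 6 * Real.exp (x / 6) * (1 - Real.exp (-x)) := h2.trans (by gcongr)
  have h4 : x ^ 3 ≤ (6 * Real.exp (x / 6) * (1 - Real.exp (-x))) ^ 3 := by gcongr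
  calc x ^ 3 * Real.exp (-x) ≤ (6 * Real.exp (x / 6) * (1 - Real.exp (-x))) ^ 3 * Real.exp (-x) := by gcongr
    _ = 216 * (Real.exp (x / 6) ^ 3 * Real.exp (-x)) * (1 - Real.exp (-x)) ^ 3 := by ring
    _ = _ := by
      rw [← Real.exp_nat_mul, ← Real.exp_add]
      congr 4
      push_cast
      ring

lemma rho3_bound (a : ℕ → ℕ) (r y γ₂ : ℝ) (hr : 0 < r) (hy : 1 ≤ y) (hγ₂ : 0 < γ₂)
    (h : ∀ j : ℕ, 1 ≤ j → (a j : ℝ) ≤ γ₂ * (j : ℝ) ^ (r - 1) * y ^ j) :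
    ∃ C : ℝ, 0 < C ∧ ∀ (n : ℕ) (σ : ℝ), 0 < σ - Real.log y → σ - Real.log y ≤ 1 →
      rho3 a n σ ≤ C * (1 / (σ - Real.log y)) ^ (r + 3) := by
  obtain ⟨C, hC, hsum⟩ := sum_bound r hr
  refine ⟨216 * γ₂ * C * 2 ^ r, by positivity, ?_⟩
  intro n σ hδ hδ1
  set δ := σ - Real.log y with hδdef
  have hterm : ∀ j ∈ Finset.Icc 1 n, (j : ℝ) ^ 3 * (a j) * Real.exp (-(j * σ)) / (1 - Real.exp (-(j * σ))) ^ 3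
      ≤ 216 * γ₂ * (1 / δ) ^ 3 * ((j : ℝ) ^ (r - 1) * Real.exp (-(j * (δ / 2)))) := by
    intro j hj
    rw [Finset.mem_Icc] at hj
    have hj0 : (0:ℝ) < j := by exact_mod_cast hj.1
    have hb := (b_bounds a y 0 γ₂ 0 (r-1) hy j ⟨by simp, h j hj.1⟩ σ).2
    rw [← hδdef] at hb
    have hq := q_le j σ y hy
    rw [← hδdef] at hq
    have hx : 0 < j * δ := by positivity
    have hlt : Real.exp (-(j * δ)) < 1 := by simpa using hx
    have h1 : 0 < 1 - Real.exp (-(j * δ)) := by linarith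
    have hex := exp_ratio (j * δ) hx
    have hj3 : Real.exp (-(j * δ)) / (1 - Real.exp (-(j * δ))) ^ 3 ≤ 216 * Real.exp (-(j * δ / 2)) / (j * δ) ^ 3 := by
      rw [div_le_div_iff₀ (by positivity) (by positivity)]
      linarith
    calc (j : ℝ) ^ 3 * (a j) * Real.exp (-(j * σ)) / (1 - Real.exp (-(j * σ))) ^ 3
        = (j : ℝ) ^ 3 * (a j * Real.exp (-(j * σ))) / (1 - Real.exp (-(j * σ))) ^ 3 := by ring
      _ ≤ (j : ℝ) ^ 3 * (γ₂ * (j : ℝ) ^ (r - 1) * Real.exp (-(j * δ))) / (1 - Real.exp (-(j * δ))) ^ 3 := by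
          gcongr
      _ = (j : ℝ) ^ 3 * (γ₂ * (j : ℝ) ^ (r - 1)) * (Real.exp (-(j * δ)) / (1 - Real.exp (-(j * δ))) ^ 3) := by ring
      _ ≤ (j : ℝ) ^ 3 * (γ₂ * (j : ℝ) ^ (r - 1)) * (216 * Real.exp (-(j * δ / 2)) / (j * δ) ^ 3) := by gcongr
      _ = _ := by
          rw [show (j:ℝ) * δ / 2 = j * (δ / 2) by ring]
          field_simp
  unfold rho3
  calc _ ≤ ∑ j ∈ Finset.Icc 1 n, 216 * γ₂ * (1 / δ) ^ 3 * ((j : ℝ) ^ (r - 1) * Real.exp (-(j * (δ / 2)))) :=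
        Finset.sum_le_sum hterm
    _ = 216 * γ₂ * (1 / δ) ^ 3 * ∑ j ∈ Finset.Icc 1 n, ((j : ℝ) ^ (r - 1) * Real.exp (-(j * (δ / 2)))) := by
        rw [Finset.mul_sum]
    _ ≤ 216 * γ₂ * (1 / δ) ^ 3 * (C * (1 / (δ / 2)) ^ r) := by
        gcongr
        exact hsum n (δ / 2) (by positivity) (by linarith)
    _ = _ := by
        have e1 : (1 / (δ / 2)) ^ r = 2 ^ r * (1 / δ) ^ r := by
          rw [← Real.mul_rpow (by norm_num) (by positivity)]
          congr 1
          field_simp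
        have e2 : (1 / δ) ^ (r + 3) = (1 / δ) ^ r * (1 / δ) ^ 3 := by
          rw [Real.rpow_add (by positivity)]
          congr 1
          exact_mod_cast Real.rpow_natCast (1 / δ) 3
        rw [e1, e2]
        ring

/-- The tilting parameter tends to the critical one from above. -/
lemma delta_small (a : ℕ → ℕ) (r y γ₂ : ℝ) (hr : 0 < r) (hy : 1 ≤ y) (hγ₂ : 0 < γ₂)
    (h : ∀ j : ℕ, 1 ≤ j → (a j : ℝ) ≤ γ₂ * (j : ℝ) ^ (r - 1) * y ^ j)
    (σ : ℕ → ℝ) (hσ : ∀ n : ℕ, 1 ≤ n → 0 < σ n ∧ Mfun a n (σ n) = n) (κ : ℝ) (hκ : 0 < κ) (hκ1 : κ ≤ 1) :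
    ∀ᶠ n : ℕ in atTop, σ n - Real.log y < κ := by
  obtain ⟨C, hC, hsum⟩ := sum_bound (r + 1) (by linarith)
  set D := γ₂ / (1 - Real.exp (-κ)) * (C * (1 / κ) ^ (r + 1)) with hD
  obtain ⟨n0, hn0⟩ := exists_nat_gt D
  filter_upwards [eventually_ge_atTop (max n0 1)] with n hn
  have hn1 : 1 ≤ n := le_trans (le_max_right _ _) hn
  by_contra hc
  push Not at hc
  have hM := (hσ n hn1).2
  have hek : Real.exp (-κ) < 1 := by simpa using hκ
  have hek0 : 0 < 1 - Real.exp (-κ) := by linarith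
  have hle : Mfun a n (σ n) ≤ D := by
    unfold Mfun
    calc _ ≤ ∑ j ∈ Finset.Icc 1 n, γ₂ / (1 - Real.exp (-κ)) * ((j:ℝ) ^ (r + 1 - 1) * Real.exp (-(j * κ))) := by
          refine Finset.sum_le_sum fun j hj => ?_
          rw [Finset.mem_Icc] at hj
          have hj1 : (1:ℝ) ≤ j := by exact_mod_cast hj.1
          have hj0 : (0:ℝ) < j := by linarith
          have hb := (b_bounds a y 0 γ₂ 0 (r-1) hy j ⟨by simp, h j hj.1⟩ (σ n)).2
          have hq := q_le j (σ n) y hy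
          have he : Real.exp (-(j * (σ n - Real.log y))) ≤ Real.exp (-(j * κ)) := by
            rw [Real.exp_le_exp]; nlinarith
          have he2 : Real.exp (-(j * κ)) ≤ Real.exp (-κ) := by
            rw [Real.exp_le_exp]; nlinarith
          have hq2 : Real.exp (-(j * σ n)) ≤ Real.exp (-κ) := hq.trans (he.trans he2)
          calc (j : ℝ) * (a j) * Real.exp (-(j * σ n)) / (1 - Real.exp (-(j * σ n)))
              = (j : ℝ) * (a j * Real.exp (-(j * σ n))) / (1 - Real.exp (-(j * σ n))) := by ring
            _ ≤ (j : ℝ) * (γ₂ * (j : ℝ) ^ (r - 1) * Real.exp (-(j * κ))) / (1 - Real.exp (-κ)) := by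
                have hb2 : (a j : ℝ) * Real.exp (-(j * σ n)) ≤
                    γ₂ * (j : ℝ) ^ (r - 1) * Real.exp (-(j * κ)) := hb.trans (by gcongr)
                exact div_le_div₀ (by positivity) (mul_le_mul_of_nonneg_left hb2 hj0.le) hek0
                  (by linarith)
            _ = _ := by
                rw [show r + 1 - 1 = (r - 1) + 1 by ring, Real.rpow_add_one hj0.ne']
                ring
      _ = γ₂ / (1 - Real.exp (-κ)) * ∑ j ∈ Finset.Icc 1 n, ((j:ℝ) ^ (r + 1 - 1) * Real.exp (-(j * κ))) := by
          rw [Finset.mul_sum]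
      _ ≤ _ := by
          rw [hD]
          gcongr
          exact hsum n κ hκ hκ1
  rw [hM] at hle
  have : (n0:ℝ) ≤ n := by exact_mod_cast le_trans (le_max_left _ _) hn
  linarith

lemma delta_large (a : ℕ → ℕ) (r₁ y γ₁ : ℝ) (hr : 0 < r₁) (hy : 1 ≤ y) (hγ₁ : 0 < γ₁)
    (h : ∀ j : ℕ, 1 ≤ j → γ₁ * (j : ℝ) ^ (r₁ - 1) * y ^ j ≤ (a j : ℝ))
    (σ : ℕ → ℝ) (hσ : ∀ n : ℕ, 1 ≤ n → 0 < σ n ∧ Mfun a n (σ n) = n) :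
    ∀ᶠ n : ℕ in atTop, 1 ≤ n * (σ n - Real.log y) := by
  have hlim : Tendsto (fun n : ℕ => ((n / 4 : ℕ) : ℝ) ^ r₁) atTop atTop :=
    (tendsto_rpow_atTop hr).comp (tendsto_natCast_atTop_atTop.comp (Nat.tendsto_div_const_atTop (by norm_num)))
  filter_upwards [hlim.eventually_gt_atTop (8 / (γ₁ * Real.exp (-1))), eventually_ge_atTop 4] with n hn hn4
  by_contra hc
  push Not at hc
  set m := n / 4 with hm
  have hm1 : 1 ≤ m := by omega
  have hm0 : (0:ℝ) < m := by exact_mod_cast hm1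
  obtain ⟨hs, hM⟩ := hσ n (by omega)
  have hlow : (m:ℝ) * (γ₁ * Real.exp (-1) * (m:ℝ) ^ r₁) ≤ Mfun a n (σ n) := by
    unfold Mfun
    have hnn : ∀ j ∈ Finset.Icc 1 n, 0 ≤ (j : ℝ) * (a j) * Real.exp (-(j * σ n)) / (1 - Real.exp (-(j * σ n))) := by
      intro j hj
      rw [Finset.mem_Icc] at hj
      have := q_lt j hj.1 (σ n) hs
      have : 0 < 1 - Real.exp (-(j * σ n)) := by linarith
      positivity
    have hsub : Finset.Ico m (2 * m) ⊆ Finset.Icc 1 n := by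
      intro j hj
      rw [Finset.mem_Ico] at hj
      rw [Finset.mem_Icc]
      omega
    refine le_trans ?_ (Finset.sum_le_sum_of_subset_of_nonneg hsub fun j hj _ => hnn j hj)
    calc (m:ℝ) * (γ₁ * Real.exp (-1) * (m:ℝ) ^ r₁)
        = ∑ j ∈ Finset.Ico m (2 * m), γ₁ * Real.exp (-1) * (m:ℝ) ^ r₁ := by
          rw [Finset.sum_const, Nat.card_Ico, nsmul_eq_mul]
          congr 2
          omega
      _ ≤ _ := by
          refine Finset.sum_le_sum fun j hj => ?_
          have hjI := hsub hj
          rw [Finset.mem_Icc] at hjI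
          rw [Finset.mem_Ico] at hj
          have hj0 : (0:ℝ) < j := by exact_mod_cast hjI.1
          have hmj : (m:ℝ) ≤ j := by exact_mod_cast hj.1
          have hjn : (j:ℝ) ≤ n := by exact_mod_cast hjI.2
          have hq := q_lt j hjI.1 (σ n) hs
          have hq0 := q_pos j (σ n)
          have hb := (b_bounds a y γ₁ (a j / (y ^ j)) (r₁-1) 0 hy j ⟨h j hjI.1, by
            have : y ^ j ≠ 0 := pow_ne_zero _ (by linarith)
            rw [Real.rpow_zero, mul_one, div_mul_cancel₀ _ this]⟩ (σ n)).1
          have he : Real.exp (-1) ≤ Real.exp (-(j * (σ n - Real.log y))) := by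
            rw [Real.exp_le_exp]
            rcases le_or_gt 0 (σ n - Real.log y) with h0 | h0
            · nlinarith
            · nlinarith
          have h1 : (j:ℝ) * (a j * Real.exp (-(j * σ n))) ≤
              (j : ℝ) * (a j) * Real.exp (-(j * σ n)) / (1 - Real.exp (-(j * σ n))) := by
            rw [le_div_iff₀ (by linarith), ← mul_assoc]
            have : 0 ≤ (j:ℝ) * (a j) * Real.exp (-(j * σ n)) := by positivity
            nlinarith
          refine le_trans ?_ h1
          calc γ₁ * Real.exp (-1) * (m:ℝ) ^ r₁ ≤ γ₁ * Real.exp (-1) * (j:ℝ) ^ r₁ := by gcongr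
            _ = (j:ℝ) * (γ₁ * (j:ℝ) ^ (r₁ - 1) * Real.exp (-1)) := by
                have : (j:ℝ) ^ r₁ = (j:ℝ) ^ (r₁ - 1) * j := by
                  rw [← Real.rpow_add_one hj0.ne']; congr 1; ring
                rw [this]; ring
            _ ≤ (j:ℝ) * (γ₁ * (j:ℝ) ^ (r₁ - 1) * Real.exp (-(j * (σ n - Real.log y)))) := by gcongr
            _ ≤ _ := by gcongr
  rw [hM] at hlow
  have hn8 : (n:ℝ) ≤ 8 * m := by
    have : n ≤ 8 * m := by omega
    exact_mod_cast this
  rw [div_lt_iff₀ (by positivity)] at hn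
  nlinarith

lemma setup (a : ℕ → ℕ) (r₁ r y : ℝ) (hr₁ : 0 < r₁) (hr : 0 < r) (hy : 1 ≤ y)
    (hF : FCond a r₁ r y)
    (σ : ℕ → ℝ) (hσ : ∀ n : ℕ, 1 ≤ n → 0 < σ n ∧ Mfun a n (σ n) = n) :
    ∃ (N : ℕ → ℕ) (c C : ℝ), Tendsto N atTop atTop ∧ 0 < c ∧ 0 < C ∧ ∀ᶠ n in atTop,
      1 ≤ N n ∧ 4 * N n ≤ n ∧
      (∀ j ∈ Finset.Ico (N n) (4 * N n), c * (N n : ℝ) ^ (r₁ - 1) ≤ a j * Real.exp (-(j * σ n))) ∧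
      rho3 a n (σ n) ≤ C * (N n : ℝ) ^ (r + 3) := by
  obtain ⟨γ₁, γ₂, hγ₁, hγ₂, hbd⟩ := hF
  obtain ⟨C, hC, hrho⟩ := rho3_bound a r y γ₂ hr hy hγ₂ (fun j hj => (hbd j hj).2)
  have hsm := delta_small a r y γ₂ hr hy hγ₂ (fun j hj => (hbd j hj).2) σ hσ
  have hla := delta_large a r₁ y γ₁ hr₁ hy hγ₁ (fun j hj => (hbd j hj).1) σ hσ
  refine ⟨fun n => ⌊1 / (4 * (σ n - Real.log y))⌋₊, γ₁ * Real.exp (-1) / 4 ^ |r₁ - 1|, C * 8 ^ (r + 3),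
    ?_, by positivity, by positivity, ?_⟩
  · rw [tendsto_atTop]
    intro K
    filter_upwards [hla, hsm (1 / (4 * (K + 1))) (by positivity) (by
      rw [div_le_one (by positivity)]
      have : (0:ℝ) ≤ K := by positivity
      linarith), eventually_ge_atTop 1] with n h1 h2 hn
    have hn0 : (0:ℝ) < n := by exact_mod_cast hn
    set δ := σ n - Real.log y
    have hδ : 0 < δ := by
      by_contra hc
      push Not at hc
      nlinarith
    apply Nat.le_floor
    rw [le_div_iff₀ (by positivity)]
    rw [lt_div_iff₀ (by positivity)] at h2
    nlinarith
  · filter_upwards [hla, hsm (1 / 4) (by norm_num) (by norm_num), eventually_ge_atTop 1] with n h1 h2 hn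
    have hn0 : (0:ℝ) < n := by exact_mod_cast hn
    have hδ : 0 < σ n - Real.log y := by
      by_contra hc
      push Not at hc
      nlinarith
    have hrh := hrho n (σ n) hδ (by linarith)
    have hbb := fun j (hj : 1 ≤ j) => (b_bounds a y γ₁ γ₂ (r₁ - 1) (r - 1) hy j (hbd j hj) (σ n)).1
    set δ := σ n - Real.log y with hδdef
    set N := ⌊1 / (4 * δ)⌋₊ with hN
    have hx1 : 1 ≤ 1 / (4 * δ) := by rw [le_div_iff₀ (by positivity)]; linarith
    have hN1 : 1 ≤ N := Nat.le_floor (by simpa using hx1)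
    have hN1' : (1:ℝ) ≤ N := by exact_mod_cast hN1
    have hNle : (N:ℝ) ≤ 1 / (4 * δ) := Nat.floor_le (by positivity)
    have hNlt : 1 / (4 * δ) < N + 1 := Nat.lt_floor_add_one _
    have h4N : 4 * N * δ ≤ 1 := by
      rw [le_div_iff₀ (by positivity)] at hNle
      linarith
    refine ⟨hN1, ?_, ?_, ?_⟩
    · have : (4 * N : ℝ) ≤ n := by
        by_contra hc
        push Not at hc
        nlinarith
      exact_mod_cast this
    · intro j hj
      rw [Finset.mem_Ico] at hj
      have hNj : (N:ℝ) ≤ j := by exact_mod_cast hj.1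
      have hj4 : (j:ℝ) ≤ 4 * N := by exact_mod_cast hj.2.le
      have hj0 : (0:ℝ) < j := by linarith
      have hrc := rpow_comp (r₁ - 1) N j 4 (by linarith) hNj hj4
      refine le_trans ?_ (hbb j (by omega))
      have he : Real.exp (-1) ≤ Real.exp (-(j * δ)) := by
        rw [Real.exp_le_exp]
        nlinarith
      calc γ₁ * Real.exp (-1) / 4 ^ |r₁ - 1| * (N:ℝ) ^ (r₁ - 1)
          ≤ γ₁ * Real.exp (-1) / 4 ^ |r₁ - 1| * (4 ^ |r₁ - 1| * (j:ℝ) ^ (r₁ - 1)) := by gcongr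
        _ = γ₁ * (j:ℝ) ^ (r₁ - 1) * Real.exp (-1) := by
            have : (4:ℝ) ^ |r₁ - 1| ≠ 0 := by positivity
            field_simp
        _ ≤ _ := by gcongr
    · refine hrh.trans ?_
      rw [mul_assoc, ← Real.mul_rpow (by norm_num) (by positivity)]
      gcongr
      have : 1 / δ = 4 * (1 / (4 * δ)) := by field_simp
      rw [this]
      linarith

lemma final_tail (C c ε p : ℝ) (hc : 0 < c) (hε : 0 < ε) :
    Tendsto (fun x : ℝ => 2 * (8 * C * x ^ (-(3 * ε / 4))) * Real.sqrt (2 * Real.pi)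
      + 2 * Real.pi * (Real.sqrt C * x ^ p * Real.exp (-(c / 40 * x ^ (ε / 2))))
      + Real.exp (-(c / 4 * x ^ (ε / 2))) * Real.sqrt (4 * Real.pi)) atTop (nhds 0) := by
  have hu : Tendsto (fun x : ℝ => x ^ (ε / 2)) atTop atTop := tendsto_rpow_atTop (by positivity)
  have t1 : Tendsto (fun x : ℝ => x ^ (-(3 * ε / 4))) atTop (nhds 0) :=
    tendsto_rpow_neg_atTop (by positivity)
  have t2 : Tendsto (fun x : ℝ => x ^ p * Real.exp (-(c / 40 * x ^ (ε / 2)))) atTop (nhds 0) := by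
    have h := (tendsto_rpow_mul_exp_neg_mul_atTop_nhds_zero (p / (ε / 2)) (c / 40) (by positivity)).comp hu
    refine h.congr' ?_
    filter_upwards [eventually_gt_atTop 0] with x hx
    simp only [Function.comp]
    rw [← Real.rpow_mul hx.le, mul_div_cancel₀ _ (by positivity), neg_mul]
  have t3 : Tendsto (fun x : ℝ => Real.exp (-(c / 4 * x ^ (ε / 2)))) atTop (nhds 0) :=
    Real.tendsto_exp_neg_atTop_nhds_zero.comp (hu.const_mul_atTop (by positivity))
  have := (((t1.const_mul (8 * C)).const_mul 2).mul_const (Real.sqrt (2 * Real.pi))).add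
    ((t2.const_mul (Real.sqrt C)).const_mul (2 * Real.pi)) |>.add (t3.mul_const (Real.sqrt (4 * Real.pi)))
  simp only [mul_zero, zero_mul, add_zero] at this
  refine this.congr fun x => ?_
  ring

/-- Corollary: for `r > 0`, `0 < ε ≤ r/3`, `y ≥ 1` and
`a ∈ 𝓕(2r/3 + ε, r, y)`,
`c_n ∼ (e^{nσ_n}/√(2π B_n²)) · Π_{j=1}^n (1 - e^{-jσ_n})^{-a_j}`. -/
theorem multiset_asymptotics_oscillation (a : ℕ → ℕ) (r ε y : ℝ) (hr : 0 < r)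
    (hε : 0 < ε) (hε' : ε ≤ r / 3) (hy : 1 ≤ y)
    (hF : FCond a (2 * r / 3 + ε) r y)
    (σ : ℕ → ℝ) (hσ : ∀ n : ℕ, 1 ≤ n → 0 < σ n ∧ Mfun a n (σ n) = n) :
    Tendsto (fun n : ℕ =>
      (multisetCount a n : ℝ) /
        (Real.exp (n * σ n) / Real.sqrt (2 * Real.pi * B2 a n (σ n)) *
          ∏ j ∈ Finset.Icc 1 n, (1 - Real.exp (-(j * σ n))) ^ (-(a j : ℤ))))
      atTop (nhds 1) := by
  set r₁ := 2 * r / 3 + ε with hr₁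
  have hr₁0 : 0 < r₁ := by positivity
  have ha : ∀ j, 1 ≤ j → 1 ≤ a j := by
    obtain ⟨γ₁, γ₂, hγ₁, hγ₂, hbd⟩ := hF
    intro j hj
    have h := (hbd j hj).1
    have hj0 : (0:ℝ) < j := by exact_mod_cast hj
    have hy0 : 0 < y := by linarith
    have h0 : 0 < γ₁ * (j : ℝ) ^ (r₁ - 1) * y ^ j := by positivity
    have : (0:ℝ) < a j := lt_of_lt_of_le h0 h
    exact_mod_cast this
  obtain ⟨N, c, C, hNlim, hc, hC, hev⟩ := setup a r₁ r y hr₁0 hr hy hF σ hσ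
  have htail := (final_tail C c ε ((r + 3) / 2) hc hε).comp (tendsto_natCast_atTop_atTop.comp hNlim)
  set β := 1 + r / 3 + ε / 4 with hβ
  have hsmall : ∀ᶠ n in atTop, 8 * C * (N n : ℝ) ^ (-(3 * ε / 4)) ≤ 1 := by
    have h1 : Tendsto (fun n => 8 * C * (N n : ℝ) ^ (-(3 * ε / 4))) atTop (nhds (8 * C * 0)) :=
      ((tendsto_rpow_neg_atTop (by positivity)).comp (tendsto_natCast_atTop_atTop.comp hNlim)).const_mul _
    rw [mul_zero] at h1
    filter_upwards [h1.eventually_lt_const (by norm_num : (0:ℝ) < 1)] with n hn using hn.le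
  rw [tendsto_iff_norm_sub_tendsto_zero]
  refine squeeze_zero' (Eventually.of_forall fun _ => norm_nonneg _) ?_ htail
  filter_upwards [hev, hsmall, eventually_ge_atTop 1] with n hn hsm hn1
  obtain ⟨hN1, hN4, hlow, hrho⟩ := hn
  obtain ⟨hs, hM⟩ := hσ n hn1
  simp only [Function.comp]
  set x : ℝ := (N n : ℝ) with hx
  have hx1 : (1:ℝ) ≤ x := by rw [hx]; exact_mod_cast hN1
  have hx0 : 0 < x := by linarith
  have hpi := Real.pi_gt_three
  have hpi4 := Real.pi_le_four
  set T : ℝ := x ^ (-β) with hT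
  have hT0 : 0 < T := by positivity
  have hβ0 : 0 < β := by positivity
  have hT1 : T ≤ 1 := Real.rpow_le_one_of_one_le_of_nonpos hx1 (by linarith)
  have hsub : Finset.Ico (N n) (4 * N n) ⊆ Finset.Icc 1 n := by
    intro j hj
    rw [Finset.mem_Ico] at hj
    rw [Finset.mem_Icc]
    omega
  have hT2 : T ^ 2 = x ^ (-(2 * β)) := by
    rw [hT, ← Real.rpow_natCast, ← Real.rpow_mul hx0.le]; congr 1; push_cast; ring
  have hT3 : T ^ 3 = x ^ (-(3 * β)) := by
    rw [hT, ← Real.rpow_natCast, ← Real.rpow_mul hx0.le]; congr 1; push_cast; ring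
  -- x^(r₁-1) * x^3 * T^2 = x^(ε/2)
  have hpow : x ^ (r₁ - 1) * x ^ 3 * T ^ 2 = x ^ (ε / 2) := by
    rw [hT2, ← Real.rpow_natCast x 3, ← Real.rpow_add hx0, ← Real.rpow_add hx0]
    congr 1
    rw [hr₁, hβ]; push_cast; ring
  have hB2low : c * (x ^ (r₁ - 1) * x ^ 3) ≤ B2 a n (σ n) := by
    unfold B2
    have hnn : ∀ j ∈ Finset.Icc 1 n, (j:ℝ) ^ 2 * (a j * Real.exp (-(j * σ n))) ≤
        (j : ℝ) ^ 2 * (a j) * Real.exp (-(j * σ n)) / (1 - Real.exp (-(j * σ n))) ^ 2 := by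
      intro j hj
      rw [Finset.mem_Icc] at hj
      have h1 := q_lt j hj.1 (σ n) hs
      have h2 := q_pos j (σ n)
      have h3 : 0 < 1 - Real.exp (-(j * σ n)) := by linarith
      rw [le_div_iff₀ (by positivity), ← mul_assoc]
      have h4 : 0 ≤ (j:ℝ) ^ 2 * (a j) * Real.exp (-(j * σ n)) := by positivity
      have h5 : (1 - Real.exp (-(j * σ n))) ^ 2 ≤ 1 := pow_le_one₀ h3.le (by linarith)
      nlinarith
    calc c * (x ^ (r₁ - 1) * x ^ 3) = x * (x ^ 2 * (c * x ^ (r₁ - 1))) := by ring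
      _ ≤ ∑ j ∈ Finset.Ico (N n) (4 * N n), (x ^ 2 * (c * x ^ (r₁ - 1))) := by
          rw [Finset.sum_const, Nat.card_Ico, nsmul_eq_mul]
          gcongr
          rw [hx]
          have : N n ≤ 4 * N n - N n := by omega
          exact_mod_cast this
      _ ≤ ∑ j ∈ Finset.Ico (N n) (4 * N n), (j:ℝ) ^ 2 * (a j * Real.exp (-(j * σ n))) := by
          refine Finset.sum_le_sum fun j hj => ?_
          have h1 := hlow j hj
          rw [Finset.mem_Ico] at hj
          have h2 : x ≤ j := by rw [hx]; exact_mod_cast hj.1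
          gcongr
      _ ≤ ∑ j ∈ Finset.Icc 1 n, (j:ℝ) ^ 2 * (a j * Real.exp (-(j * σ n))) :=
          Finset.sum_le_sum_of_subset_of_nonneg hsub fun j _ _ => by positivity
      _ ≤ _ := Finset.sum_le_sum hnn
  have hB0 : 0 < B2 a n (σ n) := lt_of_lt_of_le (by positivity) hB2low
  have hrhoT : 8 * T ^ 3 * rho3 a n (σ n) ≤ 8 * C * x ^ (-(3 * ε / 4)) := by
    calc 8 * T ^ 3 * rho3 a n (σ n) ≤ 8 * T ^ 3 * (C * x ^ (r + 3)) := by gcongr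
      _ = 8 * C * (x ^ (-(3 * β)) * x ^ (r + 3)) := by rw [hT3]; ring
      _ = _ := by
        rw [← Real.rpow_add hx0]
        congr 2
        rw [hβ]; ring
  have hratio := ratio_bound a n (σ n) T (Real.exp (-(c / 40 * x ^ (ε / 2)))) hs ha hM hB0 hT0
    (by linarith) (Real.exp_pos _).le (hrhoT.trans hsm) ?_
  · rw [Real.norm_eq_abs]
    refine hratio.trans ?_
    gcongr ?_ + ?_ + ?_
    · gcongr
    · have hsq : Real.sqrt (B2 a n (σ n)) ≤ Real.sqrt C * x ^ ((r + 3) / 2) := by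
        have e : Real.sqrt C * x ^ ((r + 3) / 2) = Real.sqrt (C * x ^ (r + 3)) := by
          rw [Real.sqrt_mul hC.le, Real.sqrt_eq_rpow (x ^ (r + 3)), ← Real.rpow_mul hx0.le]
          congr 2
          ring
        rw [e]
        exact Real.sqrt_le_sqrt ((B2_le_rho3 a n (σ n) hs).trans hrho)
      gcongr
    · gcongr
      calc c / 4 * x ^ (ε / 2) = c * (x ^ (r₁ - 1) * x ^ 3) * T ^ 2 / 4 := by rw [← hpow]; ring
        _ ≤ _ := by gcongr
  · intro t ht1 ht2
    refine (Fch_norm a n (σ n) hs t).trans ?_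
    rw [Real.exp_le_exp, neg_le_neg_iff]
    have hsin : x ^ (ε / 2) / 16 ≤ x ^ (r₁ - 1) * ∑ j ∈ Finset.Ico (N n) (4 * N n), Real.sin (j * t / 2) ^ 2 := by
      rcases le_total |t| (Real.pi / (2 * N n)) with h | h
      · have h1 := trig_small (N n) hN1 t h
        rw [← hx] at h1
        have h2 : T ^ 2 ≤ t ^ 2 := by rw [← sq_abs t]; gcongr
        have h3 : Real.pi ^ 2 ≤ 16 := by nlinarith
        calc x ^ (ε / 2) / 16 = x ^ (r₁ - 1) * (x ^ 3 * T ^ 2 / 16) := by rw [← hpow]; ring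
          _ ≤ x ^ (r₁ - 1) * (x ^ 3 * t ^ 2 / Real.pi ^ 2) := by gcongr
          _ ≤ _ := by gcongr
      · have h1 := trig_large (N n) hN1 t h ht2
        rw [← hx] at h1
        have h2 : x ^ (ε / 2) ≤ x ^ r₁ := Real.rpow_le_rpow_of_exponent_le hx1 (by rw [hr₁]; linarith)
        have h3 : x ^ r₁ = x ^ (r₁ - 1) * x := by
          rw [← Real.rpow_add_one hx0.ne']; congr 1; ring
        have h4 : 0 < x ^ r₁ := by positivity
        calc x ^ (ε / 2) / 16 ≤ x ^ (r₁ - 1) * (x / 8) := by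
              rw [← mul_div_assoc, ← h3]; linarith
          _ ≤ _ := by gcongr
    have hsum : c * (x ^ (r₁ - 1) * ∑ j ∈ Finset.Ico (N n) (4 * N n), Real.sin (j * t / 2) ^ 2) ≤
        ∑ j ∈ Finset.Icc 1 n, (a j * Real.exp (-(j * σ n))) * Real.sin (j * t / 2) ^ 2 := by
      rw [← mul_assoc, Finset.mul_sum]
      calc _ ≤ ∑ j ∈ Finset.Ico (N n) (4 * N n), (a j * Real.exp (-(j * σ n))) * Real.sin (j * t / 2) ^ 2 := by
            refine Finset.sum_le_sum fun j hj => ?_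
            have := hlow j hj
            gcongr
        _ ≤ _ := Finset.sum_le_sum_of_subset_of_nonneg hsub fun j _ _ => by positivity
    nlinarith [mul_le_mul_of_nonneg_left hsin hc.le]
end

section
/- Assume condition (exp). Then c_n / c_{n+1} = y^{−1} exp(−δ_n + o(δ_n)) as n → ∞; equivalently, (log(c_n/c_{n+1}) + log y) / δ_n → −1 as n → ∞. -/
open Finset Filter

/-- Condition (exp): `a_j ≍ j^{r-1} y^j`, i.e. there are constants `D₁, D₂ > 0` with
`D₁ j^{r-1} y^j ≤ a_j ≤ D₂ j^{r-1} y^j` for all `j ≥ 1`. -/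
def ExpansiveCond (a : ℕ → ℕ) (r y : ℝ) : Prop :=
  ∃ D₁ D₂ : ℝ, 0 < D₁ ∧ 0 < D₂ ∧ ∀ j : ℕ, 1 ≤ j →
    D₁ * (j : ℝ) ^ (r - 1) * y ^ j ≤ (a j : ℝ) ∧ (a j : ℝ) ≤ D₂ * (j : ℝ) ^ (r - 1) * y ^ j


/-- The power series of `(1 - X^j)^{-a}` over `ℂ`. -/
noncomputable def serH (j a : ℕ) : PowerSeries ℂ :=
  PowerSeries.mk fun k => if j ∣ k then ((Nat.choose (a + k / j - 1) (k / j) : ℕ) : ℂ) else 0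

lemma serH_zero (j : ℕ) (hj : 1 ≤ j) : serH j 0 = 1 := by
  ext k
  simp only [serH, PowerSeries.coeff_mk, PowerSeries.coeff_one]
  by_cases hk : k = 0
  · subst hk; simp
  · rw [if_neg hk]
    split_ifs with hd
    · obtain ⟨e, rfl⟩ := hd
      have he : 0 < e := by
        rcases Nat.eq_zero_or_pos e with h | h
        · subst h; simp at hk
        · exact h
      rw [Nat.mul_div_cancel_left _ hj]
      rw [Nat.choose_eq_zero_of_lt (by omega)]; simp
    · rfl

lemma serH_succ (j a : ℕ) (hj : 1 ≤ j) :
    serH j (a + 1) = serH j a + PowerSeries.X ^ j * serH j (a + 1) := by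
  ext k
  rw [map_add, PowerSeries.coeff_X_pow_mul']
  simp only [serH, PowerSeries.coeff_mk]
  by_cases hd : j ∣ k
  · obtain ⟨e, rfl⟩ := hd
    rcases Nat.eq_zero_or_pos e with h | h
    · subst h
      have : ¬ (j ≤ 0) := by omega
      simp [this]
    · obtain ⟨e, rfl⟩ : ∃ e', e = e' + 1 := ⟨e - 1, by omega⟩
      have h1 : j ≤ j * (e + 1) := Nat.le_mul_of_pos_right _ h
      have h2 : j * (e + 1) - j = j * e := by rw [Nat.mul_add, Nat.mul_one]; omega
      rw [if_pos h1, h2, if_pos (Dvd.intro _ rfl), if_pos (Dvd.intro _ rfl), if_pos (Dvd.intro _ rfl),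
        Nat.mul_div_cancel_left _ hj, Nat.mul_div_cancel_left _ hj]
      rw [← Nat.cast_add]
      congr 1
      have e1 : a + 1 + (e + 1) - 1 = (a + e) + 1 := by omega
      have e2 : a + (e + 1) - 1 = a + e := by omega
      have e3 : a + 1 + e - 1 = a + e := by omega
      rw [e1, e2, e3, Nat.choose_succ_succ, add_comm]
  · rw [if_neg hd, if_neg hd]
    split_ifs with h1 h2
    · exact absurd (by have := Nat.dvd_add h2 (dvd_refl j); rwa [Nat.sub_add_cancel h1] at this) hd
    · simp
    · simp

/-- Absolute convergence of the series `F` at `z` with value `v`. -/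
def GoodAt (z : ℂ) (F : PowerSeries ℂ) (v : ℂ) : Prop :=
  Summable (fun k => ‖PowerSeries.coeff k F * z ^ k‖) ∧ HasSum (fun k => PowerSeries.coeff k F * z ^ k) v

lemma GoodAt.mul {z : ℂ} {F G : PowerSeries ℂ} {v w : ℂ} (hF : GoodAt z F v) (hG : GoodAt z G w) :
    GoodAt z (F * G) (v * w) := by
  have key : ∀ k, PowerSeries.coeff k (F * G) * z ^ k =
      ∑ p ∈ Finset.HasAntidiagonal.antidiagonal k, (PowerSeries.coeff p.1 F * z ^ p.1) * (PowerSeries.coeff p.2 G * z ^ p.2) := by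
    intro k
    rw [PowerSeries.coeff_mul, Finset.sum_mul]
    refine Finset.sum_congr rfl fun p hp => ?_
    rw [← Finset.HasAntidiagonal.mem_antidiagonal.1 hp, pow_add]; ring
  have hs := summable_norm_sum_mul_antidiagonal_of_summable_norm hF.1 hG.1
  have ht := tsum_mul_tsum_eq_tsum_sum_antidiagonal_of_summable_norm hF.1 hG.1
  constructor
  · simpa only [key] using hs
  · simp only [key]
    rw [← hF.2.tsum_eq, ← hG.2.tsum_eq, ht]
    exact hs.of_norm.hasSum

lemma goodAt_one (z : ℂ) : GoodAt z 1 1 := by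
  have h : ∀ k, k ∉ ({0} : Finset ℕ) → PowerSeries.coeff k (1 : PowerSeries ℂ) * z ^ k = 0 := by
    intro k hk
    have : k ≠ 0 := by simpa using hk
    simp [PowerSeries.coeff_one, this]
  refine ⟨summable_of_ne_finset_zero (s := {0}) fun k hk => by rw [h k hk, norm_zero], ?_⟩
  have := hasSum_sum_of_ne_finset_zero (L := SummationFilter.unconditional ℕ) h
  simpa using this

lemma GoodAt.prod {ι : Type*} {z : ℂ} (s : Finset ι) {F : ι → PowerSeries ℂ} {v : ι → ℂ}
    (h : ∀ i ∈ s, GoodAt z (F i) (v i)) : GoodAt z (∏ i ∈ s, F i) (∏ i ∈ s, v i) := by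
  classical
  induction s using Finset.induction_on with
  | empty => simpa using goodAt_one z
  | insert i s hi ih =>
    rw [Finset.prod_insert hi, Finset.prod_insert hi]
    exact (h i (Finset.mem_insert_self _ _)).mul (ih fun k hk => h k (Finset.mem_insert_of_mem hk))

lemma goodAt_serH_one (j : ℕ) (hj : 1 ≤ j) (z : ℂ) (hz : ‖z‖ < 1) :
    GoodAt z (serH j 1) ((1 - z ^ j)⁻¹) := by
  have hzj : ‖z ^ j‖ < 1 := by
    rw [norm_pow]; exact pow_lt_one₀ (norm_nonneg _) hz (by omega)
  have hc : ∀ k, PowerSeries.coeff k (serH j 1) = if j ∣ k then 1 else 0 := by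
    intro k
    simp [serH]
  have hinj : Function.Injective (fun e : ℕ => j * e) := fun x y h => Nat.eq_of_mul_eq_mul_left hj h
  have hout : ∀ k ∉ Set.range (fun e : ℕ => j * e), PowerSeries.coeff k (serH j 1) * z ^ k = 0 := by
    intro k hk
    rw [hc, if_neg, zero_mul]
    rintro ⟨e, rfl⟩; exact hk ⟨e, rfl⟩
  constructor
  · rw [← hinj.summable_iff]
    · have : Summable fun e : ℕ => ‖z ^ j‖ ^ e := summable_geometric_of_lt_one (norm_nonneg _) hzj
      convert this using 2 with e
      simp [hc, pow_mul]
    · intro k hk; rw [hout k hk, norm_zero]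
  · rw [← hinj.hasSum_iff hout]
    simpa [Function.comp_def, hc, pow_mul] using hasSum_geometric_of_norm_lt_one hzj

lemma serH_eq_pow (j a : ℕ) (hj : 1 ≤ j) : serH j a = serH j 1 ^ a := by
  have h1 : serH j 1 * (1 - PowerSeries.X ^ j) = 1 := by
    have := serH_succ j 0 hj
    rw [serH_zero j hj, zero_add] at this
    linear_combination this
  induction a with
  | zero => rw [serH_zero j hj, pow_zero]
  | succ a ih =>
    have := serH_succ j a hj
    rw [pow_succ, ← ih]
    linear_combination (serH j 1) * this - (serH j (a+1)) * h1

lemma goodAt_serH (j a : ℕ) (hj : 1 ≤ j) (z : ℂ) (hz : ‖z‖ < 1) :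
    GoodAt z (serH j a) (((1 - z ^ j)⁻¹) ^ a) := by
  rw [serH_eq_pow j a hj]
  have := GoodAt.prod (z := z) (Finset.range a) (F := fun _ => serH j 1) (v := fun _ => (1 - z ^ j)⁻¹)
    (fun _ _ => goodAt_serH_one j hj z hz)
  simpa using this

lemma coeff_prod_serH (a : ℕ → ℕ) (m N : ℕ) (hm : m ≤ N) :
    PowerSeries.coeff m (∏ j ∈ Finset.Icc 1 N, serH j (a j)) = (multisetCount a m : ℂ) := by
  classical
  set I : Ideal (PowerSeries ℂ) := Ideal.span {PowerSeries.X ^ (m + 1)} with hI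
  have hmk : ∀ F G : PowerSeries ℂ, Ideal.Quotient.mk I F = Ideal.Quotient.mk I G ↔
      ∀ k ≤ m, PowerSeries.coeff k F = PowerSeries.coeff k G := by
    intro F G
    rw [Ideal.Quotient.eq, hI, Ideal.mem_span_singleton, PowerSeries.X_pow_dvd_iff]
    constructor
    · intro h k hk
      have := h k (by omega)
      rwa [map_sub, sub_eq_zero] at this
    · intro h k hk
      rw [map_sub, h k (by omega), sub_self]
  let Q : ℕ → PowerSeries ℂ := fun j => ∑ e : Fin (m + 1),
    PowerSeries.monomial (j * e.1) ((Nat.choose (a j + e.1 - 1) e.1 : ℕ) : ℂ)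
  have hQ : ∀ j, 1 ≤ j → Ideal.Quotient.mk I (serH j (a j)) = Ideal.Quotient.mk I (Q j) := by
    intro j hj
    rw [hmk]
    intro k hk
    simp only [Q, serH, PowerSeries.coeff_mk, map_sum, PowerSeries.coeff_monomial]
    by_cases hd : j ∣ k
    · obtain ⟨e, rfl⟩ := hd
      have he : e ≤ m := le_trans (Nat.le_mul_of_pos_left _ hj) hk
      rw [if_pos (Dvd.intro _ rfl), Nat.mul_div_cancel_left _ hj]
      rw [Finset.sum_eq_single (⟨e, by omega⟩ : Fin (m + 1))]
      · simp
      · intro b _ hb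
        rw [if_neg]
        intro h
        exact hb (Fin.ext (Nat.eq_of_mul_eq_mul_left hj h).symm)
      · simp
    · rw [if_neg hd]
      symm
      refine Finset.sum_eq_zero fun e _ => ?_
      rw [if_neg]
      rintro rfl
      exact hd (Dvd.intro _ rfl)
  have hone : ∀ j, m < j → Ideal.Quotient.mk I (serH j (a j)) = 1 := by
    intro j hj
    rw [← map_one (Ideal.Quotient.mk I), hmk]
    intro k hk
    simp only [serH, PowerSeries.coeff_mk, PowerSeries.coeff_one]
    by_cases h0 : k = 0
    · subst h0; simp
    · rw [if_neg h0, if_neg]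
      intro hd
      exact absurd (Nat.le_of_dvd (by omega) hd) (by omega)
  have hprod : Ideal.Quotient.mk I (∏ j ∈ Finset.Icc 1 N, serH j (a j)) =
      Ideal.Quotient.mk I (∏ j : Fin m, Q (j.1 + 1)) := by
    rw [map_prod, map_prod]
    rw [Fin.prod_univ_eq_prod_range (fun j => Ideal.Quotient.mk I (Q (j + 1))) m]
    rw [← Finset.prod_subset (s₁ := Finset.Icc 1 m) (Finset.Icc_subset_Icc_right hm)]
    · rw [Finset.prod_congr rfl fun j hj => hQ j (Finset.mem_Icc.1 hj).1]
      rw [Finset.range_eq_Ico, Finset.prod_Ico_add' (fun j => Ideal.Quotient.mk I (Q j)) 0 m 1]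
      rfl
    · intro j hj hj'
      apply hone
      simp only [Finset.mem_Icc] at hj hj'
      omega
  rw [(hmk _ _).1 hprod m le_rfl]
  simp only [Q]
  rw [Finset.prod_univ_sum, Fintype.piFinset_univ, map_sum, multisetCount, Nat.cast_sum]
  refine Finset.sum_congr rfl fun η _ => ?_
  have hmon : ∀ (s : Finset (Fin m)), ∏ j ∈ s, PowerSeries.monomial ((j.1 + 1) * (η j).1)
      ((Nat.choose (a (j.1 + 1) + (η j).1 - 1) (η j).1 : ℕ) : ℂ) =
      PowerSeries.monomial (∑ j ∈ s, (j.1 + 1) * (η j).1)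
        (∏ j ∈ s, ((Nat.choose (a (j.1 + 1) + (η j).1 - 1) (η j).1 : ℕ) : ℂ)) := by
    intro s
    induction s using Finset.induction_on with
    | empty => simp
    | insert i s hi ih =>
      rw [Finset.prod_insert hi, Finset.prod_insert hi, Finset.sum_insert hi, ih,
        PowerSeries.monomial_mul_monomial]
  rw [hmon, PowerSeries.coeff_monomial]
  by_cases h : ∑ j : Fin m, (j.1 + 1) * (η j).1 = m
  · rw [if_pos h.symm, if_pos h]; push_cast; rfl
  · rw [if_neg (Ne.symm h), if_neg h]; simp

/-- The characteristic function of the total size under the Boltzmann measure. -/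
noncomputable def charF (a : ℕ → ℕ) (N : ℕ) (σ t : ℝ) : ℂ :=
  ∏ j ∈ Finset.Icc 1 N, (((1 - Real.exp (-(j * σ)) : ℝ) : ℂ) /
    (1 - (Real.exp (-(j * σ)) : ℂ) * Complex.exp ((j * t : ℝ) * Complex.I))) ^ (a j)

/-- The probability of total size `m` under the Boltzmann measure. -/
noncomputable def probP (a : ℕ → ℕ) (N : ℕ) (σ : ℝ) (m : ℕ) : ℝ :=
  (multisetCount a m : ℝ) * Real.exp (-(m * σ)) *
    ∏ j ∈ Finset.Icc 1 N, (1 - Real.exp (-(j * σ))) ^ (a j)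

lemma exp_neg_mul_lt_one {σ : ℝ} (hσ : 0 < σ) {j : ℕ} (hj : 1 ≤ j) : Real.exp (-(j * σ)) < 1 := by
  rw [Real.exp_lt_one_iff]
  have : (0 : ℝ) < j := by exact_mod_cast hj
  have := mul_pos this hσ
  linarith

lemma one_sub_ne_zero {u θ : ℝ} (hu : 0 < u) (hu1 : u < 1) :
    (1 - (u : ℂ) * Complex.exp ((θ : ℝ) * Complex.I)) ≠ 0 := by
  intro h
  have h2 : (u : ℂ) * Complex.exp ((θ : ℝ) * Complex.I) = 1 := (sub_eq_zero.1 h).symm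
  have h3 := congrArg norm h2
  rw [norm_mul, Complex.norm_exp_ofReal_mul_I, Complex.norm_real, Real.norm_eq_abs, abs_of_pos hu] at h3
  simp at h3
  linarith

lemma charF_continuous (a : ℕ → ℕ) (N : ℕ) (σ : ℝ) (hσ : 0 < σ) : Continuous (charF a N σ) := by
  unfold charF
  refine continuous_finsetProd _ fun j hj => ?_
  refine Continuous.pow (Continuous.div continuous_const (by fun_prop) ?_) _
  intro t
  exact one_sub_ne_zero (Real.exp_pos _) (exp_neg_mul_lt_one hσ (Finset.mem_Icc.1 hj).1)

lemma integral_cexp_int (k : ℤ) (hk : k ≠ 0) :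
    ∫ t in (-Real.pi)..Real.pi, Complex.exp (((k : ℂ) * Complex.I) * (t : ℂ)) = 0 := by
  rw [integral_exp_mul_complex (mul_ne_zero (by exact_mod_cast hk) Complex.I_ne_zero)]
  have : Complex.exp ((k : ℂ) * Complex.I * (Real.pi : ℝ)) =
      Complex.exp ((k : ℂ) * Complex.I * ((-Real.pi : ℝ) : ℂ)) := by
    rw [Complex.exp_eq_exp_iff_exists_int]
    exact ⟨k, by push_cast; ring⟩
  rw [this, sub_self, zero_div]

lemma integral_charF (a : ℕ → ℕ) (N m : ℕ) (hm : m ≤ N) (σ : ℝ) (hσ : 0 < σ) :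
    ∫ t in (-Real.pi)..Real.pi, charF a N σ t * Complex.exp (-((m : ℂ) * t) * Complex.I) =
      ((2 * Real.pi * probP a N σ m : ℝ) : ℂ) := by
  set F : PowerSeries ℂ := ∏ j ∈ Finset.Icc 1 N, serH j (a j) with hF
  set Z : ℂ := ∏ j ∈ Finset.Icc 1 N, (((1 - Real.exp (-(j * σ)) : ℝ) : ℂ)) ^ (a j) with hZ
  have hgood : ∀ t : ℝ, GoodAt (Complex.exp (-σ + t * Complex.I)) F
      (∏ j ∈ Finset.Icc 1 N, ((1 - (Complex.exp (-σ + t * Complex.I)) ^ j)⁻¹) ^ (a j)) := by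
    intro t
    refine GoodAt.prod _ fun j hj => goodAt_serH j (a j) (Finset.mem_Icc.1 hj).1 _ ?_
    rw [Complex.norm_exp]
    simp [hσ]
  have hval : ∀ t : ℝ, Z * (∏ j ∈ Finset.Icc 1 N, ((1 - (Complex.exp (-σ + t * Complex.I)) ^ j)⁻¹) ^ (a j))
      = charF a N σ t := by
    intro t
    rw [hZ, ← Finset.prod_mul_distrib]
    unfold charF
    refine Finset.prod_congr rfl fun j _ => ?_
    rw [← mul_pow, ← div_eq_mul_inv, ← Complex.exp_nat_mul]
    congr 3
    rw [Complex.ofReal_exp, ← Complex.exp_add]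
    congr 2
    push_cast; ring
  have hsum : ∀ t : ℝ, HasSum (fun k : ℕ => (Z * (PowerSeries.coeff k F * Complex.exp (-(k * σ)))) *
      Complex.exp ((((k : ℤ) - (m : ℤ) : ℤ) : ℂ) * Complex.I * t))
      (charF a N σ t * Complex.exp (-((m : ℂ) * t) * Complex.I)) := by
    intro t
    have h := ((hgood t).2.mul_left Z).mul_right (Complex.exp (-((m : ℂ) * t) * Complex.I))
    rw [hval] at h
    refine (funext fun k => ?_ : (fun k : ℕ => (Z * (PowerSeries.coeff k F * Complex.exp (-(k * σ)))) *
      Complex.exp ((((k : ℤ) - (m : ℤ) : ℤ) : ℂ) * Complex.I * t)) = _) ▸ h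
    have e1 : Complex.exp (-(k * σ)) * Complex.exp ((((k : ℤ) - (m : ℤ) : ℤ) : ℂ) * Complex.I * t) =
        Complex.exp (k * (-σ + t * Complex.I)) * Complex.exp (-((m : ℂ) * t) * Complex.I) := by
      rw [← Complex.exp_add, ← Complex.exp_add]
      congr 1
      push_cast; ring
    rw [← Complex.exp_nat_mul]
    linear_combination (Z * PowerSeries.coeff k F) * e1
  have hIntg := intervalIntegral.hasSum_integral_of_dominated_convergence
    (μ := MeasureTheory.volume) (a := -Real.pi) (b := Real.pi)
    (F := fun (k : ℕ) (t : ℝ) => (Z * (PowerSeries.coeff k F * Complex.exp (-(k * σ)))) *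
      Complex.exp ((((k : ℤ) - (m : ℤ) : ℤ) : ℂ) * Complex.I * t))
    (f := fun t => charF a N σ t * Complex.exp (-((m : ℂ) * t) * Complex.I))
    (fun k _ => ‖Z‖ * ‖PowerSeries.coeff k F * (Complex.exp (-σ + (0:ℝ) * Complex.I)) ^ k‖)
    (fun k => by
      apply Continuous.aestronglyMeasurable
      fun_prop)
    (fun k => by
      refine Filter.Eventually.of_forall fun t _ => ?_
      rw [norm_mul, norm_mul, ← Complex.exp_nat_mul]
      have h1 : ‖Complex.exp ((((k : ℤ) - (m : ℤ) : ℤ) : ℂ) * Complex.I * t)‖ = 1 := by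
        rw [Complex.norm_exp]; simp
      rw [h1, mul_one]
      apply le_of_eq
      congr 4
      push_cast; ring)
    (Filter.Eventually.of_forall fun t _ => ((hgood 0).1.mul_left ‖Z‖))
    (by simp)
    (Filter.Eventually.of_forall fun t _ => hsum t)
  have hsingle := hasSum_single (f := fun k : ℕ => ∫ t in (-Real.pi)..Real.pi,
      (Z * (PowerSeries.coeff k F * Complex.exp (-(k * σ)))) *
      Complex.exp ((((k : ℤ) - (m : ℤ) : ℤ) : ℂ) * Complex.I * t)) m (by
    intro k hk
    rw [intervalIntegral.integral_const_mul, integral_cexp_int, mul_zero]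
    omega)
  rw [hIntg.unique hsingle]
  simp only [sub_self, Int.cast_zero, zero_mul, Complex.exp_zero, mul_one]
  rw [intervalIntegral.integral_const, hF, coeff_prod_serH a m N hm, hZ]
  unfold probP
  rw [Complex.real_smul]
  push_cast
  ring

lemma cexp_taylor_three (x : ℝ) :
    ‖Complex.exp ((x : ℝ) * Complex.I) - 1 - x * Complex.I + x ^ 2 / 2‖ ≤ 4 * |x| ^ 3 := by
  rcases le_total |x| 1 with h | h
  · have hn : ‖(x : ℂ) * Complex.I‖ = |x| := by simp
    have := Complex.exp_bound (x := (x : ℂ) * Complex.I) (by rw [hn]; exact h) (n := 3) (by norm_num)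
    rw [hn] at this
    have e : Complex.exp ((x : ℝ) * Complex.I) - 1 - x * Complex.I + x ^ 2 / 2 =
        Complex.exp ((x : ℝ) * Complex.I) -
          ∑ m ∈ Finset.range 3, ((x : ℂ) * Complex.I) ^ m / (m.factorial : ℂ) := by
      simp [Finset.sum_range_succ, mul_pow]
      ring
    rw [e]
    refine this.trans ?_
    have h3 : 0 ≤ |x| ^ 3 := by positivity
    norm_num [Nat.factorial]
    linarith
  · have h1 : ‖Complex.exp ((x : ℝ) * Complex.I)‖ = 1 := Complex.norm_exp_ofReal_mul_I x
    have h2 : ‖(x : ℂ) * Complex.I‖ = |x| := by simp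
    have h3 : ‖(x : ℂ) ^ 2 / 2‖ = |x| ^ 2 / 2 := by simp
    have h4 : ‖(1 : ℂ)‖ = 1 := norm_one
    have := norm_add_le (Complex.exp ((x : ℝ) * Complex.I) - 1 - x * Complex.I) ((x : ℂ) ^ 2 / 2)
    have := norm_sub_le (Complex.exp ((x : ℝ) * Complex.I) - 1) (x * Complex.I)
    have := norm_sub_le (Complex.exp ((x : ℝ) * Complex.I)) 1
    have : 1 ≤ |x| ^ 2 := by nlinarith
    have : |x| ^ 2 ≤ |x| ^ 3 := by nlinarith
    nlinarith

lemma factor_log (u θ : ℝ) (hu : 0 < u) (hu1 : u < 1) :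
    ∃ L : ℂ, Complex.exp L = ((1 - u : ℝ) : ℂ) / (1 - (u : ℂ) * Complex.exp ((θ : ℝ) * Complex.I)) ∧
      L.re ≤ -(u * (1 - Real.cos θ)) ∧
      ‖L - ((u / (1 - u) * θ : ℝ) : ℂ) * Complex.I + ((u / (1 - u) ^ 2 * θ ^ 2 / 2 : ℝ) : ℂ)‖
        ≤ 8 * (u / (1 - u) ^ 3) * |θ| ^ 3 := by
  have h1u : 0 < 1 - u := by linarith
  set w : ℂ := (u : ℂ) * Complex.exp ((θ : ℝ) * Complex.I) with hw
  have hun : ‖(u : ℂ)‖ < 1 := by rw [Complex.norm_real, Real.norm_eq_abs, abs_of_pos hu]; exact hu1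
  have hwn : ‖w‖ < 1 := by
    rw [hw, norm_mul, Complex.norm_exp_ofReal_mul_I, mul_one]; exact hun
  have hs1 := Complex.hasSum_taylorSeries_neg_log hwn
  have hs2 := Complex.hasSum_taylorSeries_neg_log hun
  have hs := hs1.sub hs2
  set L : ℂ := -Complex.log (1 - w) - -Complex.log (1 - (u : ℂ)) with hL
  have hterm : ∀ k : ℕ, w ^ k / k - (u : ℂ) ^ k / k =
      ((u ^ k / k : ℝ) : ℂ) * (Complex.exp (((k * θ : ℝ) : ℂ) * Complex.I) - 1) := by
    intro k
    rw [hw, mul_pow, ← Complex.exp_nat_mul]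
    push_cast
    rw [show (k : ℂ) * ((θ : ℂ) * Complex.I) = (k : ℂ) * θ * Complex.I by ring]
    ring
  have hne1 : (1 - w) ≠ 0 := one_sub_ne_zero hu hu1
  have hne2 : (1 - (u : ℂ)) ≠ 0 := by
    have : ((1 - u : ℝ) : ℂ) ≠ 0 := by exact_mod_cast h1u.ne'
    simpa using this
  refine ⟨L, ?_, ?_, ?_⟩
  · rw [hL, sub_neg_eq_add, Complex.exp_add, Complex.exp_neg, Complex.exp_log hne1, Complex.exp_log hne2]
    push_cast
    field_simp
  · have hre := Complex.hasSum_re hs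
    have hre' := hre.neg
    have hterm_re : ∀ k : ℕ, -(w ^ k / k - (u : ℂ) ^ k / k).re = u ^ k / k * (1 - Real.cos (k * θ)) := by
      intro k
      rw [hterm k, Complex.re_ofReal_mul, Complex.sub_re, Complex.exp_ofReal_mul_I_re, Complex.one_re]
      ring
    have hge : -(w ^ 1 / (1 : ℕ) - (u : ℂ) ^ 1 / (1 : ℕ)).re ≤ -L.re := by
      refine le_hasSum hre' 1 fun k _ => ?_
      rw [hterm_re]
      have := Real.cos_le_one (k * θ)
      have : 0 ≤ u ^ k / k := by positivity
      exact mul_nonneg this (by linarith)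
    rw [hterm_re] at hge
    simp at hge
    linarith
  · have hg1 : HasSum (fun k : ℕ => ((u ^ (k+1) : ℝ) : ℂ)) ((u / (1 - u) : ℝ) : ℂ) := by
      rw [Complex.hasSum_ofReal]
      have := (hasSum_geometric_of_lt_one hu.le hu1).mul_left u
      simpa [pow_succ', div_eq_mul_inv] using this
    have hg2 : HasSum (fun k : ℕ => (((k + 1 : ℕ) * u ^ (k + 1) : ℝ) : ℂ)) ((u / (1 - u) ^ 2 : ℝ) : ℂ) := by
      rw [Complex.hasSum_ofReal]
      have := hasSum_coe_mul_geometric_of_norm_lt_one (r := u) (by rwa [Real.norm_eq_abs, abs_of_pos hu])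
      rw [← hasSum_nat_add_iff' 1] at this
      simpa using this
    have hg3 : HasSum (fun k : ℕ => 8 * |θ| ^ 3 * u * (((k + 2).choose 2 : ℕ) * u ^ k))
        (8 * |θ| ^ 3 * u * (1 / (1 - u) ^ 3)) :=
      (hasSum_choose_mul_geometric_of_norm_lt_one 2 (r := u)
        (by rwa [Real.norm_eq_abs, abs_of_pos hu])).mul_left _
    have hs' : HasSum (fun k : ℕ => w ^ (k+1) / (k+1 : ℕ) - (u : ℂ) ^ (k+1) / (k+1 : ℕ)) L := by
      have := (hasSum_nat_add_iff' 1).2 hs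
      simpa using this
    have htot := (hs'.sub (hg1.mul_right ((θ : ℂ) * Complex.I))).add (hg2.mul_right ((θ : ℂ) ^ 2 / 2))
    have e : L - ((u / (1 - u) * θ : ℝ) : ℂ) * Complex.I + ((u / (1 - u) ^ 2 * θ ^ 2 / 2 : ℝ) : ℂ) =
      L - ((u / (1 - u) : ℝ) : ℂ) * (θ * Complex.I) + ((u / (1 - u) ^ 2 : ℝ) : ℂ) * (θ ^ 2 / 2) := by
      push_cast; ring
    rw [e, ← htot.tsum_eq]
    have e2 : 8 * (u / (1 - u) ^ 3) * |θ| ^ 3 = 8 * |θ| ^ 3 * u * (1 / (1 - u) ^ 3) := by ring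
    rw [e2]
    refine tsum_of_norm_bounded hg3 fun k => ?_
    rw [hterm]
    have hk : ((k + 1 : ℕ) : ℂ) ≠ 0 := by exact_mod_cast Nat.succ_ne_zero k
    have e3 : ((u ^ (k+1) / (k+1 : ℕ) : ℝ) : ℂ) * (Complex.exp ((((k+1 : ℕ) * θ : ℝ) : ℂ) * Complex.I) - 1) -
        ((u ^ (k+1) : ℝ) : ℂ) * (θ * Complex.I) +
        (((k + 1 : ℕ) * u ^ (k + 1) : ℝ) : ℂ) * ((θ : ℂ) ^ 2 / 2) =
        ((u ^ (k+1) / (k+1 : ℕ) : ℝ) : ℂ) * (Complex.exp ((((k+1 : ℕ) * θ : ℝ) : ℂ) * Complex.I) - 1 -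
          (((k+1 : ℕ) * θ : ℝ) : ℂ) * Complex.I + (((k+1 : ℕ) * θ : ℝ) : ℂ) ^ 2 / 2) := by
      push_cast at hk ⊢
      field_simp
    rw [e3, norm_mul, Complex.norm_real, Real.norm_eq_abs, abs_of_nonneg (by positivity)]
    refine (mul_le_mul_of_nonneg_left (cexp_taylor_three _) (by positivity)).trans ?_
    rw [abs_mul, abs_of_nonneg (by positivity : (0:ℝ) ≤ ((k+1 : ℕ) : ℝ))]
    have hch : (((k + 2).choose 2 : ℕ) : ℝ) = (k + 2) * (k + 1) / 2 := by
      rw [Nat.cast_choose_two]; push_cast; ring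
    rw [hch]
    have hk' : ((k + 1 : ℕ) : ℝ) = (k : ℝ) + 1 := by push_cast; ring
    rw [hk']
    have hk0 : (0 : ℝ) ≤ k := Nat.cast_nonneg k
    have e4 : u ^ (k + 1) / ((k : ℝ) + 1) * (4 * (((k : ℝ) + 1) * |θ|) ^ 3) =
        (4 * |θ| ^ 3 * u * u ^ k) * (((k : ℝ) + 1) * (k + 1)) := by
      field_simp
      ring
    have e5 : 8 * |θ| ^ 3 * u * (((k : ℝ) + 2) * (k + 1) / 2 * u ^ k) =
        (4 * |θ| ^ 3 * u * u ^ k) * (((k : ℝ) + 2) * (k + 1)) := by ring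
    rw [e4, e5]
    refine mul_le_mul_of_nonneg_left ?_ (by positivity)
    nlinarith

/-- The variance sum. -/
noncomputable def Vfun (a : ℕ → ℕ) (n : ℕ) (σ : ℝ) : ℝ :=
  ∑ j ∈ Finset.Icc 1 n, (j : ℝ) ^ 2 * (a j) * Real.exp (-(j * σ)) / (1 - Real.exp (-(j * σ))) ^ 2

/-- The third moment sum. -/
noncomputable def Wfun (a : ℕ → ℕ) (n : ℕ) (σ : ℝ) : ℝ :=
  ∑ j ∈ Finset.Icc 1 n, (j : ℝ) ^ 3 * (a j) * Real.exp (-(j * σ)) / (1 - Real.exp (-(j * σ))) ^ 3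

lemma charF_log (a : ℕ → ℕ) (N : ℕ) (σ t : ℝ) (hσ : 0 < σ) :
    ∃ L : ℂ, Complex.exp L = charF a N σ t ∧
      L.re ≤ -∑ j ∈ Finset.Icc 1 N, (a j) * Real.exp (-(j * σ)) * (1 - Real.cos (j * t)) ∧
      ‖L - ((Mfun a N σ * t : ℝ) : ℂ) * Complex.I + ((Vfun a N σ * t ^ 2 / 2 : ℝ) : ℂ)‖
        ≤ 8 * Wfun a N σ * |t| ^ 3 := by
  have key : ∀ j : ℕ, ∃ L : ℂ, 1 ≤ j → (Complex.exp L = ((1 - Real.exp (-(j * σ)) : ℝ) : ℂ) /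
        (1 - (Real.exp (-(j * σ)) : ℂ) * Complex.exp ((j * t : ℝ) * Complex.I)) ∧
      L.re ≤ -(Real.exp (-(j * σ)) * (1 - Real.cos (j * t))) ∧
      ‖L - ((Real.exp (-(j * σ)) / (1 - Real.exp (-(j * σ))) * (j * t) : ℝ) : ℂ) * Complex.I +
        ((Real.exp (-(j * σ)) / (1 - Real.exp (-(j * σ))) ^ 2 * (j * t) ^ 2 / 2 : ℝ) : ℂ)‖
        ≤ 8 * (Real.exp (-(j * σ)) / (1 - Real.exp (-(j * σ))) ^ 3) * |j * t| ^ 3) := by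
    intro j
    by_cases hj : 1 ≤ j
    · obtain ⟨L, hL⟩ := factor_log (Real.exp (-(j * σ))) (j * t) (Real.exp_pos _) (exp_neg_mul_lt_one hσ hj)
      exact ⟨L, fun _ => hL⟩
    · exact ⟨0, fun h => absurd h hj⟩
  choose L hL using key
  refine ⟨∑ j ∈ Finset.Icc 1 N, (a j : ℂ) * L j, ?_, ?_, ?_⟩
  · rw [Complex.exp_sum]
    unfold charF
    refine Finset.prod_congr rfl fun j hj => ?_
    rw [Complex.exp_nat_mul, (hL j (Finset.mem_Icc.1 hj).1).1]
  · rw [Complex.re_sum, ← Finset.sum_neg_distrib]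
    refine Finset.sum_le_sum fun j hj => ?_
    have h := (hL j (Finset.mem_Icc.1 hj).1).2.1
    have e : ((a j : ℂ) * L j).re = (a j : ℝ) * (L j).re := by
      rw [← Complex.ofReal_natCast, Complex.re_ofReal_mul]
    rw [e]
    have := mul_le_mul_of_nonneg_left h (Nat.cast_nonneg (α := ℝ) (a j))
    linarith
  · have e : ∑ j ∈ Finset.Icc 1 N, (a j : ℂ) * L j - ((Mfun a N σ * t : ℝ) : ℂ) * Complex.I +
        ((Vfun a N σ * t ^ 2 / 2 : ℝ) : ℂ) = ∑ j ∈ Finset.Icc 1 N, (a j : ℂ) * (L j -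
        ((Real.exp (-(j * σ)) / (1 - Real.exp (-(j * σ))) * (j * t) : ℝ) : ℂ) * Complex.I +
        ((Real.exp (-(j * σ)) / (1 - Real.exp (-(j * σ))) ^ 2 * (j * t) ^ 2 / 2 : ℝ) : ℂ)) := by
      unfold Mfun Vfun
      rw [Finset.sum_mul, Finset.sum_mul, Finset.sum_div, Complex.ofReal_sum, Complex.ofReal_sum,
        Finset.sum_mul, ← Finset.sum_sub_distrib, ← Finset.sum_add_distrib]
      refine Finset.sum_congr rfl fun j _ => ?_
      push_cast
      ring
    rw [e]
    refine (norm_sum_le _ _).trans ?_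
    unfold Wfun
    rw [Finset.mul_sum, Finset.sum_mul]
    refine Finset.sum_le_sum fun j hj => ?_
    rw [norm_mul, Complex.norm_natCast]
    refine (mul_le_mul_of_nonneg_left (hL j (Finset.mem_Icc.1 hj).1).2.2 (Nat.cast_nonneg _)).trans ?_
    rw [abs_mul, Nat.abs_cast]
    apply le_of_eq
    ring

lemma sum_cos_telescope (t : ℝ) (p n : ℕ) :
    Real.sin (t / 2) * ∑ j ∈ Finset.Ico p (p + n), Real.cos (j * t) =
      (Real.sin (((p + n : ℕ) - 1 / 2) * t) - Real.sin ((p - 1 / 2) * t)) / 2 := by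
  induction n with
  | zero => simp
  | succ n ih =>
    rw [← add_assoc, Finset.sum_Ico_succ_top (by omega), mul_add, ih]
    have e1 : (((p + n + 1 : ℕ) : ℝ) - 1 / 2) * t = ((p + n : ℕ) : ℝ) * t + t / 2 := by push_cast; ring
    have e2 : (((p + n : ℕ) : ℝ) - 1 / 2) * t = ((p + n : ℕ) : ℝ) * t - t / 2 := by push_cast; ring
    rw [e1, e2, Real.sin_add, Real.sin_sub]
    ring

lemma cos_window_pos (l N : ℕ) (hl : 1 ≤ l) (hN : 6 * l ≤ N) (α : ℝ) (hα : 0 ≤ α) (w : ℕ → ℝ)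
    (hw : ∀ j, 0 ≤ w j) (hwα : ∀ j, l < j → j ≤ 6 * l → α ≤ w j) (t : ℝ) (ht0 : 0 ≤ t) (ht : t ≤ Real.pi) :
    (2 * l * t ≤ Real.pi → α * l ^ 3 / 5 * t ^ 2 ≤ ∑ j ∈ Finset.Icc 1 N, w j * (1 - Real.cos (j * t))) ∧
    (Real.pi ≤ 2 * l * t → 2 * α * l ≤ ∑ j ∈ Finset.Icc 1 N, w j * (1 - Real.cos (j * t))) := by
  have hpi := Real.pi_gt_three
  have hpi2 := Real.pi_lt_d2
  have hl0 : (1 : ℝ) ≤ l := by exact_mod_cast hl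
  have hnn : ∀ j : ℕ, 0 ≤ w j * (1 - Real.cos (j * t)) := fun j =>
    mul_nonneg (hw j) (by have := Real.cos_le_one (j * t); linarith)
  constructor
  · intro h
    have hsub : Finset.Ioc l (2 * l) ⊆ Finset.Icc 1 N := by
      intro j hj
      rw [Finset.mem_Ioc] at hj
      rw [Finset.mem_Icc]; omega
    refine le_trans ?_ (Finset.sum_le_sum_of_subset_of_nonneg hsub fun j _ _ => hnn j)
    have hterm : ∀ j ∈ Finset.Ioc l (2 * l), α * l ^ 2 / 5 * t ^ 2 ≤ w j * (1 - Real.cos (j * t)) := by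
      intro j hj
      rw [Finset.mem_Ioc] at hj
      have hj1 : (l : ℝ) ≤ j := by exact_mod_cast hj.1.le
      have hj2 : (j : ℝ) ≤ 2 * l := by exact_mod_cast hj.2
      have hjt : |(j : ℝ) * t| ≤ Real.pi := by
        rw [abs_of_nonneg (by positivity)]
        exact (mul_le_mul_of_nonneg_right hj2 ht0).trans h
      have hc := Real.cos_le_one_sub_mul_cos_sq hjt
      have h5 : (1 : ℝ) / 5 ≤ 2 / Real.pi ^ 2 := by
        rw [div_le_div_iff₀ (by norm_num) (by positivity)]
        nlinarith
      have h6 : (l * t) ^ 2 ≤ (j * t) ^ 2 := by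
        apply pow_le_pow_left₀ (by positivity)
        exact mul_le_mul_of_nonneg_right hj1 ht0
      have h7 : 1 / 5 * (l * t) ^ 2 ≤ 1 - Real.cos (j * t) := by
        have : 1 / 5 * (l * t) ^ 2 ≤ 2 / Real.pi ^ 2 * (j * t) ^ 2 := by gcongr
        linarith
      calc α * l ^ 2 / 5 * t ^ 2 = α * (1 / 5 * (l * t) ^ 2) := by ring
        _ ≤ w j * (1 - Real.cos (j * t)) :=
          mul_le_mul (hwα j hj.1 (by omega)) h7 (by positivity) (hw j)
    have := Finset.card_nsmul_le_sum _ _ _ hterm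
    rw [Nat.card_Ioc, nsmul_eq_mul] at this
    have e : ((2 * l - l : ℕ) : ℝ) = l := by congr 1; omega
    rw [e] at this
    calc α * l ^ 3 / 5 * t ^ 2 = l * (α * l ^ 2 / 5 * t ^ 2) := by ring
      _ ≤ _ := this
  · intro h
    have hsub : Finset.Ico (2 * l + 1) (2 * l + 1 + 4 * l) ⊆ Finset.Icc 1 N := by
      intro j hj
      rw [Finset.mem_Ico] at hj
      rw [Finset.mem_Icc]; omega
    refine le_trans ?_ (Finset.sum_le_sum_of_subset_of_nonneg hsub fun j _ _ => hnn j)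
    have h1 : ∑ j ∈ Finset.Ico (2 * l + 1) (2 * l + 1 + 4 * l), α * (1 - Real.cos (j * t)) ≤
        ∑ j ∈ Finset.Ico (2 * l + 1) (2 * l + 1 + 4 * l), w j * (1 - Real.cos (j * t)) := by
      refine Finset.sum_le_sum fun j hj => ?_
      rw [Finset.mem_Ico] at hj
      exact mul_le_mul_of_nonneg_right (hwα j (by omega) (by omega))
        (by have := Real.cos_le_one (j * t); linarith)
    refine le_trans ?_ h1
    rw [← Finset.mul_sum, Finset.sum_sub_distrib]
    simp only [Finset.sum_const, Nat.card_Ico, nsmul_eq_mul, mul_one]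
    have e : ((2 * l + 1 + 4 * l - (2 * l + 1) : ℕ) : ℝ) = 4 * l := by
      rw [Nat.add_sub_cancel_left]; push_cast; ring
    rw [e]
    have htel := sum_cos_telescope t (2 * l + 1) (4 * l)
    set S := ∑ j ∈ Finset.Ico (2 * l + 1) (2 * l + 1 + 4 * l), Real.cos (j * t)
    have hS : Real.sin (t / 2) * S ≤ 1 := by
      rw [htel]
      have h2 := Real.sin_le_one (((2 * l + 1 + 4 * l : ℕ) - 1 / 2) * t)
      have h3 := Real.neg_one_le_sin (((2 * l + 1 : ℕ) - 1 / 2) * t)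
      linarith
    have hs : 1 / (2 * l) ≤ Real.sin (t / 2) := by
      have h4 := Real.mul_le_sin (x := t / 2) (by linarith) (by linarith)
      refine le_trans ?_ h4
      rw [div_mul_div_comm, div_le_div_iff₀ (by positivity) (by positivity)]
      nlinarith
    have hS2 : S ≤ 2 * l := by
      by_contra hcon
      push Not at hcon
      have : 1 / (2 * (l : ℝ)) * S ≤ 1 := (mul_le_mul_of_nonneg_right hs (by linarith)).trans hS
      rw [div_mul_eq_mul_div, one_mul, div_le_one (by positivity)] at this
      linarith
    nlinarith

lemma cos_window (l N : ℕ) (hl : 1 ≤ l) (hN : 6 * l ≤ N) (α : ℝ) (hα : 0 ≤ α) (w : ℕ → ℝ)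
    (hw : ∀ j, 0 ≤ w j) (hwα : ∀ j, l < j → j ≤ 6 * l → α ≤ w j) (t : ℝ) (ht : |t| ≤ Real.pi) :
    (2 * l * |t| ≤ Real.pi → α * l ^ 3 / 5 * t ^ 2 ≤ ∑ j ∈ Finset.Icc 1 N, w j * (1 - Real.cos (j * t))) ∧
    (Real.pi ≤ 2 * l * |t| → 2 * α * l ≤ ∑ j ∈ Finset.Icc 1 N, w j * (1 - Real.cos (j * t))) := by
  have := cos_window_pos l N hl hN α hα w hw hwα |t| (abs_nonneg t) ht
  have e : ∀ j : ℕ, Real.cos (j * |t|) = Real.cos (j * t) := by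
    intro j
    rw [← Real.cos_abs (j * t), abs_mul, Nat.abs_cast]
  simpa only [e, sq_abs] using this

lemma integral_abs_exp_le (A : ℝ) (hA : 0 < A) :
    ∫ t in (-Real.pi)..Real.pi, |t| * Real.exp (-(A * t ^ 2)) ≤ 1 / A := by
  have hc : Continuous fun t : ℝ => |t| * Real.exp (-(A * t ^ 2)) := by fun_prop
  have hpos : ∫ t in (0 : ℝ)..Real.pi, |t| * Real.exp (-(A * t ^ 2)) ≤ 1 / (2 * A) := by
    have e : ∫ t in (0 : ℝ)..Real.pi, |t| * Real.exp (-(A * t ^ 2)) =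
        ∫ t in (0 : ℝ)..Real.pi, t * Real.exp (-(A * t ^ 2)) := by
      refine intervalIntegral.integral_congr fun t ht => ?_
      rw [Set.uIcc_of_le Real.pi_pos.le] at ht
      simp only [abs_of_nonneg ht.1]
    have hd : ∀ t : ℝ, HasDerivAt (fun t : ℝ => -(Real.exp (-(A * t ^ 2))) / (2 * A))
        (t * Real.exp (-(A * t ^ 2))) t := by
      intro t
      have h1 : HasDerivAt (fun t : ℝ => -(A * t ^ 2)) (-(A * (2 * t))) t := by
        have h := (((hasDerivAt_id t).fun_pow 2).const_mul A).fun_neg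
        simpa using h
      have h2 := h1.exp.fun_neg.div_const (2 * A)
      have e3 : -(Real.exp (-(A * t ^ 2)) * -(A * (2 * t))) / (2 * A) = t * Real.exp (-(A * t ^ 2)) := by
        field_simp
      rwa [e3] at h2
    rw [e, intervalIntegral.integral_eq_sub_of_hasDerivAt (fun t _ => hd t)
      (Continuous.intervalIntegrable (by fun_prop) _ _)]
    have := Real.exp_pos (-(A * Real.pi ^ 2))
    have h2 : 0 < Real.exp (-(A * Real.pi ^ 2)) / (2 * A) := by positivity
    simp only [ne_eq, OfNat.ofNat_ne_zero, not_false_eq_true, zero_pow, mul_zero, neg_zero, Real.exp_zero]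
    rw [neg_div, neg_div]
    linarith
  have hneg : ∫ t in (-Real.pi)..0, |t| * Real.exp (-(A * t ^ 2)) =
      ∫ t in (0 : ℝ)..Real.pi, |t| * Real.exp (-(A * t ^ 2)) := by
    have := intervalIntegral.integral_comp_neg (a := (0:ℝ)) (b := Real.pi)
      (fun t : ℝ => |t| * Real.exp (-(A * t ^ 2)))
    simpa using this.symm
  rw [← intervalIntegral.integral_add_adjacent_intervals (b := 0)
    (hc.intervalIntegrable _ _) (hc.intervalIntegrable _ _), hneg]
  have : 1 / A = 1 / (2 * A) + 1 / (2 * A) := by field_simp; norm_num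
  linarith

lemma integral_abs_cube_exp_le (A : ℝ) (hA : 0 < A) :
    ∫ t in (-Real.pi)..Real.pi, |t| ^ 3 * Real.exp (-(A * t ^ 2)) ≤ 4 / A ^ 2 := by
  have hpi := Real.pi_pos
  have h1 : ∀ t : ℝ, |t| ^ 3 * Real.exp (-(A * t ^ 2)) ≤
      (2 / A) * (|t| * Real.exp (-(A / 2 * t ^ 2))) := by
    intro t
    have hx : A / 2 * t ^ 2 * Real.exp (-(A / 2 * t ^ 2)) ≤ 1 := by
      have := Real.add_one_le_exp (A / 2 * t ^ 2)
      rw [Real.exp_neg, ← div_eq_mul_inv, div_le_one (Real.exp_pos _)]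
      linarith
    have e : Real.exp (-(A * t ^ 2)) = Real.exp (-(A / 2 * t ^ 2)) * Real.exp (-(A / 2 * t ^ 2)) := by
      rw [← Real.exp_add]; congr 1; ring
    have e2 : |t| ^ 3 = |t| * t ^ 2 := by rw [pow_succ', sq_abs]
    rw [e, e2]
    have h0 : 0 ≤ (2 / A) * (|t| * Real.exp (-(A / 2 * t ^ 2))) := by positivity
    calc |t| * t ^ 2 * (Real.exp (-(A / 2 * t ^ 2)) * Real.exp (-(A / 2 * t ^ 2)))
        = ((2 / A) * (|t| * Real.exp (-(A / 2 * t ^ 2)))) * (A / 2 * t ^ 2 * Real.exp (-(A / 2 * t ^ 2))) := by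
          field_simp
      _ ≤ ((2 / A) * (|t| * Real.exp (-(A / 2 * t ^ 2)))) * 1 := mul_le_mul_of_nonneg_left hx h0
      _ = _ := mul_one _
  have h2 := intervalIntegral.integral_mono (a := -Real.pi) (b := Real.pi) (by linarith)
    (μ := MeasureTheory.volume)
    (Continuous.intervalIntegrable (by fun_prop) _ _)
    (Continuous.intervalIntegrable (by fun_prop) _ _) (fun t => h1 t)
  refine h2.trans ?_
  rw [intervalIntegral.integral_const_mul]
  have h3 := integral_abs_exp_le (A / 2) (by positivity)
  calc 2 / A * ∫ t in (-Real.pi)..Real.pi, |t| * Real.exp (-(A / 2 * t ^ 2))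
      ≤ 2 / A * (1 / (A / 2)) := mul_le_mul_of_nonneg_left h3 (by positivity)
    _ = 4 / A ^ 2 := by field_simp; norm_num

lemma integral_gauss_ge (V : ℝ) (hV : 1 ≤ V) :
    1 / Real.sqrt V ≤ ∫ t in (-Real.pi)..Real.pi, Real.exp (-(V * t ^ 2 / 2)) := by
  have hpi := Real.pi_gt_three
  have hs : 1 ≤ Real.sqrt V := by rw [Real.one_le_sqrt]; exact hV
  set s := 1 / Real.sqrt V with hsdef
  have hs0 : 0 < s := by positivity
  have hs1 : s ≤ 1 := by rw [hsdef, div_le_one (by positivity)]; exact hs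
  have hsV : V * s ^ 2 = 1 := by
    rw [hsdef, div_pow, one_pow, Real.sq_sqrt (by linarith)]; field_simp
  have hc : Continuous fun t : ℝ => Real.exp (-(V * t ^ 2 / 2)) := by fun_prop
  have h1 : ∫ t in (-s)..s, (1/2 : ℝ) ≤ ∫ t in (-s)..s, Real.exp (-(V * t ^ 2 / 2)) := by
    refine intervalIntegral.integral_mono_on (by linarith) (by simp) (hc.intervalIntegrable _ _) ?_
    intro t ht
    have : t ^ 2 ≤ s ^ 2 := sq_le_sq' ht.1 ht.2
    have h2 : V * t ^ 2 ≤ 1 := by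
      rw [← hsV]; exact mul_le_mul_of_nonneg_left this (by linarith)
    have := Real.add_one_le_exp (-(V * t ^ 2 / 2))
    linarith
  rw [intervalIntegral.integral_const] at h1
  have h3 : ∫ t in (-s)..s, Real.exp (-(V * t ^ 2 / 2)) ≤ ∫ t in (-Real.pi)..Real.pi, Real.exp (-(V * t ^ 2 / 2)) :=
    intervalIntegral.integral_mono_interval (by linarith) (by linarith) (by linarith)
      (Filter.Eventually.of_forall fun t => (Real.exp_pos _).le) (hc.intervalIntegrable _ _)
  simp only [smul_eq_mul] at h1
  linarith

lemma norm_cexp_neg_sub_one_le (t : ℝ) : ‖Complex.exp (-(t : ℂ) * Complex.I) - 1‖ ≤ |t| := by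
  have := Real.norm_exp_I_mul_ofReal_sub_one_le (x := -t)
  rw [Real.norm_eq_abs, abs_neg] at this
  convert this using 4
  push_cast; ring

lemma core_diff (f : ℝ → ℂ) (hf : Continuous f) (n : ℕ) (P0 P1 A ε : ℝ) (hA : 0 < A) (hε : 0 ≤ ε)
    (h0 : ∫ t in (-Real.pi)..Real.pi, f t * Complex.exp (-((n : ℂ) * t) * Complex.I) = ((2 * Real.pi * P0 : ℝ) : ℂ))
    (h1 : ∫ t in (-Real.pi)..Real.pi, f t * Complex.exp (-(((n + 1 : ℕ) : ℂ) * t) * Complex.I) =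
      ((2 * Real.pi * P1 : ℝ) : ℂ))
    (hb : ∀ t : ℝ, |t| ≤ Real.pi → ‖f t‖ ≤ Real.exp (-(A * t ^ 2)) + ε) :
    2 * Real.pi * |P1 - P0| ≤ 1 / A + 2 * Real.pi ^ 2 * ε := by
  have hpi := Real.pi_pos
  have e : ((2 * Real.pi * (P1 - P0) : ℝ) : ℂ) = ∫ t in (-Real.pi)..Real.pi,
      f t * Complex.exp (-((n : ℂ) * t) * Complex.I) * (Complex.exp (-(t : ℂ) * Complex.I) - 1) := by
    rw [mul_sub, Complex.ofReal_sub, ← h0, ← h1, ← intervalIntegral.integral_sub]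
    · refine intervalIntegral.integral_congr fun t _ => ?_
      have : Complex.exp (-(((n + 1 : ℕ) : ℂ) * t) * Complex.I) =
          Complex.exp (-((n : ℂ) * t) * Complex.I) * Complex.exp (-(t : ℂ) * Complex.I) := by
        rw [← Complex.exp_add]; congr 1; push_cast; ring
      simp only [this]
      ring
    · exact Continuous.intervalIntegrable (by fun_prop) _ _
    · exact Continuous.intervalIntegrable (by fun_prop) _ _
  have hn : ‖((2 * Real.pi * (P1 - P0) : ℝ) : ℂ)‖ = 2 * Real.pi * |P1 - P0| := by
    rw [Complex.norm_real, Real.norm_eq_abs, abs_mul, abs_of_pos (by positivity)]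
  rw [← hn, e]
  have hle : ‖∫ t in (-Real.pi)..Real.pi,
      f t * Complex.exp (-((n : ℂ) * t) * Complex.I) * (Complex.exp (-(t : ℂ) * Complex.I) - 1)‖ ≤
      ∫ t in (-Real.pi)..Real.pi, (|t| * Real.exp (-(A * t ^ 2)) + Real.pi * ε) := by
    refine intervalIntegral.norm_integral_le_of_norm_le (by linarith) ?_
      (Continuous.intervalIntegrable (by fun_prop) _ _)
    refine Filter.Eventually.of_forall fun t ht => ?_
    have ht' : |t| ≤ Real.pi := abs_le.2 ⟨ht.1.le, ht.2⟩
    have hn1 : ‖Complex.exp (-((n : ℂ) * t) * Complex.I)‖ = 1 := by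
      rw [Complex.norm_exp]; simp
    rw [norm_mul, norm_mul, hn1, mul_one]
    have hx := mul_le_mul (hb t ht') (norm_cexp_neg_sub_one_le t) (norm_nonneg _)
      (by positivity)
    refine hx.trans ?_
    have := mul_le_mul_of_nonneg_right ht' hε
    nlinarith
  refine hle.trans ?_
  rw [intervalIntegral.integral_add (Continuous.intervalIntegrable (by fun_prop) _ _) (by simp),
    intervalIntegral.integral_const]
  have := integral_abs_exp_le A hA
  simp only [smul_eq_mul]
  nlinarith

lemma core_lower (f : ℝ → ℂ) (hf : Continuous f) (n : ℕ) (P0 A ε V ρ d : ℝ) (hA : 0 < A)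
    (hρ : 0 ≤ ρ) (hd : 0 ≤ d) (hV : 1 ≤ V)
    (h0 : ∫ t in (-Real.pi)..Real.pi, f t * Complex.exp (-((n : ℂ) * t) * Complex.I) = ((2 * Real.pi * P0 : ℝ) : ℂ))
    (hg : ∀ t : ℝ, |t| ≤ Real.pi → ‖f t * Complex.exp (-((n : ℂ) * t) * Complex.I) -
      (Real.exp (-(V * t ^ 2 / 2)) : ℂ)‖ ≤ (ρ * |t| ^ 3 + d * |t|) * Real.exp (-(A * t ^ 2)) + 2 * ε) :
    1 / Real.sqrt V - 4 * ρ / A ^ 2 - d / A - 4 * Real.pi * ε ≤ 2 * Real.pi * P0 := by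
  have hpi := Real.pi_pos
  have hle : ‖∫ t in (-Real.pi)..Real.pi, (f t * Complex.exp (-((n : ℂ) * t) * Complex.I) -
      (Real.exp (-(V * t ^ 2 / 2)) : ℂ))‖ ≤
      ∫ t in (-Real.pi)..Real.pi, (ρ * (|t| ^ 3 * Real.exp (-(A * t ^ 2))) +
        d * (|t| * Real.exp (-(A * t ^ 2))) + 2 * ε) := by
    refine intervalIntegral.norm_integral_le_of_norm_le (by linarith) ?_
      (Continuous.intervalIntegrable (by fun_prop) _ _)
    refine Filter.Eventually.of_forall fun t ht => ?_
    have ht' : |t| ≤ Real.pi := abs_le.2 ⟨ht.1.le, ht.2⟩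
    refine (hg t ht').trans (le_of_eq ?_)
    ring
  rw [intervalIntegral.integral_sub (Continuous.intervalIntegrable (by fun_prop) _ _)
    (Continuous.intervalIntegrable (by fun_prop) _ _), h0, intervalIntegral.integral_ofReal,
    ← Complex.ofReal_sub, Complex.norm_real, Real.norm_eq_abs,
    intervalIntegral.integral_add (Continuous.intervalIntegrable (by fun_prop) _ _) (by simp),
    intervalIntegral.integral_add (Continuous.intervalIntegrable (by fun_prop) _ _)
      (Continuous.intervalIntegrable (by fun_prop) _ _),
    intervalIntegral.integral_const, intervalIntegral.integral_const_mul,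
    intervalIntegral.integral_const_mul] at hle
  have i1 := mul_le_mul_of_nonneg_left (integral_abs_exp_le A hA) hd
  have i3 := mul_le_mul_of_nonneg_left (integral_abs_cube_exp_le A hA) hρ
  have i2 := integral_gauss_ge V hV
  have h5 := (abs_le.1 hle).1
  simp only [smul_eq_mul] at h5
  have e1 : d * (1 / A) = d / A := by ring
  have e2 : ρ * (4 / A ^ 2) = 4 * ρ / A ^ 2 := by ring
  rw [e1] at i1
  rw [e2] at i3
  nlinarith

lemma norm_cexp_sub_le (a b : ℂ) (M : ℝ) (ha : a.re ≤ M) (hb : b.re ≤ M) :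
    ‖Complex.exp a - Complex.exp b‖ ≤ Real.exp M * ‖a - b‖ := by
  have hconv : Convex ℝ {z : ℂ | z.re ≤ M} := convex_halfSpace_re_le M
  refine hconv.norm_image_sub_le_of_norm_hasDerivWithin_le (f := Complex.exp) (f' := Complex.exp)
    (fun z _ => (Complex.hasDerivAt_exp z).hasDerivWithinAt) (fun z hz => ?_) hb ha
  rw [Complex.norm_exp]
  exact Real.exp_le_exp.2 hz

lemma Vfun_ge (a : ℕ → ℕ) (N l : ℕ) (hl : 1 ≤ l) (σ α : ℝ) (hσ : 0 < σ) (hα : 0 < α) (hN : 6 * l ≤ N)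
    (hw : ∀ j, l < j → j ≤ 6 * l → α ≤ (a j) * Real.exp (-(j * σ))) :
    α * l ^ 3 ≤ Vfun a N σ := by
  unfold Vfun
  have hsub : Finset.Ioc l (2 * l) ⊆ Finset.Icc 1 N := by
    intro j hj
    rw [Finset.mem_Ioc] at hj
    rw [Finset.mem_Icc]; omega
  refine le_trans ?_ (Finset.sum_le_sum_of_subset_of_nonneg hsub fun j _ _ => by positivity)
  have hterm : ∀ j ∈ Finset.Ioc l (2 * l), α * l ^ 2 ≤
      (j : ℝ) ^ 2 * (a j) * Real.exp (-(j * σ)) / (1 - Real.exp (-(j * σ))) ^ 2 := by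
    intro j hj
    rw [Finset.mem_Ioc] at hj
    have hj1 : (l : ℝ) ≤ j := by exact_mod_cast hj.1.le
    have h1 := exp_neg_mul_lt_one hσ (j := j) (by omega)
    have h2 := Real.exp_pos (-(j * σ))
    have h3 : (1 - Real.exp (-(j * σ))) ^ 2 ≤ 1 := pow_le_one₀ (by linarith) (by linarith)
    have h4 : 0 < (1 - Real.exp (-(j * σ))) ^ 2 := by
      have : 0 < 1 - Real.exp (-(j * σ)) := by linarith
      positivity
    have h5 : α * l ^ 2 ≤ (j : ℝ) ^ 2 * (a j) * Real.exp (-(j * σ)) := by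
      have := mul_le_mul (hw j hj.1 (by omega)) (pow_le_pow_left₀ (by positivity) hj1 2) (by positivity)
        (by positivity)
      linarith
    refine h5.trans ?_
    rw [le_div_iff₀ h4]
    have : 0 ≤ (j : ℝ) ^ 2 * (a j) * Real.exp (-(j * σ)) := by positivity
    nlinarith
  have := Finset.card_nsmul_le_sum _ _ _ hterm
  rw [Nat.card_Ioc, nsmul_eq_mul] at this
  have e : ((2 * l - l : ℕ) : ℝ) = l := by congr 1; omega
  rw [e] at this
  linarith

lemma pointwise_bounds (a : ℕ → ℕ) (N l n : ℕ) (hl : 1 ≤ l) (σ α d : ℝ) (hσ : 0 < σ) (hα : 0 < α)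
    (hN : 6 * l ≤ N) (hw : ∀ j, l < j → j ≤ 6 * l → α ≤ (a j) * Real.exp (-(j * σ)))
    (hd : |Mfun a N σ - n| ≤ d) (t : ℝ) (ht : |t| ≤ Real.pi) :
    ‖charF a N σ t‖ ≤ Real.exp (-(α * l ^ 3 / 5 * t ^ 2)) + Real.exp (-(α * l / 4)) ∧
    ‖charF a N σ t * Complex.exp (-((n : ℂ) * t) * Complex.I) - (Real.exp (-(Vfun a N σ * t ^ 2 / 2)) : ℂ)‖
      ≤ (8 * Wfun a N σ * |t| ^ 3 + d * |t|) * Real.exp (-(α * l ^ 3 / 5 * t ^ 2)) +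
        2 * Real.exp (-(α * l / 4)) := by
  have hpi := Real.pi_gt_three
  obtain ⟨L, hL1, hL2, hL3⟩ := charF_log a N σ t hσ
  have hV := Vfun_ge a N l hl σ α hσ hα hN hw
  obtain ⟨hc1, hc2⟩ := cos_window l N hl hN α hα.le (fun j => (a j) * Real.exp (-(j * σ)))
    (fun j => by positivity) hw t ht
  have hl0 : (1 : ℝ) ≤ l := by exact_mod_cast hl
  have hn : ‖charF a N σ t‖ = Real.exp L.re := by rw [← hL1, Complex.norm_exp]
  have hE : Real.exp (-(Vfun a N σ * t ^ 2 / 2)) ≤ Real.exp (-(α * l ^ 3 / 5 * t ^ 2)) := by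
    rw [Real.exp_le_exp]
    have h1 := mul_le_mul_of_nonneg_right hV (sq_nonneg t)
    have h2 : 0 ≤ α * l ^ 3 * t ^ 2 := by positivity
    linarith
  have hε := Real.exp_pos (-(α * l / 4))
  have hAp := Real.exp_pos (-(α * l ^ 3 / 5 * t ^ 2))
  have hW : 0 ≤ Wfun a N σ := by
    unfold Wfun
    refine Finset.sum_nonneg fun j hj => ?_
    have h1 := exp_neg_mul_lt_one hσ (j := j) (Finset.mem_Icc.1 hj).1
    have : 0 < 1 - Real.exp (-(j * σ)) := by linarith
    positivity
  have hd0 : 0 ≤ d := (abs_nonneg _).trans hd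
  rcases le_total (2 * l * |t|) Real.pi with h | h
  · have hre : L.re ≤ -(α * l ^ 3 / 5 * t ^ 2) := by
      have := hc1 h
      linarith
    constructor
    · rw [hn]
      have := Real.exp_le_exp.2 hre
      linarith
    · rw [← hL1, ← Complex.exp_add, Complex.ofReal_exp]
      have hb := norm_cexp_sub_le (L + -((n : ℂ) * t) * Complex.I) ((-(Vfun a N σ * t ^ 2 / 2) : ℝ) : ℂ)
        (-(α * l ^ 3 / 5 * t ^ 2)) (by
          have : (L + -((n : ℂ) * t) * Complex.I).re = L.re := by simp
          rw [this]; exact hre) (by rw [Complex.ofReal_re]; exact Real.exp_le_exp.1 hE)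
      have hab : ‖(L + -((n : ℂ) * t) * Complex.I) - ((-(Vfun a N σ * t ^ 2 / 2) : ℝ) : ℂ)‖ ≤
          8 * Wfun a N σ * |t| ^ 3 + d * |t| := by
        have e : (L + -((n : ℂ) * t) * Complex.I) - ((-(Vfun a N σ * t ^ 2 / 2) : ℝ) : ℂ) =
            (L - ((Mfun a N σ * t : ℝ) : ℂ) * Complex.I + ((Vfun a N σ * t ^ 2 / 2 : ℝ) : ℂ)) +
            (((Mfun a N σ - n) * t : ℝ) : ℂ) * Complex.I := by
          push_cast; ring
        rw [e]
        refine (norm_add_le _ _).trans (add_le_add hL3 ?_)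
        rw [norm_mul, Complex.norm_I, mul_one, Complex.norm_real, Real.norm_eq_abs, abs_mul]
        exact mul_le_mul_of_nonneg_right hd (abs_nonneg t)
      have := mul_le_mul_of_nonneg_left hab hAp.le
      linarith
  · have hre : L.re ≤ -(α * l / 4) := by
      have := hc2 h
      have h2 : 0 < α * l := by positivity
      linarith
    have h1 : Real.exp L.re ≤ Real.exp (-(α * l / 4)) := Real.exp_le_exp.2 hre
    have h2 : Real.exp (-(α * l ^ 3 / 5 * t ^ 2)) ≤ Real.exp (-(α * l / 4)) := by
      rw [Real.exp_le_exp]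
      have h3 : 9 ≤ 4 * l ^ 2 * t ^ 2 := by
        have : 3 ≤ 2 * l * |t| := by linarith
        have := pow_le_pow_left₀ (by norm_num) this 2
        rw [mul_pow, mul_pow, sq_abs] at this
        linarith
      have h4 : 0 < α * l := by positivity
      have := mul_le_mul_of_nonneg_left h3 h4.le
      nlinarith
    constructor
    · rw [hn]; linarith
    · refine (norm_sub_le _ _).trans ?_
      have hn1 : ‖Complex.exp (-((n : ℂ) * t) * Complex.I)‖ = 1 := by
        rw [Complex.norm_exp]; simp
      rw [norm_mul, hn1, mul_one, hn, Complex.norm_real, Real.norm_eq_abs, abs_of_pos (Real.exp_pos _)]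
      have : 0 ≤ (8 * Wfun a N σ * |t| ^ 3 + d * |t|) * Real.exp (-(α * l ^ 3 / 5 * t ^ 2)) := by
        positivity
      linarith

/-- Summary of the local estimates at a fixed `n`. -/
lemma fixed_n (a : ℕ → ℕ) (l n : ℕ) (hl : 1 ≤ l) (σ α d : ℝ) (hσ : 0 < σ) (hα : 0 < α)
    (hN : 6 * l ≤ n + 1) (hw : ∀ j, l < j → j ≤ 6 * l → α ≤ (a j) * Real.exp (-(j * σ)))
    (hd : |Mfun a (n + 1) σ - n| ≤ d) (hV : 1 ≤ Vfun a (n + 1) σ) :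
    2 * Real.pi * |probP a (n + 1) σ (n + 1) - probP a (n + 1) σ n| ≤
      1 / (α * l ^ 3 / 5) + 2 * Real.pi ^ 2 * Real.exp (-(α * l / 4)) ∧
    1 / Real.sqrt (Vfun a (n + 1) σ) - 4 * (8 * Wfun a (n + 1) σ) / (α * l ^ 3 / 5) ^ 2 -
      d / (α * l ^ 3 / 5) - 4 * Real.pi * Real.exp (-(α * l / 4)) ≤ 2 * Real.pi * probP a (n + 1) σ n := by
  have hl0 : (0 : ℝ) < l := by exact_mod_cast hl
  have hb := pointwise_bounds a (n + 1) l n hl σ α d hσ hα hN hw hd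
  have hW : 0 ≤ Wfun a (n + 1) σ := by
    unfold Wfun
    refine Finset.sum_nonneg fun j hj => ?_
    have h1 := exp_neg_mul_lt_one hσ (j := j) (Finset.mem_Icc.1 hj).1
    have : 0 < 1 - Real.exp (-(j * σ)) := by linarith
    positivity
  have hcont := charF_continuous a (n + 1) σ hσ
  have h0 := integral_charF a (n + 1) n (by omega) σ hσ
  have h1 := integral_charF a (n + 1) (n + 1) le_rfl σ hσ
  exact ⟨core_diff _ hcont n _ _ _ _ (by positivity) (Real.exp_pos _).le h0 h1 fun t ht => (hb t ht).1,
    core_lower _ hcont n _ _ _ _ _ _ (by positivity) (by positivity) ((abs_nonneg _).trans hd) hV h0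
      fun t ht => (hb t ht).2⟩

lemma exists_rpow_le_exp_half (s : ℝ) : ∃ K : ℝ, 0 < K ∧ ∀ x : ℝ, 1 ≤ x → x ^ s ≤ K * Real.exp (x / 2) := by
  obtain ⟨k, hk⟩ := exists_nat_ge s
  refine ⟨2 ^ k * (k.factorial : ℝ), by positivity, fun x hx => ?_⟩
  have h1 : x ^ s ≤ x ^ k := by
    rw [← Real.rpow_natCast]
    exact Real.rpow_le_rpow_of_exponent_le hx hk
  have h2 := Real.pow_div_factorial_le_exp (x / 2) (by linarith) k
  have h3 : (0 : ℝ) < k.factorial := by positivity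
  rw [div_le_iff₀ h3, div_pow, div_le_iff₀ (by positivity)] at h2
  linarith

lemma sum_rpow_le (r : ℝ) (hr : 0 < r) (m : ℕ) :
    ∑ j ∈ Finset.Icc 1 m, (j : ℝ) ^ (r - 1) ≤ (1 / r + 1) * (m : ℝ) ^ r := by
  have hr1 : 0 < 1 / r := by positivity
  rcases le_total 1 r with h | h
  · have : ∀ j ∈ Finset.Icc 1 m, (j : ℝ) ^ (r - 1) ≤ (m : ℝ) ^ (r - 1) := by
      intro j hj
      rw [Finset.mem_Icc] at hj
      exact Real.rpow_le_rpow (by positivity) (by exact_mod_cast hj.2) (by linarith)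
    have h2 := Finset.sum_le_card_nsmul _ _ _ this
    rw [Nat.card_Icc, nsmul_eq_mul, Nat.add_sub_cancel] at h2
    rcases Nat.eq_zero_or_pos m with h0 | h0
    · subst h0; simp; positivity
    · have hm : (0 : ℝ) < m := by exact_mod_cast h0
      have e : (m : ℝ) * (m : ℝ) ^ (r - 1) = (m : ℝ) ^ r := by
        rw [Real.rpow_sub_one hm.ne']; field_simp
      rw [e] at h2
      have : 0 ≤ (m : ℝ) ^ r := by positivity
      nlinarith
  · have key : ∑ j ∈ Finset.Icc 1 m, (j : ℝ) ^ (r - 1) ≤ 1 / r * (m : ℝ) ^ r := by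
      induction m with
      | zero => simp; positivity
      | succ m ih =>
        rw [Finset.sum_Icc_succ_top (by omega)]
        have hm : (0 : ℝ) < ((m + 1 : ℕ) : ℝ) := by positivity
        set x : ℝ := ((m + 1 : ℕ) : ℝ) with hx
        have hmx : (m : ℝ) = x * (1 + (-(1 / x))) := by
          rw [hx]; push_cast; field_simp; ring
        have hx1 : 1 ≤ x := by rw [hx]; exact_mod_cast Nat.succ_pos m
        have hinv : 1 / x ≤ 1 := by rw [div_le_one hm]; exact hx1
        have hb := rpow_one_add_le_one_add_mul_self (s := -(1 / x)) (by linarith) hr.le h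
        have : (m : ℝ) ^ r ≤ x ^ r * (1 + r * (-(1 / x))) := by
          rw [hmx, Real.mul_rpow hm.le (by linarith)]
          exact mul_le_mul_of_nonneg_left hb (by positivity)
        have e : x ^ (r - 1) = x ^ r / x := Real.rpow_sub_one hm.ne' r
        rw [e]
        have h3 := mul_le_mul_of_nonneg_left this hr1.le
        have e2 : 1 / r * (x ^ r * (1 + r * (-(1 / x)))) = 1 / r * x ^ r - x ^ r / x := by
          field_simp
          ring
        linarith
    have : 0 ≤ (m : ℝ) ^ r := by positivity
    linarith

lemma sum_exp_le (δ : ℝ) (hδ : 0 < δ) (N : ℕ) :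
    ∑ j ∈ Finset.Icc 1 N, Real.exp (-(j * δ)) ≤ 1 / δ := by
  have hq0 := Real.exp_pos (-δ)
  have hq1 : Real.exp (-δ) < 1 := by rw [Real.exp_lt_one_iff]; linarith
  have key : ∑ j ∈ Finset.Icc 1 N, Real.exp (-(j * δ)) ≤ (1 - Real.exp (-(N * δ))) / δ := by
    induction N with
    | zero => simp
    | succ m ih =>
      rw [Finset.sum_Icc_succ_top (by omega)]
      refine (add_le_add_left ih _).trans ?_
      rw [← le_sub_iff_add_le', ← sub_div, le_div_iff₀ hδ]
      have e : Real.exp (-(m * δ)) = Real.exp (-((m + 1 : ℕ) * δ)) * Real.exp δ := by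
        rw [← Real.exp_add]; congr 1; push_cast; ring
      rw [e]
      have := Real.add_one_le_exp δ
      have := Real.exp_pos (-((m + 1 : ℕ) * δ))
      nlinarith
  refine key.trans ?_
  have := Real.exp_pos (-(N * δ))
  gcongr
  linarith

lemma sum_rpow_exp_le (r : ℝ) (hr : 0 < r) : ∃ C : ℝ, 0 < C ∧ ∀ (δ : ℝ), 0 < δ → ∀ N : ℕ,
    ∑ j ∈ Finset.Icc 1 N, (j : ℝ) ^ (r - 1) * Real.exp (-(j * δ)) ≤ C * δ ^ (-r) := by
  obtain ⟨K, hK, hKx⟩ := exists_rpow_le_exp_half (r - 1)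
  refine ⟨(1 / r + 1) + 2 * K, by positivity, fun δ hδ N => ?_⟩
  set m := ⌊1 / δ⌋₊ with hm
  have hterm : ∀ j ∈ Finset.Icc 1 N, (j : ℝ) ^ (r - 1) * Real.exp (-(j * δ)) ≤
      (if j ≤ m then (j : ℝ) ^ (r - 1) else 0) + K * δ ^ (1 - r) * Real.exp (-(j * (δ / 2))) := by
    intro j hj
    have hj1 : (0 : ℝ) < j := by exact_mod_cast (Finset.mem_Icc.1 hj).1
    split_ifs with h
    · have h1 : Real.exp (-(j * δ)) ≤ 1 := by
        rw [Real.exp_le_one_iff]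
        have := mul_pos hj1 hδ
        linarith
      have h2 : 0 ≤ (j : ℝ) ^ (r - 1) := by positivity
      have h3 : 0 ≤ K * δ ^ (1 - r) * Real.exp (-(j * (δ / 2))) := by positivity
      nlinarith
    · push Not at h
      have h1 : 1 / δ < j := (Nat.floor_lt (by positivity)).1 h
      have h2 : 1 ≤ j * δ := by
        rw [div_lt_iff₀ hδ] at h1
        exact h1.le
      have h3 := hKx _ h2
      have e1 : (j : ℝ) ^ (r - 1) = δ ^ (1 - r) * (j * δ) ^ (r - 1) := by
        rw [Real.mul_rpow hj1.le hδ.le, mul_comm ((j : ℝ) ^ (r - 1)), ← mul_assoc, ← Real.rpow_add hδ]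
        simp
      have e2 : Real.exp (-(j * (δ / 2))) = Real.exp (j * δ / 2) * Real.exp (-(j * δ)) := by
        rw [← Real.exp_add]; congr 1; ring
      rw [zero_add, e1, e2]
      have h4 : 0 ≤ δ ^ (1 - r) * Real.exp (-(j * δ)) := by positivity
      have := mul_le_mul_of_nonneg_left h3 h4
      linarith
  refine (Finset.sum_le_sum hterm).trans ?_
  rw [Finset.sum_add_distrib, ← Finset.mul_sum, ← Finset.sum_filter]
  have h1 : ∑ j ∈ Finset.Icc 1 N with j ≤ m, (j : ℝ) ^ (r - 1) ≤ (1 / r + 1) * δ ^ (-r) := by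
    refine le_trans (Finset.sum_le_sum_of_subset_of_nonneg (t := Finset.Icc 1 m) ?_ ?_)
      ((sum_rpow_le r hr m).trans ?_)
    · intro j hj
      simp only [Finset.mem_filter, Finset.mem_Icc] at hj ⊢
      omega
    · intro j _ _; positivity
    · have : (m : ℝ) ≤ 1 / δ := Nat.floor_le (by positivity)
      have h2 : (m : ℝ) ^ r ≤ (1 / δ) ^ r := Real.rpow_le_rpow (by positivity) this hr.le
      rw [one_div, Real.inv_rpow hδ.le, ← Real.rpow_neg hδ.le] at h2
      exact mul_le_mul_of_nonneg_left h2 (by positivity)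
  have h2 := sum_exp_le (δ / 2) (by positivity) N
  have h3 : K * δ ^ (1 - r) * ∑ j ∈ Finset.Icc 1 N, Real.exp (-(j * (δ / 2))) ≤ 2 * K * δ ^ (-r) := by
    refine (mul_le_mul_of_nonneg_left h2 (by positivity)).trans (le_of_eq ?_)
    have : δ ^ (1 - r) = δ * δ ^ (-r) := by
      rw [sub_eq_add_neg, Real.rpow_add hδ, Real.rpow_one]
    rw [this]; field_simp
  linarith

/-- Uniform moment bound. -/
lemma moment_le (a : ℕ → ℕ) (r y D₂ : ℝ) (hr : 0 < r) (hy : 1 ≤ y) (hD₂ : 0 < D₂)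
    (ha : ∀ j : ℕ, 1 ≤ j → (a j : ℝ) ≤ D₂ * (j : ℝ) ^ (r - 1) * y ^ j) :
    ∃ C : ℝ, 0 < C ∧ ∀ (k : ℕ), k ≤ 3 → ∀ σ : ℝ, 0 < σ - Real.log y → ∀ N : ℕ,
      ∑ j ∈ Finset.Icc 1 N, (j : ℝ) ^ k * (a j) * Real.exp (-(j * σ)) / (1 - Real.exp (-(j * σ))) ^ k ≤
        C * (σ - Real.log y) ^ (-(r + k)) := by
  obtain ⟨C, hC, hCs⟩ := sum_rpow_exp_le r hr
  refine ⟨D₂ * 216 * (C * 2 ^ r), by positivity, fun k hk σ hδ N => ?_⟩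
  set δ := σ - Real.log y with hδdef
  have hy0 : 0 < y := by linarith
  have hterm : ∀ j ∈ Finset.Icc 1 N,
      (j : ℝ) ^ k * (a j) * Real.exp (-(j * σ)) / (1 - Real.exp (-(j * σ))) ^ k ≤
      D₂ * 216 * (δ ^ k)⁻¹ * ((j : ℝ) ^ (r - 1) * Real.exp (-(j * (δ / 2)))) := by
    intro j hj
    have hj1 := (Finset.mem_Icc.1 hj).1
    have hj0 : (0 : ℝ) < j := by exact_mod_cast hj1
    set x : ℝ := j * δ with hx
    have hx0 : 0 < x := by positivity
    have hexp : Real.exp (-(j * σ)) = (y ^ j)⁻¹ * Real.exp (-x) := by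
      have : -(j * σ) = -(j * Real.log y) + -x := by rw [hx, hδdef]; ring
      rw [this, Real.exp_add, Real.exp_neg (j * Real.log y), Real.exp_nat_mul, Real.exp_log hy0]
    have hyj : 1 ≤ y ^ j := one_le_pow₀ hy
    have hle : Real.exp (-(j * σ)) ≤ Real.exp (-x) := by
      rw [hexp]
      have := inv_le_one_of_one_le₀ hyj
      have := Real.exp_pos (-x)
      nlinarith
    have h1 : (a j : ℝ) * Real.exp (-(j * σ)) ≤ D₂ * (j : ℝ) ^ (r - 1) * Real.exp (-x) := by
      rw [hexp]
      have h := mul_le_mul_of_nonneg_right (ha j hj1) (by positivity : 0 ≤ (y ^ j)⁻¹ * Real.exp (-x))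
      refine h.trans (le_of_eq ?_)
      field_simp
    have hpos : x / (1 + x) ≤ 1 - Real.exp (-(j * σ)) := by
      have h2 : Real.exp (-x) ≤ 1 / (1 + x) := by
        rw [Real.exp_neg, ← one_div]
        apply one_div_le_one_div_of_le (by linarith)
        have := Real.add_one_le_exp x
        linarith
      have h3 : x / (1 + x) = 1 - 1 / (1 + x) := by field_simp; ring
      linarith
    have hxp : 0 < x / (1 + x) := by positivity
    have h4 : (j : ℝ) ^ k / (1 - Real.exp (-(j * σ))) ^ k ≤ (δ ^ k)⁻¹ * (1 + x) ^ k := by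
      rw [← div_pow, ← inv_pow, ← mul_pow]
      apply pow_le_pow_left₀ (by have : 0 < 1 - Real.exp (-(j * σ)) := by linarith
                                 positivity)
      calc (j : ℝ) / (1 - Real.exp (-(j * σ))) ≤ j / (x / (1 + x)) :=
            div_le_div_of_nonneg_left hj0.le hxp hpos
        _ = δ⁻¹ * (1 + x) := by rw [hx]; field_simp
    have h5 : (1 + x) ^ k * Real.exp (-x) ≤ 216 * Real.exp (-(j * (δ / 2))) := by
      have h6 : 1 + x ≤ 6 * Real.exp (x / 6) := by
        have := Real.add_one_le_exp (x / 6)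
        linarith
      have h7 : (1 + x) ^ k ≤ (1 + x) ^ 3 := pow_le_pow_right₀ (by linarith) hk
      have h8 : (1 + x) ^ 3 ≤ (6 * Real.exp (x / 6)) ^ 3 := pow_le_pow_left₀ (by linarith) h6 3
      have h9 : (6 * Real.exp (x / 6)) ^ 3 = 216 * Real.exp (x / 2) := by
        rw [mul_pow, ← Real.exp_nat_mul]; norm_num; ring
      have h10 : Real.exp (-(j * (δ / 2))) = Real.exp (x / 2) * Real.exp (-x) := by
        rw [← Real.exp_add]; congr 1; rw [hx]; ring
      rw [h10]
      have := mul_le_mul_of_nonneg_right (h7.trans (h8.trans h9.le)) (Real.exp_pos (-x)).le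
      linarith
    calc (j : ℝ) ^ k * (a j) * Real.exp (-(j * σ)) / (1 - Real.exp (-(j * σ))) ^ k
        = ((j : ℝ) ^ k / (1 - Real.exp (-(j * σ))) ^ k) * ((a j) * Real.exp (-(j * σ))) := by ring
      _ ≤ ((δ ^ k)⁻¹ * (1 + x) ^ k) * (D₂ * (j : ℝ) ^ (r - 1) * Real.exp (-x)) :=
          mul_le_mul h4 h1 (by positivity) (by positivity)
      _ = (D₂ * (δ ^ k)⁻¹ * (j : ℝ) ^ (r - 1)) * ((1 + x) ^ k * Real.exp (-x)) := by ring
      _ ≤ (D₂ * (δ ^ k)⁻¹ * (j : ℝ) ^ (r - 1)) * (216 * Real.exp (-(j * (δ / 2)))) :=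
          mul_le_mul_of_nonneg_left h5 (by positivity)
      _ = _ := by ring
  refine (Finset.sum_le_sum hterm).trans ?_
  rw [← Finset.mul_sum]
  refine (mul_le_mul_of_nonneg_left (hCs (δ / 2) (by positivity) N) (by positivity)).trans (le_of_eq ?_)
  rw [neg_add, Real.rpow_add hδ, Real.rpow_neg hδ.le (k : ℝ), Real.rpow_natCast,
    Real.div_rpow hδ.le (by norm_num), Real.rpow_neg (by norm_num : (0:ℝ) ≤ 2) r]
  field_simp


lemma exp_split {y σ : ℝ} (hy : 1 ≤ y) (j : ℕ) :
    Real.exp (-(j * σ)) = (y ^ j)⁻¹ * Real.exp (-(j * (σ - Real.log y))) := by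
  have hy0 : 0 < y := by linarith
  have : -(j * σ) = -(j * Real.log y) + -(j * (σ - Real.log y)) := by ring
  rw [this, Real.exp_add, Real.exp_neg (j * Real.log y), Real.exp_nat_mul, Real.exp_log hy0]

lemma weight_ge {a : ℕ → ℕ} {r y D₁ : ℝ} (hy : 1 ≤ y) (σ : ℝ) (j : ℕ)
    (ha : D₁ * (j : ℝ) ^ (r - 1) * y ^ j ≤ (a j : ℝ)) :
    D₁ * (j : ℝ) ^ (r - 1) * Real.exp (-(j * (σ - Real.log y))) ≤ a j * Real.exp (-(j * σ)) := by
  have hy0 : 0 < y := by linarith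
  rw [exp_split (σ := σ) hy]
  have h := mul_le_mul_of_nonneg_right ha
    (by positivity : 0 ≤ (y ^ j)⁻¹ * Real.exp (-(j * (σ - Real.log y))))
  refine le_trans (le_of_eq ?_) h
  field_simp

lemma weight_le {a : ℕ → ℕ} {r y D₂ : ℝ} (hy : 1 ≤ y) (σ : ℝ) (j : ℕ)
    (ha : (a j : ℝ) ≤ D₂ * (j : ℝ) ^ (r - 1) * y ^ j) :
    a j * Real.exp (-(j * σ)) ≤ D₂ * (j : ℝ) ^ (r - 1) * Real.exp (-(j * (σ - Real.log y))) := by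
  have hy0 : 0 < y := by linarith
  rw [exp_split (σ := σ) hy]
  have h := mul_le_mul_of_nonneg_right ha
    (by positivity : 0 ≤ (y ^ j)⁻¹ * Real.exp (-(j * (σ - Real.log y))))
  refine h.trans (le_of_eq ?_)
  field_simp

/-- A window lower bound for `Mfun`. -/
lemma Mfun_window (a : ℕ → ℕ) (N p q : ℕ) (hpq : p ≤ q) (hq : q ≤ N) (σ β : ℝ) (hσ : 0 < σ)
    (hw : ∀ j, p < j → j ≤ q → β ≤ (j : ℝ) * ((a j) * Real.exp (-(j * σ)))) :
    β * ((q : ℝ) - p) ≤ Mfun a N σ := by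
  unfold Mfun
  have hsub : Finset.Ioc p q ⊆ Finset.Icc 1 N := by
    intro j hj
    rw [Finset.mem_Ioc] at hj
    rw [Finset.mem_Icc]; omega
  have hden : ∀ j : ℕ, 1 ≤ j → 0 < 1 - Real.exp (-(j * σ)) := fun j hj => by
    have := exp_neg_mul_lt_one hσ hj
    linarith
  refine le_trans ?_ (Finset.sum_le_sum_of_subset_of_nonneg hsub fun j hj _ => by
    have := hden j (Finset.mem_Icc.1 hj).1
    positivity)
  have hterm : ∀ j ∈ Finset.Ioc p q, β ≤
      (j : ℝ) * (a j) * Real.exp (-(j * σ)) / (1 - Real.exp (-(j * σ))) := by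
    intro j hj
    rw [Finset.mem_Ioc] at hj
    have h4 := hden j (by omega)
    have h2 := Real.exp_pos (-(j * σ))
    refine (hw j hj.1 hj.2).trans ?_
    rw [le_div_iff₀ h4]
    have : 0 ≤ (j : ℝ) * (a j) * Real.exp (-(j * σ)) := by positivity
    nlinarith
  have := Finset.card_nsmul_le_sum _ _ _ hterm
  rw [Nat.card_Ioc, nsmul_eq_mul, Nat.cast_sub hpq] at this
  linarith

lemma eventually_large (a : ℕ → ℕ) (r y D₁ : ℝ) (hr : 0 < r) (hy : 1 ≤ y) (hD₁ : 0 < D₁)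
    (ha : ∀ j : ℕ, 1 ≤ j → D₁ * (j : ℝ) ^ (r - 1) * y ^ j ≤ (a j : ℝ))
    (σ : ℕ → ℝ) (hσ : ∀ n : ℕ, 1 ≤ n → 0 < σ n ∧ Mfun a n (σ n) = n) (A : ℝ) (hA : 0 ≤ A) :
    ∀ᶠ n : ℕ in atTop, A < n * (σ n - Real.log y) := by
  have ht : Tendsto (fun n : ℕ => ((n : ℝ) / 2) ^ r) atTop atTop :=
    (tendsto_rpow_atTop hr).comp ((tendsto_natCast_atTop_atTop).atTop_div_const (by norm_num))
  filter_upwards [ht.eventually_gt_atTop (2 / (D₁ * Real.exp (-A))), eventually_ge_atTop 1] with n hn hn1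
  by_contra! hcon
  obtain ⟨hs, hM⟩ := hσ n hn1
  have hn0 : (1 : ℝ) ≤ n := by exact_mod_cast hn1
  have h := Mfun_window a n (n / 2) n (by omega) le_rfl (σ n) (D₁ * Real.exp (-A) * ((n : ℝ) / 2) ^ r) hs (by
    intro j hj hjn
    have hj1 : 1 ≤ j := by omega
    have hj0 : (0 : ℝ) < j := by exact_mod_cast hj1
    have hjn' : (j : ℝ) ≤ n := by exact_mod_cast hjn
    have hj2 : (n : ℝ) / 2 ≤ j := by
      have : n ≤ 2 * j := by omega
      have : (n : ℝ) ≤ 2 * j := by exact_mod_cast this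
      linarith
    have h1 := weight_ge hy (σ n) j (ha j hj1)
    have h2 : Real.exp (-A) ≤ Real.exp (-(j * (σ n - Real.log y))) := by
      rw [Real.exp_le_exp]
      rcases le_total 0 (σ n - Real.log y) with h | h
      · have := mul_le_mul_of_nonneg_right hjn' h
        linarith
      · have := mul_nonpos_of_nonneg_of_nonpos hj0.le h
        linarith
    have h3 : ((n : ℝ) / 2) ^ r ≤ (j : ℝ) ^ r := Real.rpow_le_rpow (by positivity) hj2 hr.le
    have h4 : (j : ℝ) * (j : ℝ) ^ (r - 1) = (j : ℝ) ^ r := by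
      rw [Real.rpow_sub hj0, Real.rpow_one]; field_simp
    calc D₁ * Real.exp (-A) * ((n : ℝ) / 2) ^ r
        ≤ D₁ * Real.exp (-(j * (σ n - Real.log y))) * (j : ℝ) ^ r := by gcongr
      _ = j * (D₁ * (j : ℝ) ^ (r - 1) * Real.exp (-(j * (σ n - Real.log y)))) := by rw [← h4]; ring
      _ ≤ _ := mul_le_mul_of_nonneg_left h1 hj0.le)
  rw [hM] at h
  have hE := Real.exp_pos (-A)
  have h5 : ((n / 2 : ℕ) : ℝ) ≤ n / 2 := by
    have := @Nat.cast_div_le ℝ _ _ _ n 2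
    simpa using this
  rw [div_lt_iff₀ (by positivity)] at hn
  have h6 : 2 * ((n : ℝ) / 2) < D₁ * Real.exp (-A) * ((n : ℝ) / 2) ^ r * (n - (n / 2 : ℕ)) :=
    mul_lt_mul (by linarith) (by linarith) (by positivity) (by positivity)
  linarith

/-- The upper bound for the difference of neighbouring probabilities, as a function of `L`. -/
noncomputable def bndU (r D L : ℝ) : ℝ :=
  1 / (D * L ^ (r - 1) * L ^ 3 / 5) + 2 * Real.pi ^ 2 * Real.exp (-(D * L ^ (r - 1) * L / 4))

/-- The lower bound for the point probability, as a function of `L`. -/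
noncomputable def bndL (r D C d L : ℝ) : ℝ :=
  1 / Real.sqrt (C * L ^ (r + 2)) - 4 * (8 * (C * L ^ (r + 3))) / (D * L ^ (r - 1) * L ^ 3 / 5) ^ 2
    - d / (D * L ^ (r - 1) * L ^ 3 / 5) - 4 * Real.pi * Real.exp (-(D * L ^ (r - 1) * L / 4))

lemma bnd_eventually (r D C d : ℝ) (hr : 0 < r) (hD : 0 < D) (hC : 0 < C) (ε : ℝ) (hε : 0 < ε) :
    ∀ᶠ L : ℝ in atTop, 0 < bndL r D C d L ∧ L * bndU r D L ≤ ε * bndL r D C d L := by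
  have tneg : ∀ s : ℝ, 0 < s → Tendsto (fun L : ℝ => L ^ (-s)) atTop (nhds 0) :=
    fun s hs => tendsto_rpow_neg_atTop hs
  have texp : ∀ s : ℝ, Tendsto (fun L : ℝ => L ^ s * Real.exp (-(D / 4 * L ^ r))) atTop (nhds 0) := by
    intro s
    have h := (tendsto_rpow_mul_exp_neg_mul_atTop_nhds_zero (s / r) (D / 4) (by positivity)).comp
      (tendsto_rpow_atTop hr)
    refine h.congr' ?_
    filter_upwards [eventually_gt_atTop 0] with L hL
    simp only [Function.comp]
    rw [← Real.rpow_mul hL.le, mul_div_cancel₀ _ hr.ne', neg_mul]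
  have hsC : 0 < 1 / Real.sqrt C := by positivity
  have tL : Tendsto (fun L : ℝ => 1 / Real.sqrt C - 800 * C / D ^ 2 * L ^ (-(r / 2)) -
      5 * d / D * L ^ (-((r + 2) / 2)) - 4 * Real.pi * (L ^ ((r + 2) / 2) * Real.exp (-(D / 4 * L ^ r))))
      atTop (nhds (1 / Real.sqrt C)) := by
    have := ((tendsto_const_nhds (x := 1 / Real.sqrt C) (f := atTop)).sub
      ((tneg (r / 2) (by positivity)).const_mul (800 * C / D ^ 2))).sub
      ((tneg ((r + 2) / 2) (by positivity)).const_mul (5 * d / D)) |>.sub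
      ((texp ((r + 2) / 2)).const_mul (4 * Real.pi))
    simpa using this
  have tU : Tendsto (fun L : ℝ => 5 / D * L ^ (-(r / 2)) +
      2 * Real.pi ^ 2 * (L ^ ((r + 4) / 2) * Real.exp (-(D / 4 * L ^ r)))) atTop (nhds 0) := by
    have := ((tneg (r / 2) (by positivity)).const_mul (5 / D)).add
      ((texp ((r + 4) / 2)).const_mul (2 * Real.pi ^ 2))
    simpa using this
  have tF := (tL.const_mul ε).sub tU
  filter_upwards [tL.eventually (lt_mem_nhds hsC), tF.eventually (lt_mem_nhds (a := 0) (by rw [sub_zero]; positivity)),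
    eventually_gt_atTop 0] with L h1 h2 hL
  have e1 : D * L ^ (r - 1) * L / 4 = D / 4 * L ^ r := by
    rw [Real.rpow_sub hL, Real.rpow_one]; field_simp
  have e2 : D * L ^ (r - 1) * L ^ 3 / 5 = D / 5 * L ^ (r + 2) := by
    rw [Real.rpow_sub hL, Real.rpow_add hL, Real.rpow_one, Real.rpow_two]; field_simp
  set s := L ^ ((r + 2) / 2) with hs
  have hs0 : 0 < s := Real.rpow_pos_of_pos hL _
  have hss : L ^ (r + 2) = s ^ 2 := by
    rw [hs, ← Real.rpow_natCast, ← Real.rpow_mul hL.le]; congr 1; push_cast; ring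
  have hsn : L ^ (-((r + 2) / 2)) = s⁻¹ := by rw [Real.rpow_neg hL.le]
  have hLs : L ^ ((r + 4) / 2) = L * s := by
    have : (r + 4) / 2 = 1 + (r + 2) / 2 := by ring
    rw [this, Real.rpow_add hL, Real.rpow_one]
  have hr2 : L ^ (-(r / 2)) = L / s := by
    have : -(r / 2) = 1 - (r + 2) / 2 := by ring
    rw [this, Real.rpow_sub hL, Real.rpow_one]
  have hr3 : L ^ (r + 3) = L * s ^ 2 := by
    rw [← hss]
    have : r + 3 = 1 + (r + 2) := by ring
    rw [this, Real.rpow_add hL, Real.rpow_one]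
  have eL : s * bndL r D C d L = 1 / Real.sqrt C - 800 * C / D ^ 2 * L ^ (-(r / 2)) -
      5 * d / D * L ^ (-((r + 2) / 2)) - 4 * Real.pi * (L ^ ((r + 2) / 2) * Real.exp (-(D / 4 * L ^ r))) := by
    unfold bndL
    rw [e1, e2, hss, hsn, hr2, hr3, Real.sqrt_mul hC.le, Real.sqrt_sq hs0.le, ← hs]
    have := Real.sqrt_pos.2 hC
    field_simp
    ring
  have eU : s * (L * bndU r D L) = 5 / D * L ^ (-(r / 2)) +
      2 * Real.pi ^ 2 * (L ^ ((r + 4) / 2) * Real.exp (-(D / 4 * L ^ r))) := by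
    unfold bndU
    rw [e1, e2, hss, hr2, hLs]
    field_simp
  rw [← hs] at eL
  rw [← eL] at h1 h2
  rw [← eU] at h2
  refine ⟨by nlinarith, ?_⟩
  have : 0 < s * (ε * bndL r D C d L - L * bndU r D L) := by linarith
  have := (mul_pos_iff_of_pos_left hs0).1 this
  linarith


lemma rpow_window (r L x : ℝ) (hL : 0 < L) (h1 : L ≤ x) (h2 : x ≤ 6 * L) :
    min 1 ((6 : ℝ) ^ (r - 1)) * L ^ (r - 1) ≤ x ^ (r - 1) := by
  have ht1 : 1 ≤ x / L := by rw [le_div_iff₀ hL]; linarith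
  have ht2 : x / L ≤ 6 := by rw [div_le_iff₀ hL]; linarith
  have hx : x = x / L * L := by field_simp
  have hm : min 1 ((6 : ℝ) ^ (r - 1)) ≤ (x / L) ^ (r - 1) := by
    rcases le_total 0 (r - 1) with h | h
    · exact (min_le_left _ _).trans (Real.one_le_rpow ht1 h)
    · exact (min_le_right _ _).trans (Real.rpow_le_rpow_of_nonpos (by linarith) ht2 h)
  calc _ ≤ (x / L) ^ (r - 1) * L ^ (r - 1) := mul_le_mul_of_nonneg_right hm (by positivity)
    _ = x ^ (r - 1) := by rw [← Real.mul_rpow (by linarith) hL.le, ← hx]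

lemma per_n (a : ℕ → ℕ) (r y D₁ D₂ : ℝ) (hr : 0 < r) (hy : 1 ≤ y) (hD₁ : 0 < D₁) (hD₂ : 0 < D₂)
    (ha1 : ∀ j : ℕ, 1 ≤ j → D₁ * (j : ℝ) ^ (r - 1) * y ^ j ≤ (a j : ℝ))
    (ha2 : ∀ j : ℕ, 1 ≤ j → (a j : ℝ) ≤ D₂ * (j : ℝ) ^ (r - 1) * y ^ j) :
    ∃ D C d : ℝ, 0 < D ∧ 0 < C ∧ ∀ (n l : ℕ) (σ : ℝ), 1 ≤ l → 0 < σ → Mfun a n σ = n →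
      1 ≤ l * (σ - Real.log y) → l * (σ - Real.log y) ≤ 2 → 12 ≤ n * (σ - Real.log y) →
      1 ≤ D * (l : ℝ) ^ (r - 1) * (l : ℝ) ^ 3 →
      2 * Real.pi * |probP a (n + 1) σ (n + 1) - probP a (n + 1) σ n| ≤ bndU r D l ∧
      bndL r D C d l ≤ 2 * Real.pi * probP a (n + 1) σ n := by
  obtain ⟨C, hC, hmom⟩ := moment_le a r y D₂ hr hy hD₂ ha2
  obtain ⟨K, hK, hKb⟩ := exists_rpow_le_exp_half (r + 1)
  set D : ℝ := D₁ * Real.exp (-12) * min 1 ((6 : ℝ) ^ (r - 1)) with hDdef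
  have hm : 0 < min 1 ((6 : ℝ) ^ (r - 1)) := lt_min one_pos (Real.rpow_pos_of_pos (by norm_num) _)
  have hD : 0 < D := by positivity
  refine ⟨D, C, 2 * D₂ * K / D, hD, hC, ?_⟩
  intro n l σ hl hσ hM hl1 hl2 hn12 hV1
  set δ := σ - Real.log y with hδdef
  have hL : (1 : ℝ) ≤ l := by exact_mod_cast hl
  have hL0 : (0 : ℝ) < l := by linarith
  have hδ : 0 < δ := by
    by_contra! h
    have := mul_nonpos_of_nonneg_of_nonpos hL0.le h
    linarith
  have h6 : 6 * l ≤ n := by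
    have : 6 * (l : ℝ) ≤ n := by
      by_contra! h
      have := mul_lt_mul_of_pos_right h hδ
      linarith
    exact_mod_cast this
  have hw : ∀ j, l < j → j ≤ 6 * l → D * (l : ℝ) ^ (r - 1) ≤ (a j) * Real.exp (-(j * σ)) := by
    intro j hj1 hj2
    refine le_trans ?_ (weight_ge hy σ j (ha1 j (by omega)))
    have hj1' : (l : ℝ) ≤ j := by exact_mod_cast hj1.le
    have hj2' : (j : ℝ) ≤ 6 * l := by exact_mod_cast hj2
    have h1 := rpow_window r l j hL0 hj1' hj2'
    have h2 : Real.exp (-12) ≤ Real.exp (-(j * δ)) := by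
      rw [Real.exp_le_exp]
      have := mul_le_mul_of_nonneg_right hj2' hδ.le
      linarith
    calc D * (l : ℝ) ^ (r - 1) = D₁ * (min 1 ((6 : ℝ) ^ (r - 1)) * (l : ℝ) ^ (r - 1)) * Real.exp (-12) := by
          rw [hDdef]; ring
      _ ≤ D₁ * (j : ℝ) ^ (r - 1) * Real.exp (-(j * δ)) := by gcongr
  have hα : 0 < D * (l : ℝ) ^ (r - 1) := by positivity
  have hinv : δ⁻¹ ≤ l := by
    rw [inv_le_iff_one_le_mul₀ hδ]; exact hl1
  have hpw : ∀ s : ℝ, 0 ≤ s → δ ^ (-s) ≤ (l : ℝ) ^ s := by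
    intro s hs
    rw [Real.rpow_neg hδ.le, ← Real.inv_rpow hδ.le]
    exact Real.rpow_le_rpow (by positivity) hinv hs
  have hnlow : D * (l : ℝ) ^ (r + 1) ≤ n := by
    have h := Mfun_window a n l (2 * l) (by omega) (by omega) σ (l * (D * (l : ℝ) ^ (r - 1))) hσ (by
      intro j hj1 hj2
      have hj1' : (l : ℝ) ≤ j := by exact_mod_cast hj1.le
      exact mul_le_mul hj1' (hw j hj1 (by omega)) hα.le (by positivity))
    rw [hM] at h
    refine le_trans (le_of_eq ?_) h
    have : r + 1 = (r - 1) + 2 := by ring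
    rw [this, Real.rpow_add hL0, Real.rpow_two]
    push_cast
    ring
  have hd : |Mfun a (n + 1) σ - n| ≤ 2 * D₂ * K / D := by
    have e : Mfun a (n + 1) σ - n = ((n + 1 : ℕ) : ℝ) * (a (n + 1)) * Real.exp (-((n + 1 : ℕ) * σ)) /
        (1 - Real.exp (-((n + 1 : ℕ) * σ))) := by
      have : Mfun a (n + 1) σ = Mfun a n σ + ((n + 1 : ℕ) : ℝ) * (a (n + 1)) *
          Real.exp (-((n + 1 : ℕ) * σ)) / (1 - Real.exp (-((n + 1 : ℕ) * σ))) := by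
        unfold Mfun
        rw [Finset.sum_Icc_succ_top (by omega)]
      rw [this, hM]; ring
    rw [e]
    set x : ℝ := ((n + 1 : ℕ) : ℝ) with hx
    have hxn : x = n + 1 := by rw [hx]; push_cast; ring
    have hx0 : 0 < x := by rw [hxn]; positivity
    have hxδ : 12 ≤ x * δ := by rw [hxn]; nlinarith
    have hlogy : 0 ≤ Real.log y := Real.log_nonneg hy
    have hu : Real.exp (-(x * σ)) ≤ 1 / 2 := by
      have h1 : x * δ ≤ x * σ := mul_le_mul_of_nonneg_left (by linarith) hx0.le
      have h2 := Real.add_one_le_exp (x * σ)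
      rw [Real.exp_neg, ← one_div]
      exact one_div_le_one_div_of_le (by norm_num) (by linarith)
    have hup := Real.exp_pos (-(x * σ))
    have hwl := weight_le hy σ (n + 1) (ha2 (n + 1) (by omega))
    rw [← hx] at hwl
    rw [abs_of_nonneg (div_nonneg (by positivity) (by linarith)), div_le_div_iff₀ (by linarith) hD]
    -- polynomial times exponential
    have hk := hKb (x * δ) (by linarith)
    have hk2 : (x * δ) ^ (r + 1) * Real.exp (-(x * δ)) ≤ K := by
      have h1 : K * Real.exp (x * δ / 2) * Real.exp (-(x * δ)) ≤ K := by
        rw [mul_assoc, ← Real.exp_add]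
        have : Real.exp (x * δ / 2 + -(x * δ)) ≤ 1 := Real.exp_le_one_iff.2 (by linarith)
        nlinarith
      exact (mul_le_mul_of_nonneg_right hk (Real.exp_pos _).le).trans h1
    have hk3 : x ^ (r + 1) * Real.exp (-(x * δ)) ≤ K * (l : ℝ) ^ (r + 1) := by
      rw [Real.mul_rpow hx0.le hδ.le] at hk2
      have h1 := mul_le_mul hk2 (hpw (r + 1) (by linarith)) (by positivity) hK.le
      refine le_trans (le_of_eq ?_) h1
      rw [Real.rpow_neg hδ.le]
      have : 0 < δ ^ (r + 1) := by positivity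
      field_simp
    have hk4 : x ^ r * Real.exp (-(x * δ)) * D ≤ K := by
      have e1 : x ^ (r + 1) = x ^ r * x := by rw [Real.rpow_add hx0, Real.rpow_one]
      have h1 : x ^ r * Real.exp (-(x * δ)) * (D * (l : ℝ) ^ (r + 1)) ≤ K * (l : ℝ) ^ (r + 1) := by
        refine le_trans ?_ hk3
        rw [e1]
        have : D * (l : ℝ) ^ (r + 1) ≤ x := by linarith
        have := mul_le_mul_of_nonneg_left this (by positivity : 0 ≤ x ^ r * Real.exp (-(x * δ)))
        linarith
      have hp : 0 < (l : ℝ) ^ (r + 1) := by positivity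
      refine le_of_mul_le_mul_right ?_ hp
      linarith
    have hxr : x * x ^ (r - 1) = x ^ r := by
      rw [Real.rpow_sub hx0, Real.rpow_one]; field_simp
    have h7 : x * (a (n + 1)) * Real.exp (-(x * σ)) * D ≤ D₂ * K := by
      have h8 := mul_le_mul_of_nonneg_left hwl hx0.le
      have h9 := mul_le_mul_of_nonneg_right h8 hD.le
      have h10 := mul_le_mul_of_nonneg_left hk4 hD₂.le
      rw [← hxr] at h10
      rw [← hδdef] at h9
      linarith
    have h11 : 0 < D₂ * K := by positivity
    nlinarith
  have hVge := Vfun_ge a (n + 1) l hl σ _ hσ hα (by omega) hw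
  have hV : 1 ≤ Vfun a (n + 1) σ := hV1.trans hVge
  have hVle : Vfun a (n + 1) σ ≤ C * (l : ℝ) ^ (r + 2) := by
    have h1 := hmom 2 (by norm_num) σ hδ (n + 1)
    refine (le_of_eq rfl).trans (h1.trans ?_)
    have := hpw (r + 2) (by linarith)
    exact mul_le_mul_of_nonneg_left (by exact_mod_cast this) hC.le
  have hWle : Wfun a (n + 1) σ ≤ C * (l : ℝ) ^ (r + 3) := by
    have h1 := hmom 3 (by norm_num) σ hδ (n + 1)
    refine (le_of_eq rfl).trans (h1.trans ?_)
    have := hpw (r + 3) (by linarith)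
    exact mul_le_mul_of_nonneg_left (by exact_mod_cast this) hC.le
  obtain ⟨hU, hLo⟩ := fixed_n a l n hl σ _ _ hσ hα (by omega) hw hd hV
  refine ⟨hU, le_trans ?_ hLo⟩
  unfold bndL
  have g1 : 1 / Real.sqrt (C * (l : ℝ) ^ (r + 2)) ≤ 1 / Real.sqrt (Vfun a (n + 1) σ) :=
    one_div_le_one_div_of_le (Real.sqrt_pos.2 (by linarith)) (Real.sqrt_le_sqrt hVle)
  have g2 : 4 * (8 * Wfun a (n + 1) σ) / (D * (l : ℝ) ^ (r - 1) * (l : ℝ) ^ 3 / 5) ^ 2 ≤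
      4 * (8 * (C * (l : ℝ) ^ (r + 3))) / (D * (l : ℝ) ^ (r - 1) * (l : ℝ) ^ 3 / 5) ^ 2 := by
    apply div_le_div_of_nonneg_right _ (by positivity)
    linarith
  linarith


lemma probP_ratio (a : ℕ → ℕ) (N : ℕ) (σ : ℝ) (hσ : 0 < σ) (n : ℕ)
    (h0 : 0 < probP a N σ n) (h1 : 0 < probP a N σ (n + 1)) :
    Real.log ((multisetCount a n : ℝ) / (multisetCount a (n + 1) : ℝ)) =
      -σ - Real.log (probP a N σ (n + 1) / probP a N σ n) := by
  unfold probP at *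
  set Q : ℝ := ∏ j ∈ Finset.Icc 1 N, (1 - Real.exp (-(j * σ))) ^ (a j) with hQ
  have hc0 : (multisetCount a n : ℝ) ≠ 0 := by intro h; rw [h] at h0; simp at h0
  have hc1 : (multisetCount a (n + 1) : ℝ) ≠ 0 := by intro h; rw [h] at h1; simp at h1
  have hQ0 : Q ≠ 0 := by intro h; rw [h] at h0; simp at h0
  rw [Real.log_div hc0 hc1, Real.log_div h1.ne' h0.ne', Real.log_mul (by positivity) hQ0,
    Real.log_mul (by positivity) hQ0, Real.log_mul hc0 (by positivity), Real.log_mul hc1 (by positivity),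
    Real.log_exp, Real.log_exp]
  push_cast
  ring

lemma abs_log_one_add_le (e : ℝ) (he : |e| ≤ 1 / 2) : |Real.log (1 + e)| ≤ 2 * |e| := by
  have h := abs_le.1 he
  have hp : 0 < 1 + e := by linarith
  have h1 := Real.log_le_sub_one_of_pos hp
  have h2 := Real.one_sub_inv_le_log_of_pos hp
  have h3 : 1 - (1 + e)⁻¹ = e / (1 + e) := by field_simp; ring
  rw [h3] at h2
  have h4 : |e / (1 + e)| ≤ 2 * |e| := by
    rw [abs_div, abs_of_pos hp, div_le_iff₀ hp]
    have := abs_nonneg e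
    nlinarith
  rw [abs_le]
  constructor
  · have := neg_abs_le (e / (1 + e))
    linarith
  · have := le_abs_self e
    have := abs_nonneg e
    linarith


/-- under condition (exp),
`c_n/c_{n+1} = y^{-1} exp(-δ_n + o(δ_n))` where `δ_n = σ_n - log y`; equivalently
`(log(c_n/c_{n+1}) + log y)/δ_n → -1`. -/
theorem ratio_delta_asymptotics (a : ℕ → ℕ) (r y : ℝ) (hr : 0 < r) (hy : 1 ≤ y)
    (hexp : ExpansiveCond a r y)
    (σ : ℕ → ℝ) (hσ : ∀ n : ℕ, 1 ≤ n → 0 < σ n ∧ Mfun a n (σ n) = n) :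
    Tendsto (fun n : ℕ =>
      (Real.log ((multisetCount a n : ℝ) / (multisetCount a (n + 1) : ℝ)) + Real.log y) /
        (σ n - Real.log y))
      atTop (nhds (-1)) := by
  obtain ⟨D₁, D₂, hD₁, hD₂, ha⟩ := hexp
  obtain ⟨D, C, d, hD, hC, hper⟩ := per_n a r y D₁ D₂ hr hy hD₁ hD₂ (fun j hj => (ha j hj).1)
    (fun j hj => (ha j hj).2)
  obtain ⟨C₁, hC₁, hmom⟩ := moment_le a r y D₂ hr hy hD₂ (fun j hj => (ha j hj).2)
  have hlarge := eventually_large a r y D₁ hr hy hD₁ (fun j hj => (ha j hj).1) σ hσ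
  -- `δ_n → 0`
  have hsmall : ∀ ε : ℝ, 0 < ε → ∀ᶠ n : ℕ in atTop, σ n - Real.log y < ε := by
    intro ε hε
    filter_upwards [eventually_ge_atTop 1,
      (tendsto_natCast_atTop_atTop (R := ℝ)).eventually_gt_atTop (C₁ * ε ^ (-(r + 1)))] with n hn1 hn
    by_contra! h
    obtain ⟨hs, hM⟩ := hσ n hn1
    have h1 := hmom 1 (by norm_num) (σ n) (by linarith) n
    simp only [pow_one] at h1
    change Mfun a n (σ n) ≤ _ at h1
    rw [hM] at h1
    have h2 : (σ n - Real.log y) ^ (-(r + 1)) ≤ ε ^ (-(r + 1)) :=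
      Real.rpow_le_rpow_of_nonpos hε h (by linarith)
    have h3 := mul_le_mul_of_nonneg_left h2 hC₁.le
    push_cast at h1
    linarith
  have hpos : ∀ᶠ n : ℕ in atTop, 0 < σ n - Real.log y := by
    filter_upwards [hlarge 0 le_rfl] with n hn
    by_contra! h
    have := mul_nonpos_of_nonneg_of_nonpos (Nat.cast_nonneg (α := ℝ) n) h
    linarith
  have hLt : Tendsto (fun n : ℕ => ((⌈1 / (σ n - Real.log y)⌉₊ : ℕ) : ℝ)) atTop atTop := by
    rw [tendsto_atTop]
    intro b
    filter_upwards [hpos, hsmall (1 / (|b| + 1)) (by positivity)] with n h0 h1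
    refine le_trans ?_ (Nat.le_ceil _)
    have hb : (0 : ℝ) < |b| + 1 := by positivity
    rw [lt_div_iff₀ hb] at h1
    rw [le_div_iff₀ h0]
    have := le_abs_self b
    nlinarith
  rw [Metric.tendsto_nhds]
  intro ε hε
  set ε' : ℝ := min (1 / 2) (ε / 4) with hε'
  have hε'0 : 0 < ε' := lt_min (by norm_num) (by positivity)
  have hV : ∀ᶠ L : ℝ in atTop, 1 ≤ D * L ^ (r - 1) * L ^ 3 := by
    have h := (tendsto_rpow_atTop (show 0 < r + 2 by linarith)).eventually_ge_atTop (1 / D)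
    filter_upwards [h, eventually_gt_atTop 0] with L h1 hL
    rw [div_le_iff₀ hD] at h1
    have : r + 2 = (r - 1) + ((3 : ℕ) : ℝ) := by push_cast; ring
    rw [this, Real.rpow_add hL, Real.rpow_natCast] at h1
    linarith
  filter_upwards [eventually_ge_atTop 1, hpos, hsmall 1 one_pos, hlarge 12 (by norm_num),
    hLt.eventually hV, hLt.eventually (bnd_eventually r D C d hr hD hC ε' hε'0)] with n hn1 hδ hδ1 hn12 hV1 hB
  obtain ⟨hs, hM⟩ := hσ n hn1
  set δ := σ n - Real.log y with hδdef
  set l : ℕ := ⌈1 / δ⌉₊ with hl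
  have hl1 : 1 / δ ≤ l := Nat.le_ceil _
  have hl2 : (l : ℝ) < 1 / δ + 1 := Nat.ceil_lt_add_one (by positivity)
  have hlpos : 1 ≤ l := Nat.ceil_pos.2 (by positivity)
  have hlδ1 : 1 ≤ l * δ := by rwa [div_le_iff₀ hδ] at hl1
  have hlδ2 : l * δ ≤ 2 := by
    have h1 := mul_le_mul_of_nonneg_right hl2.le hδ.le
    have h2 : (1 / δ + 1) * δ = 1 + δ := by field_simp
    linarith
  obtain ⟨hU, hLo⟩ := hper n l (σ n) hlpos hs hM hlδ1 hlδ2 hn12.le hV1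
  obtain ⟨hB1, hB2⟩ := hB
  set P0 := probP a (n + 1) (σ n) n with hP0
  set P1 := probP a (n + 1) (σ n) (n + 1) with hP1
  have hpi := Real.pi_pos
  have hP0pos : 0 < P0 := by
    have : 0 < 2 * Real.pi * P0 := lt_of_lt_of_le hB1 hLo
    exact (mul_pos_iff_of_pos_left (by positivity)).1 this
  have hL0 : (0 : ℝ) < l := by exact_mod_cast hlpos
  -- relative difference
  have hdiff : l * |P1 - P0| ≤ ε' * P0 := by
    have h1 := mul_le_mul_of_nonneg_left hU hL0.le
    have h2 := mul_le_mul_of_nonneg_left hLo hε'0.le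
    have h3 : 2 * Real.pi * (l * |P1 - P0|) ≤ 2 * Real.pi * (ε' * P0) := by linarith
    exact le_of_mul_le_mul_left h3 (by positivity)
  set e := (P1 - P0) / P0 with he
  have hle : l * |e| ≤ ε' := by
    rw [he, abs_div, abs_of_pos hP0pos, ← mul_div_assoc, div_le_iff₀ hP0pos]
    exact hdiff
  have hL1 : (1 : ℝ) ≤ l := by exact_mod_cast hlpos
  have he2 : |e| ≤ 1 / 2 := by
    have h1 : ε' ≤ 1 / 2 := min_le_left _ _
    have := abs_nonneg e
    nlinarith
  have hP1e : P1 / P0 = 1 + e := by rw [he]; field_simp; ring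
  have hP1pos : 0 < P1 := by
    have h1 : 0 < P1 / P0 := by
      rw [hP1e]
      have := (abs_le.1 he2).1
      linarith
    exact (div_pos_iff_of_pos_right hP0pos).1 h1
  rw [probP_ratio a (n + 1) (σ n) hs n hP0pos hP1pos, ← hP0, ← hP1, hP1e, Real.dist_eq]
  have e1 : (-σ n - Real.log (1 + e) + Real.log y) / δ - -1 = -(Real.log (1 + e) / δ) := by
    rw [hδdef] at hδ ⊢
    field_simp
    ring
  rw [e1, abs_neg, abs_div, abs_of_pos hδ, div_lt_iff₀ hδ]
  have h1 := abs_log_one_add_le e he2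
  have h2 : |e| ≤ ε' * δ := by
    have h3 := mul_le_mul_of_nonneg_right hle hδ.le
    have h4 := mul_le_mul_of_nonneg_right hlδ1 (abs_nonneg e)
    linarith
  have h5 : ε' ≤ ε / 4 := min_le_right _ _
  have h6 := mul_le_mul_of_nonneg_right h5 hδ.le
  have h7 : 0 < ε * δ := by positivity
  linarith
end
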